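/- arXiv:1602.06901 — 2 statements merged into one kernel-verified Lean document; each statement's English description precedes it below -/
import Mathlib

section
/- Let F be a field of characteristic 2 with I_q³F = 0 and 2 ≤ u(F) < ∞. Then there exists a central simple F-algebra of exponent 2 whose symbol length is exactly u(F)/2 − 1; hence the bound u(F)/2 − 1 on the symbol length of exponent-2 algebras over F is sharp. -/
open scoped TensorProduct

/-- The defining relations of the symbol `p`-algebra
`[a,b)_{p,F} = F⟨x,y : x^p - x = a, y^p = b, yx - xy = y⟩`. -/
inductive SymbolRel (F : Type) [Field F] (p : ℕ) (a b : F) :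
    FreeAlgebra F (Fin 2) → FreeAlgebra F (Fin 2) → Prop
  | x : SymbolRel F p a b (FreeAlgebra.ι F 0 ^ p - FreeAlgebra.ι F 0) (algebraMap F _ a)
  | y : SymbolRel F p a b (FreeAlgebra.ι F 1 ^ p) (algebraMap F _ b)
  | comm : SymbolRel F p a b
      (FreeAlgebra.ι F 1 * FreeAlgebra.ι F 0 - FreeAlgebra.ι F 0 * FreeAlgebra.ι F 1)
      (FreeAlgebra.ι F 1)

/-- The symbol `p`-algebra `[a,b)_{p,F}`. -/
abbrev SymbolAlg (F : Type) [Field F] (p : ℕ) (a b : F) : Type :=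
  RingQuot (SymbolRel F p a b)

/-- The nonsingular quadratic form `[a₁,b₁] ⊥ ⋯ ⊥ [aₙ,bₙ]` over a field of
characteristic 2, where `[a,b](u,v) = a·u² + u·v + b·v²`. -/
def binSum (F : Type) [Field F] {n : ℕ} (a b : Fin n → F) : (Fin n → F × F) → F :=
  fun v => ∑ i, (a i * (v i).1 ^ 2 + (v i).1 * (v i).2 + b i * (v i).2 ^ 2)

/-- The form `[a₁,b₁] ⊥ ⋯ ⊥ [aₙ,bₙ]` is anisotropic: it has no nontrivial zero. -/
def AnisoBin (F : Type) [Field F] {n : ℕ} (a b : Fin n → F) : Prop :=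
  ∀ v : Fin n → F × F, binSum F a b v = 0 → v = 0

/-- Two `F`-algebras are Brauer equivalent if they become isomorphic after tensoring
with matrix algebras, i.e. `M_n(A) ≅ M_m(B)` for some positive `n`, `m`. -/
def BrauerEquiv (F A B : Type) [Field F] [Ring A] [Ring B] [Algebra F A] [Algebra F B] :
    Prop :=
  ∃ (n m : ℕ), 0 < n ∧ 0 < m ∧
    Nonempty (Matrix (Fin n) (Fin n) A ≃ₐ[F] Matrix (Fin m) (Fin m) B)

namespace CharTwoWitt

open Module

section Lagrangian

variable {F V U : Type*} [Field F] [AddCommGroup V] [Module F V] [AddCommGroup U] [Module F U]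

/-- A quadratic form is nonsingular if its polar form has trivial radical. -/
def Nonsing (Q : QuadraticForm F V) : Prop :=
  ∀ x, (∀ y, QuadraticMap.polar Q x y = 0) → x = 0

/-- A nonsingular quadratic form is hyperbolic if it vanishes on a subspace of half the
dimension. -/
def Hyp (Q : QuadraticForm F V) : Prop :=
  ∃ L : Submodule F V, (∀ x ∈ L, Q x = 0) ∧ finrank F V ≤ 2 * finrank F L

theorem hyp_of_injective [FiniteDimensional F V] {Q : QuadraticForm F V} (f : U →ₗ[F] V)
    (hf : Function.Injective f) (h : ∀ x, Q (f x) = 0) (hd : finrank F V ≤ 2 * finrank F U) :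
    Hyp Q := by
  refine ⟨LinearMap.range f, ?_, ?_⟩
  · rintro _ ⟨x, rfl⟩
    exact h x
  · rwa [LinearMap.finrank_range_of_inj hf]

theorem Hyp.of_linearEquiv [FiniteDimensional F V] [FiniteDimensional F U]
    {Q : QuadraticForm F V} {R : QuadraticForm F U} (h : Hyp Q)
    (e : V ≃ₗ[F] U) (he : ∀ x, R (e x) = Q x) : Hyp R := by
  obtain ⟨L, hL, hd⟩ := h
  refine hyp_of_injective (e.toLinearMap ∘ₗ L.subtype)
    (e.injective.comp L.injective_subtype) (fun x => ?_) ?_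
  · simpa [he] using hL x x.2
  · rwa [← e.finrank_eq]

theorem Hyp.prod [FiniteDimensional F V] [FiniteDimensional F U]
    {Q : QuadraticForm F V} {R : QuadraticForm F U} (hQ : Hyp Q) (hR : Hyp R) :
    Hyp (Q.prod R) := by
  obtain ⟨L, hL, hd⟩ := hQ
  obtain ⟨M, hM, hd'⟩ := hR
  refine hyp_of_injective (LinearMap.prodMap L.subtype M.subtype)
    (L.injective_subtype.prodMap M.injective_subtype) (fun x => ?_) ?_
  · simp [hL _ x.1.2, hM _ x.2.2]
  · rw [finrank_prod, finrank_prod]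
    omega

theorem Nonsing.prod {Q : QuadraticForm F V} {R : QuadraticForm F U} (hQ : Nonsing Q)
    (hR : Nonsing R) : Nonsing (Q.prod R) := by
  intro x hx
  refine Prod.ext (hQ _ fun y => ?_) (hR _ fun y => ?_)
  · simpa using hx (y, 0)
  · simpa using hx (0, y)

theorem Nonsing.nondegenerate [FiniteDimensional F V] {Q : QuadraticForm F V} (hQ : Nonsing Q) :
    LinearMap.BilinForm.Nondegenerate Q.polarBilin :=
  .ofSeparatingLeft fun x hx => hQ x hx

theorem orthogonal_eq_self [FiniteDimensional F V] {Q : QuadraticForm F V} (hQ : Nonsing Q)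
    {L : Submodule F V} (hL : ∀ x ∈ L, Q x = 0) (hd : finrank F V ≤ 2 * finrank F L) :
    LinearMap.BilinForm.orthogonal Q.polarBilin L = L ∧ finrank F V = 2 * finrank F L := by
  have hle : L ≤ LinearMap.BilinForm.orthogonal Q.polarBilin L := by
    intro x hx
    rw [LinearMap.BilinForm.mem_orthogonal_iff]
    intro y hy
    change QuadraticMap.polar Q y x = 0
    simp [QuadraticMap.polar, hL _ hx, hL _ hy, hL _ (L.add_mem hy hx)]
  have hfo := LinearMap.BilinForm.finrank_orthogonal hQ.nondegenerate L
  have hLV := L.finrank_le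
  have heq := Submodule.eq_of_le_of_finrank_le hle (by omega)
  refine ⟨heq.symm, ?_⟩
  rw [← heq] at hfo
  omega

theorem finrank_inf_orthogonal [FiniteDimensional F V] {Q : QuadraticForm F V} (hQ : Nonsing Q)
    {L : Submodule F V} (hL : ∀ x ∈ L, Q x = 0) (hd : finrank F V ≤ 2 * finrank F L)
    (P : Submodule F V) :
    finrank F ↥(L ⊓ LinearMap.BilinForm.orthogonal Q.polarBilin P) + finrank F P =
      finrank F L + finrank F ↥(L ⊓ P) := by
  obtain ⟨heq, hdim⟩ := orthogonal_eq_self hQ hL hd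
  have hsup : L ⊓ LinearMap.BilinForm.orthogonal Q.polarBilin P =
      LinearMap.BilinForm.orthogonal Q.polarBilin (L ⊔ P) := by
    conv_lhs => rw [← heq]
    apply le_antisymm
    · rintro x ⟨h1, h2⟩
      rw [LinearMap.BilinForm.mem_orthogonal_iff]
      intro n hn
      obtain ⟨y, hy, z, hz, rfl⟩ := Submodule.mem_sup.1 hn
      have h1' : Q.polarBilin y x = 0 := h1 y hy
      have h2' : Q.polarBilin z x = 0 := h2 z hz
      change Q.polarBilin (y + z) x = 0
      rw [map_add, LinearMap.add_apply, h1', h2', add_zero]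
    · exact le_inf (LinearMap.BilinForm.orthogonal_le le_sup_left)
        (LinearMap.BilinForm.orthogonal_le le_sup_right)
  rw [hsup, LinearMap.BilinForm.finrank_orthogonal hQ.nondegenerate]
  have := Submodule.finrank_sup_add_finrank_inf_eq L P
  have := (L ⊔ P).finrank_le
  omega

theorem mem_orthogonal_map_inr {Q : QuadraticForm F V} {R : QuadraticForm F U}
    {M : Submodule F U} {x : V × U}
    (hx : x ∈ LinearMap.BilinForm.orthogonal (Q.prod R).polarBilin
      (M.map (LinearMap.inr F V U))) :
    x.2 ∈ LinearMap.BilinForm.orthogonal R.polarBilin M := by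
  intro m hm
  have h : QuadraticMap.polar (Q.prod R) (0, m) x = 0 := hx (0, m) ⟨m, hm, rfl⟩
  change QuadraticMap.polar R m x.2 = 0
  simpa using h

theorem finrank_map_inr (M : Submodule F U) :
    finrank F (M.map (LinearMap.inr F V U)) = finrank F M :=
  ((Submodule.equivMapOfInjective _ LinearMap.inr_injective M).finrank_eq).symm

/-- Witt cancellation of a hyperbolic summand. -/
theorem Hyp.cancel_right [FiniteDimensional F V] [FiniteDimensional F U]
    {Q : QuadraticForm F V} {R : QuadraticForm F U} (hQ : Nonsing Q) (hR : Nonsing R)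
    (h : Hyp (Q.prod R)) (hRh : Hyp R) : Hyp Q := by
  obtain ⟨L, hL, hd⟩ := h
  obtain ⟨M, hM, hd'⟩ := hRh
  obtain ⟨hM', hdM⟩ := orthogonal_eq_self hR hM hd'
  have key := finrank_inf_orthogonal (hQ.prod hR) hL hd (M.map (LinearMap.inr F V U))
  set L₁ := L ⊓ LinearMap.BilinForm.orthogonal (Q.prod R).polarBilin
    (M.map (LinearMap.inr F V U)) with hL₁
  have hmem : ∀ x ∈ L₁, x.2 ∈ M := fun x hx => by
    rw [← hM']
    exact mem_orthogonal_map_inr hx.2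
  let g : L₁ →ₗ[F] V := LinearMap.fst F V U ∘ₗ L₁.subtype
  refine ⟨LinearMap.range g, ?_, ?_⟩
  · rintro _ ⟨x, rfl⟩
    have h1 := hL _ x.2.1
    rw [QuadraticMap.prod_apply, hM _ (hmem _ x.2), add_zero] at h1
    exact h1
  · have hker : finrank F (LinearMap.ker g) ≤
        finrank F ↥(L ⊓ M.map (LinearMap.inr F V U)) := by
      rw [(Submodule.equivMapOfInjective _ L₁.injective_subtype (LinearMap.ker g)).finrank_eq]
      apply Submodule.finrank_mono
      rintro _ ⟨x, hx, rfl⟩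
      refine ⟨x.2.1, x.1.2, hmem _ x.2, ?_⟩
      exact Prod.ext (LinearMap.mem_ker.1 hx).symm rfl
    have := g.finrank_range_add_finrank_ker
    rw [finrank_map_inr] at key
    rw [finrank_prod] at hd
    omega

/-- If an anisotropic form is Witt equivalent to a form with a totally isotropic subspace `M`,
then its dimension is bounded by that of the latter minus twice the dimension of `M`. -/
theorem finrank_add_le_of_hyp_prod [FiniteDimensional F V] [FiniteDimensional F U]
    {Q : QuadraticForm F V} {R : QuadraticForm F U} (hQ : Nonsing Q) (hR : Nonsing R)
    (hQa : ∀ x, Q x = 0 → x = 0) (h : Hyp (Q.prod R)) (M : Submodule F U)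
    (hM : ∀ x ∈ M, R x = 0) : finrank F V + 2 * finrank F M ≤ finrank F U := by
  obtain ⟨L, hL, hd⟩ := h
  have key := finrank_inf_orthogonal (hQ.prod hR) hL hd (M.map (LinearMap.inr F V U))
  set L₁ := L ⊓ LinearMap.BilinForm.orthogonal (Q.prod R).polarBilin
    (M.map (LinearMap.inr F V U)) with hL₁
  have hfst : ∀ x ∈ L, R x.2 = 0 → x.1 = 0 := fun x hx h0 => by
    have h1 := hL _ hx
    rw [QuadraticMap.prod_apply, h0, add_zero] at h1
    exact hQa _ h1
  let g : L₁ →ₗ[F] U := LinearMap.snd F V U ∘ₗ L₁.subtype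
  have hg : Function.Injective g := by
    rw [injective_iff_map_eq_zero]
    intro x hx
    have hx' : (x : V × U).2 = 0 := hx
    exact Subtype.ext (Prod.ext (hfst _ x.2.1 (by rw [hx', map_zero])) hx')
  have hrange := LinearMap.finrank_range_of_inj hg
  have hinf : finrank F ↥(LinearMap.range g ⊓ M) ≤
      finrank F ↥(L ⊓ M.map (LinearMap.inr F V U)) := by
    rw [← finrank_map_inr (V := V)]
    apply Submodule.finrank_mono
    rintro _ ⟨_, ⟨⟨x, rfl⟩, hx⟩, rfl⟩
    refine ⟨?_, _, hx, rfl⟩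
    have h0 : (x : V × U).1 = 0 := hfst _ x.2.1 (hM _ hx)
    have : LinearMap.inr F V U (g x) = x := Prod.ext h0.symm rfl
    rw [this]
    exact x.2.1
  have hsup : LinearMap.range g ⊔ M ≤ LinearMap.BilinForm.orthogonal R.polarBilin M := by
    refine sup_le ?_ fun x hx y hy => ?_
    · rintro _ ⟨x, rfl⟩
      exact mem_orthogonal_map_inr x.2.2
    · change QuadraticMap.polar R y x = 0
      simp [QuadraticMap.polar, hM _ hx, hM _ hy, hM _ (M.add_mem hy hx)]
  have h1 := Submodule.finrank_mono hsup
  rw [LinearMap.BilinForm.finrank_orthogonal hR.nondegenerate] at h1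
  have h2 := Submodule.finrank_sup_add_finrank_inf_eq (LinearMap.range g) M
  have h3 := M.finrank_le
  rw [finrank_map_inr] at key
  rw [finrank_prod] at hd
  omega

end Lagrangian

section

/-- A finite-dimensional nonsingular quadratic space. -/
structure QSpace (F : Type) [Field F] where
  /-- The underlying vector space. -/
  V : Type
  [acg : AddCommGroup V]
  [mod : Module F V]
  [fd : FiniteDimensional F V]
  /-- The quadratic form. -/
  Q : QuadraticForm F V
  nonsing : Nonsing Q

attribute [instance] QSpace.acg QSpace.mod QSpace.fd

variable {F : Type} [Field F]

/-- The orthogonal sum of two quadratic spaces. -/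
def QSpace.sum (X Y : QSpace F) : QSpace F where
  V := X.V × Y.V
  Q := X.Q.prod Y.Q
  nonsing := X.nonsing.prod Y.nonsing

/-- The zero quadratic space. -/
def QSpace.zero : QSpace F where
  V := PUnit
  Q := 0
  nonsing := fun _ _ => rfl

/-- The binary form `[a, b] = a u² + u v + b v²`. -/
def binForm (a b : F) : QuadraticForm F (F × F) :=
  a • QuadraticMap.sq.comp (LinearMap.fst F F F) +
    QuadraticMap.linMulLin (LinearMap.fst F F F) (LinearMap.snd F F F) +
    b • QuadraticMap.sq.comp (LinearMap.snd F F F)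

@[simp]
theorem binForm_apply (a b : F) (x : F × F) :
    binForm a b x = a * x.1 ^ 2 + x.1 * x.2 + b * x.2 ^ 2 := by
  simp [binForm, sq]

variable [CharP F 2]

theorem hyp_prod_of_linearEquiv {X Y : QSpace F} (e : X.V ≃ₗ[F] Y.V)
    (he : ∀ x, Y.Q (e x) = X.Q x) : Hyp (X.Q.prod Y.Q) := by
  refine hyp_of_injective (LinearMap.prod LinearMap.id e.toLinearMap)
    (fun x y h => congrArg Prod.fst h) (fun x => ?_) ?_
  · simp [he, CharTwo.add_self_eq_zero]
  · rw [finrank_prod, ← e.finrank_eq]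
    omega

/-- Witt equivalence of quadratic spaces in characteristic two. -/
instance wittSetoid (F : Type) [Field F] [CharP F 2] : Setoid (QSpace F) where
  r X Y := Hyp (X.Q.prod Y.Q)
  iseqv := by
    refine ⟨fun X => ?_, fun {X Y} h => ?_, fun {X Y Z} h₁ h₂ => ?_⟩
    · exact hyp_prod_of_linearEquiv (LinearEquiv.refl F X.V) fun _ => rfl
    · exact h.of_linearEquiv (LinearEquiv.prodComm F X.V Y.V) fun x => by simp [add_comm]
    · refine Hyp.cancel_right (R := Y.Q.prod Y.Q) (X.nonsing.prod Z.nonsing)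
        (Y.nonsing.prod Y.nonsing) ?_ (hyp_prod_of_linearEquiv (LinearEquiv.refl F Y.V)
          fun _ => rfl)
      refine (h₁.prod h₂).of_linearEquiv
        ((LinearEquiv.prodCongr (LinearEquiv.refl F _) (LinearEquiv.prodComm F Y.V Z.V)).trans
          (LinearEquiv.prodProdProdComm F X.V Y.V Z.V Y.V)) fun x => ?_
      simp
      ring

/-- The Witt group of nonsingular quadratic forms in characteristic two. -/
def Witt (F : Type) [Field F] [CharP F 2] : Type 1 := Quotient (wittSetoid F)

/-- The Witt class of a quadratic space. -/
def Witt.mk (X : QSpace F) : Witt F := Quotient.mk _ X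

theorem Witt.mk_eq_iff {X Y : QSpace F} : Witt.mk X = Witt.mk Y ↔ Hyp (X.Q.prod Y.Q) :=
  Quotient.eq

theorem Witt.mk_eq_of_linearEquiv {X Y : QSpace F} (e : X.V ≃ₗ[F] Y.V)
    (he : ∀ x, Y.Q (e x) = X.Q x) : Witt.mk X = Witt.mk Y :=
  Witt.mk_eq_iff.2 (hyp_prod_of_linearEquiv e he)

instance : Add (Witt F) where
  add := Quotient.map₂ QSpace.sum fun X X' h Y Y' h' =>
    (Hyp.prod h h').of_linearEquiv (LinearEquiv.prodProdProdComm F X.V X'.V Y.V Y'.V)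
      fun x => by
        change X.Q x.1.1 + Y.Q x.2.1 + (X'.Q x.1.2 + Y'.Q x.2.2) =
          X.Q x.1.1 + X'.Q x.1.2 + (Y.Q x.2.1 + Y'.Q x.2.2)
        ring

instance : Zero (Witt F) where
  zero := Witt.mk QSpace.zero

theorem Witt.mk_zero : (Witt.mk QSpace.zero : Witt F) = 0 := rfl

theorem Witt.mk_eq_zero_iff {X : QSpace F} : Witt.mk X = 0 ↔ Hyp X.Q := by
  rw [← Witt.mk_zero, Witt.mk_eq_iff]
  let e : (X.V × PUnit) ≃ₗ[F] X.V := LinearEquiv.prodUnique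
  refine ⟨fun h => h.of_linearEquiv (U := X.V) e fun x => ?_,
    fun h => h.of_linearEquiv (U := X.V × PUnit) e.symm fun x => ?_⟩
  · change X.Q x.1 = X.Q x.1 + 0
    rw [add_zero]
  · change X.Q x + 0 = X.Q x
    rw [add_zero]

instance : Neg (Witt F) := ⟨id⟩

instance : AddCommGroup (Witt F) where
  add_assoc := by
    rintro ⟨X⟩ ⟨Y⟩ ⟨Z⟩
    exact Witt.mk_eq_of_linearEquiv (X := (X.sum Y).sum Z) (Y := X.sum (Y.sum Z))
      (LinearEquiv.prodAssoc F X.V Y.V Z.V) fun x => (add_assoc _ _ _).symm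
  zero_add := by
    rintro ⟨X⟩
    exact Witt.mk_eq_of_linearEquiv (X := QSpace.zero.sum X) (Y := X)
      (LinearEquiv.uniqueProd : (PUnit × X.V) ≃ₗ[F] X.V) fun x => (zero_add _).symm
  add_zero := by
    rintro ⟨X⟩
    exact Witt.mk_eq_of_linearEquiv (X := X.sum QSpace.zero) (Y := X)
      (LinearEquiv.prodUnique : (X.V × PUnit) ≃ₗ[F] X.V) fun x => (add_zero _).symm
  add_comm := by
    rintro ⟨X⟩ ⟨Y⟩
    exact Witt.mk_eq_of_linearEquiv (X := X.sum Y) (Y := Y.sum X)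
      (LinearEquiv.prodComm F X.V Y.V) fun x => add_comm _ _
  nsmul := nsmulRec
  zsmul := zsmulRec
  neg_add_cancel := by
    rintro ⟨X⟩
    exact Witt.mk_eq_zero_iff.2 (hyp_prod_of_linearEquiv (LinearEquiv.refl F X.V) fun _ => rfl)

theorem Witt.add_self (w : Witt F) : w + w = 0 := neg_add_cancel w

theorem Witt.eq_of_add_eq_zero {v w : Witt F} (h : v + w = 0) : v = w :=
  add_right_cancel (h.trans (Witt.add_self w).symm)

theorem binForm_nonsing (a b : F) : Nonsing (binForm a b) := by
  intro x hx
  have h1 := hx (0, 1)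
  have h2 := hx (1, 0)
  have h : (2 : F) = 0 := CharTwo.two_eq_zero
  simp only [QuadraticMap.polar, binForm_apply, Prod.fst_add, Prod.snd_add] at h1 h2
  refine Prod.ext ?_ ?_
  · change x.1 = 0
    linear_combination h1 - b * x.2 * h
  · change x.2 = 0
    linear_combination h2 - a * x.1 * h

/-- The quadratic space of the binary form `[a, b]`. -/
def binSpace (a b : F) : QSpace F where
  V := F × F
  Q := binForm a b
  nonsing := binForm_nonsing a b

/-- The Witt class of the binary form `[a, b]`. -/
def br (a b : F) : Witt F := Witt.mk (binSpace a b)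

theorem br_eq_br {a b c d : F} (h : Hyp ((binForm a b).prod (binForm c d))) :
    br a b = br c d :=
  Witt.mk_eq_iff.2 h

theorem br_add_left (a a' b : F) : br (a + a') b = br a b + br a' b := by
  have h : (2 : F) = 0 := CharTwo.two_eq_zero
  have key : Hyp (((binForm a b).prod (binForm a' b)).prod (binForm (a + a') b)) := by
    let f : F × F × F →ₗ[F] ((F × F) × (F × F)) × (F × F) :=
      { toFun := fun p => (((p.1, p.2.1), (p.1, p.2.2)), (p.1, p.2.1 + p.2.2))
        map_add' := fun p q => by simp; ring
        map_smul' := fun c p => by simp; ring }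
    refine hyp_of_injective f (fun p q h => ?_) (fun p => ?_) (by simp)
    · simp only [f, LinearMap.coe_mk, AddHom.coe_mk, Prod.mk.injEq] at h
      exact Prod.ext h.1.1.1 (Prod.ext h.1.1.2 h.1.2.2)
    · simp only [QuadraticMap.prod_apply, binForm_apply, f, LinearMap.coe_mk, AddHom.coe_mk]
      linear_combination ((a + a') * p.1 ^ 2 + p.1 * (p.2.1 + p.2.2) +
        b * (p.2.1 ^ 2 + p.2.1 * p.2.2 + p.2.2 ^ 2)) * h
  exact (Witt.eq_of_add_eq_zero (Witt.mk_eq_zero_iff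
    (X := ((binSpace a b).sum (binSpace a' b)).sum (binSpace (a + a') b)) |>.2 key)).symm

theorem br_comm (a b : F) : br a b = br b a := by
  have h (x : F × F) : binForm b a (x.2, x.1) = binForm a b x := by
    simp only [binForm_apply]
    ring
  exact Witt.mk_eq_of_linearEquiv (X := binSpace a b) (Y := binSpace b a)
    (LinearEquiv.prodComm F F F) h

theorem br_add_right (a b b' : F) : br a (b + b') = br a b + br a b' := by
  rw [br_comm, br_add_left, br_comm b, br_comm b']

theorem br_mul_sq (a b e : F) : br (a * e ^ 2) b = br a (b * e ^ 2) := by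
  have h : (2 : F) = 0 := CharTwo.two_eq_zero
  let f : F × F →ₗ[F] (F × F) × (F × F) :=
    { toFun := fun p => ((p.1, e * p.2), (e * p.1, p.2))
      map_add' := fun p q => by simp [mul_add]
      map_smul' := fun c p => by simp [mul_left_comm] }
  refine br_eq_br (hyp_of_injective f (fun p q h => ?_) (fun p => ?_) (by simp))
  · simp only [f, LinearMap.coe_mk, AddHom.coe_mk, Prod.mk.injEq] at h
    exact Prod.ext h.1.1 h.2.2
  · simp only [QuadraticMap.prod_apply, binForm_apply, f, LinearMap.coe_mk, AddHom.coe_mk]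
    linear_combination (a * e ^ 2 * p.1 ^ 2 + e * p.1 * p.2 + b * e ^ 2 * p.2 ^ 2) * h

theorem br_eq_zero {a b : F} (x : F × F) (hx : x ≠ 0)
    (h : a * x.1 ^ 2 + x.1 * x.2 + b * x.2 ^ 2 = 0) : br a b = 0 := by
  have key : Hyp (binForm a b) := by
    refine hyp_of_injective (LinearMap.toSpanSingleton F _ x)
      (smul_left_injective F hx) (fun p => ?_) (by simp)
    rw [LinearMap.toSpanSingleton_apply, QuadraticMap.map_smul, binForm_apply, h, smul_zero]
  exact Witt.mk_eq_zero_iff.2 key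

theorem br_artinSchreier (a c : F) : br a (a * c ^ 2 + c) = 0 := by
  refine br_eq_zero (c, 1) (fun h => one_ne_zero (congrArg Prod.snd h)) ?_
  linear_combination (a * c ^ 2 + c) * (CharTwo.two_eq_zero : (2 : F) = 0)

/-- The values of `[1, c]` are similarity factors of `[1, c]`. -/
theorem br_norm {c d e : F} (x : F × F) (hx : x.1 ^ 2 + x.1 * x.2 + c * x.2 ^ 2 = d)
    (hd : d ≠ 0) (he : e ≠ 0) : br (e * d) (c / (e * d)) = br e (c / e) := by
  have h : (2 : F) = 0 := CharTwo.two_eq_zero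
  let f : F × F →ₗ[F] (F × F) × (F × F) :=
    { toFun := fun p => ((p.1, e * d * p.2),
        (x.1 * p.1 + c * x.2 * p.2, e * (x.1 * p.2 + x.2 * p.1 + x.2 * p.2)))
      map_add' := fun p q => by ext <;> simp <;> ring
      map_smul' := fun c p => by ext <;> simp <;> ring }
  refine br_eq_br (hyp_of_injective f (fun p q h => ?_) (fun p => ?_) (by simp))
  · simp only [f, LinearMap.coe_mk, AddHom.coe_mk, Prod.mk.injEq] at h
    exact Prod.ext h.1.1 (mul_left_cancel₀ (mul_ne_zero he hd) h.1.2)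
  · simp only [QuadraticMap.prod_apply, binForm_apply, f, LinearMap.coe_mk, AddHom.coe_mk]
    have h3 : ∀ z w : F, w ≠ 0 → c / w * (w * z) ^ 2 = c * w * z ^ 2 := fun z w hw => by
      field_simp
    rw [h3 _ _ (mul_ne_zero he hd), h3 _ _ he, ← hx]
    grind

theorem br_zero_left (b : F) : br 0 b = 0 := by
  have := br_add_left 0 0 b
  rwa [add_zero, Witt.add_self] at this

theorem br_zero_right (b : F) : br b 0 = 0 := by
  rw [br_comm, br_zero_left]

end

section

variable {F : Type} [Field F] [CharP F 2]

/-- The Witt class of the binary form `a [1, c] = [a, c / a]`. -/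
def sc (c a : F) : Witt F := br a (c / a)

theorem sc_zero (c : F) : sc c 0 = 0 := br_zero_left _

theorem sc_mul_norm {c d : F} (e : F) (x : F × F)
    (hx : x.1 ^ 2 + x.1 * x.2 + c * x.2 ^ 2 = d) (hd : d ≠ 0) : sc c (e * d) = sc c e := by
  rcases eq_or_ne e 0 with rfl | he
  · rw [zero_mul]
  · exact br_norm x hx hd he

theorem sc_mul_sq (c e : F) {d : F} (hd : d ≠ 0) : sc c (e * d ^ 2) = sc c e :=
  sc_mul_norm e (d, 0) (by simp) (pow_ne_zero 2 hd)

theorem sc_add_sc (c : F) {p q : F} (hp : p ≠ 0) (hq : q ≠ 0) (hpq : p + q ≠ 0) :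
    sc c p + sc c q = sc c (p + q) + sc c (p * q * (p + q)) := by
  have h : (2 : F) = 0 := CharTwo.two_eq_zero
  have h1 : p * q * (p + q) = q * p ^ 2 + p * q ^ 2 := by ring
  have h2 : sc c (p * q * (p + q)) = br q (c / (p * q * (p + q)) * p ^ 2) +
      br p (c / (p * q * (p + q)) * q ^ 2) := by
    rw [← br_mul_sq, ← br_mul_sq, ← br_add_left, ← h1, sc]
  have h3 : sc c (p + q) = br p (c / (p + q)) + br q (c / (p + q)) := br_add_left _ _ _
  have h4 : br p (c / (p + q)) + br p (c / (p * q * (p + q)) * q ^ 2) = br p (c / p) := by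
    rw [← br_add_right]
    congr 1
    field_simp
  have h5 : br q (c / (p + q)) + br q (c / (p * q * (p + q)) * p ^ 2) = br q (c / q) := by
    rw [← br_add_right]
    congr 1
    field_simp
    ring
  rw [h2, h3, sc, sc, ← h4, ← h5]
  abel

theorem sc_eq_zero {c : F} (x : F × F) (hx : x ≠ 0)
    (h : x.1 ^ 2 + x.1 * x.2 + c * x.2 ^ 2 = 0) (e : F) : sc c e = 0 := by
  rcases eq_or_ne e 0 with rfl | he
  · exact sc_zero c
  · refine br_eq_zero (x.1, e * x.2) (fun h0 => hx ?_) ?_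
    · simpa [he, Prod.ext_iff] using h0
    · have : c / e * (e * x.2) ^ 2 = e * (c * x.2 ^ 2) := by field_simp
      rw [this]
      linear_combination e * h

/-- The values of a two-fold Pfister form are similarity factors of it. -/
theorem sc_add_mul_norm {a c d : F} (ha : a ≠ 0) (e : F) (x y : F × F)
    (h : x.1 ^ 2 + x.1 * x.2 + c * x.2 ^ 2 + a * (y.1 ^ 2 + y.1 * y.2 + c * y.2 ^ 2) = d)
    (hd : d ≠ 0) : sc c (e * d) + sc c (e * a * d) = sc c e + sc c (e * a) := by
  rcases eq_or_ne e 0 with rfl | he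
  · simp
  set m := x.1 ^ 2 + x.1 * x.2 + c * x.2 ^ 2 with hm
  set n := y.1 ^ 2 + y.1 * y.2 + c * y.2 ^ 2 with hn
  rcases eq_or_ne n 0 with hn0 | hn0
  · rw [hn0, mul_zero, add_zero] at h
    rw [sc_mul_norm e x (hm.symm.trans h) hd, sc_mul_norm (e * a) x (hm.symm.trans h) hd]
  rcases eq_or_ne m 0 with hm0 | hm0
  · rw [hm0, zero_add] at h
    have h1 : e * d = e * a * n := by rw [← h]; ring
    have h2 : e * a * d = e * n * a ^ 2 := by rw [← h]; ring
    rw [h1, h2, sc_mul_sq _ _ ha, sc_mul_norm (e * a) y hn.symm hn0,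
      sc_mul_norm e y hn.symm hn0, add_comm]
  have h1 : e * m + e * a * n = e * d := by rw [← h]; ring
  have h2 : e * m * (e * a * n) * (e * d) = e * a * d * m * n * e ^ 2 := by ring
  have key := sc_add_sc c (mul_ne_zero he hm0) (mul_ne_zero (mul_ne_zero he ha) hn0)
    (by rw [h1]; exact mul_ne_zero he hd)
  rw [h1, h2, sc_mul_sq _ _ he, sc_mul_norm _ y hn.symm hn0, sc_mul_norm _ x hm.symm hm0,
    sc_mul_norm _ y hn.symm hn0, sc_mul_norm _ x hm.symm hm0] at key
  exact key.symm

/-- Every quadratic three-fold Pfister form is isotropic. -/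
def CubeZero (F : Type) [Field F] : Prop :=
  ∀ a b c : F, a ≠ 0 → b ≠ 0 → ∃ v : Fin 4 → F × F, v ≠ 0 ∧
    ∑ i, (![1, a, b, a * b] i) * ((v i).1 ^ 2 + (v i).1 * (v i).2 + c * (v i).2 ^ 2) = 0

theorem CubeZero.sc_add (h : CubeZero F) (c : F) {a b : F} (ha : a ≠ 0) (hb : b ≠ 0) :
    sc c 1 + sc c a + (sc c b + sc c (a * b)) = 0 := by
  obtain ⟨v, hv, hv0⟩ := h a b c ha hb
  by_cases hiso : ∃ x : F × F, x ≠ 0 ∧ x.1 ^ 2 + x.1 * x.2 + c * x.2 ^ 2 = 0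
  · obtain ⟨x, hx, hx0⟩ := hiso
    simp [sc_eq_zero x hx hx0]
  push Not at hiso
  let n : F × F → F := fun x => x.1 ^ 2 + x.1 * x.2 + c * x.2 ^ 2
  have hn0 : ∀ x, n x = 0 → x = 0 := fun x hx => by
    by_contra hne
    exact hiso x hne hx
  have hsum : n (v 0) + a * n (v 1) + b * (n (v 2) + a * n (v 3)) = 0 := by
    rw [← hv0]
    simp [Fin.sum_univ_four, n]
    ring
  rcases eq_or_ne (n (v 2) + a * n (v 3)) 0 with hq | hq
  · have hp : n (v 0) + a * n (v 1) = 0 := by simpa [hq] using hsum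
    have key : ∀ x y, n x + a * n y = 0 → y ≠ 0 → ∀ e, sc c (e * a) = sc c e := by
      intro x y hxy hy e
      have hny : n y ≠ 0 := fun h0 => hy (hn0 _ h0)
      have hxy' : a * n y = n x := (CharTwo.add_eq_zero.1 hxy).symm
      have hnx : n x ≠ 0 := by
        rw [← hxy']
        exact mul_ne_zero ha hny
      rw [← sc_mul_norm (e * a) y rfl hny, mul_assoc]
      change sc c (e * (a * n y)) = _
      rw [hxy']
      exact sc_mul_norm e x rfl hnx
    have hall : ∀ e, sc c (e * a) = sc c e := by
      by_cases h1 : v 1 = 0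
      · by_cases h3 : v 3 = 0
        · have e1 : n (v 1) = 0 := by simp [n, h1]
          have e3 : n (v 3) = 0 := by simp [n, h3]
          rw [e1, mul_zero, add_zero] at hp
          rw [e3, mul_zero, add_zero] at hq
          refine absurd (funext fun i => ?_) hv
          fin_cases i
          exacts [hn0 _ hp, h1, hn0 _ hq, h3]
        · exact key _ _ hq h3
      · exact key _ _ hp h1
    have e1 := hall 1
    have e2 := hall b
    rw [one_mul] at e1
    rw [mul_comm a b, e1, e2, Witt.add_self, Witt.add_self, add_zero]
  · have hp : n (v 0) + a * n (v 1) = b * (n (v 2) + a * n (v 3)) := CharTwo.add_eq_zero.1 hsum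
    have h1 := sc_add_mul_norm (d := b * (n (v 2) + a * n (v 3))) ha 1 (v 0) (v 1) hp
      (mul_ne_zero hb hq)
    have h2 := sc_add_mul_norm (d := n (v 2) + a * n (v 3)) ha b (v 2) (v 3) rfl hq
    rw [one_mul, one_mul] at h1
    have e : a * (b * (n (v 2) + a * n (v 3))) = b * a * (n (v 2) + a * n (v 3)) := by ring
    rw [e, h2] at h1
    rw [mul_comm a b, ← h1, Witt.add_self]

/-- The class of the two-fold Pfister form attached to the differential symbol `f db`. -/
def dsym (f b : F) : Witt F := br 1 (f * b) + br b f

/-- The class of the norm form of the quaternion algebra `[a, b)`. -/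
def pf (a b : F) : Witt F := br 1 a + br b (a / b)

theorem pf_eq_dsym (a : F) {b : F} (hb : b ≠ 0) : pf a b = dsym (a / b) b := by
  rw [pf, dsym, div_mul_cancel₀ _ hb]

theorem dsym_add_left (f f' b : F) : dsym (f + f') b = dsym f b + dsym f' b := by
  simp only [dsym, add_mul, br_add_right]
  abel

theorem dsym_add_right (f b b' : F) : dsym f (b + b') = dsym f b + dsym f b' := by
  simp only [dsym, mul_add, br_add_right, br_add_left]
  abel

theorem dsym_comm (f b : F) : dsym f b = dsym b f := by
  rw [dsym, dsym, mul_comm, br_comm b f]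

theorem dsym_zero_right (f : F) : dsym f 0 = 0 := by
  rw [dsym, mul_zero, br_zero_right, br_zero_left, add_zero]

theorem dsym_zero_left (f : F) : dsym 0 f = 0 := by
  rw [dsym_comm, dsym_zero_right]

theorem dsym_sq (f c : F) : dsym f (c ^ 2) = 0 := by
  have := br_mul_sq 1 f c
  rw [one_mul] at this
  rw [dsym, this, Witt.add_self]

theorem CubeZero.dsym_mul (h : CubeZero F) (f s t : F) :
    dsym f (s * t) = dsym (f * t) s + dsym (f * s) t := by
  rcases eq_or_ne s 0 with rfl | hs
  · simp [dsym_zero_right, dsym_zero_left]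
  rcases eq_or_ne t 0 with rfl | ht
  · simp [dsym_zero_right, dsym_zero_left]
  have key := h.sc_add (f * (s * t)) hs ht
  have e1 : f * (s * t) / s = f * t := by field_simp
  have e2 : f * (s * t) / t = f * s := by field_simp
  have e3 : f * (s * t) / (s * t) = f := by field_simp
  rw [sc, sc, sc, sc, e1, e2, e3, div_one] at key
  apply Witt.eq_of_add_eq_zero
  have e4 : f * t * s = f * (s * t) := by ring
  have e5 : f * s * t = f * (s * t) := by ring
  rw [dsym, dsym, dsym, e4, e5, ← key]
  have e6 := Witt.add_self (br 1 (f * (s * t)))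
  rw [← sub_eq_zero]
  trans br 1 (f * (s * t)) + br 1 (f * (s * t))
  · abel
  · exact e6

theorem pf_add_left (a a' b : F) : pf (a + a') b = pf a b + pf a' b := by
  simp only [pf, add_div, br_add_right]
  abel

theorem pf_artinSchreier (z : F) {b : F} (hb : b ≠ 0) : pf (z ^ 2 + z) b = 0 := by
  have h1 := br_artinSchreier 1 z
  have h2 := br_artinSchreier b (z / b)
  have e : (z ^ 2 + z) / b = b * (z / b) ^ 2 + z / b := by field_simp
  rw [one_mul] at h1
  rw [pf, e, h1, h2, add_zero]

end

section System

variable {F R ι : Type*} [Field F] [Ring R] [Algebra F R]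

/-- Elements `x i`, `y i` (`i ∈ S`) of an algebra satisfying the relations of the tensor product
of the quaternion algebras `[a i, b i)`. -/
structure System (S : Finset ι) (a b : ι → F) (x y : ι → R) : Prop where
  sq_x : ∀ i ∈ S, x i * x i + x i = algebraMap F R (a i)
  sq_y : ∀ i ∈ S, y i * y i = algebraMap F R (b i)
  yx : ∀ i ∈ S, y i * x i + x i * y i = y i
  comm_x : ∀ i ∈ S, ∀ j ∈ S, Commute (x i) (x j)
  comm_y : ∀ i ∈ S, ∀ j ∈ S, Commute (y i) (y j)
  comm_xy : ∀ i ∈ S, ∀ j ∈ S, i ≠ j → Commute (x i) (y j)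

theorem System.mono {S T : Finset ι} {a b : ι → F} {x y : ι → R} (h : System S a b x y)
    (hT : T ⊆ S) : System T a b x y where
  sq_x i hi := h.sq_x i (hT hi)
  sq_y i hi := h.sq_y i (hT hi)
  yx i hi := h.yx i (hT hi)
  comm_x i hi j hj := h.comm_x i (hT hi) j (hT hj)
  comm_y i hi j hj := h.comm_y i (hT hi) j (hT hj)
  comm_xy i hi j hj := h.comm_xy i (hT hi) j (hT hj)

variable (F) in
/-- The subalgebra generated by the elements `y j` with `j ∈ J`. -/
def yAlg (y : ι → R) (J : Finset ι) : Subalgebra F R := Algebra.adjoin F (y '' J)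

theorem yAlg_mono (y : ι → R) {J K : Finset ι} (h : J ⊆ K) : yAlg F y J ≤ yAlg F y K :=
  Algebra.adjoin_mono (Set.image_mono (by exact_mod_cast h))

theorem mem_yAlg (y : ι → R) {J : Finset ι} {j : ι} (h : j ∈ J) : y j ∈ yAlg F y J :=
  Algebra.subset_adjoin ⟨j, h, rfl⟩

theorem commute_of_mem_yAlg {y : ι → R} {J : Finset ι} {r e : R}
    (h : ∀ j ∈ J, Commute r (y j)) (he : e ∈ yAlg F y J) : Commute r e := by
  refine Algebra.commute_of_mem_adjoin_of_forall_mem_commute he ?_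
  rintro _ ⟨j, hj, rfl⟩
  exact h j hj

namespace System

variable {S : Finset ι} {a b : ι → F} {x y : ι → R}

theorem commute_yAlg_y (h : System S a b x y) {J : Finset ι} (hJ : J ⊆ S) {e : R}
    (he : e ∈ yAlg F y J) {i : ι} (hi : i ∈ S) : Commute (y i) e :=
  commute_of_mem_yAlg (fun j hj => h.comm_y i hi j (hJ hj)) he

theorem commute_yAlg (h : System S a b x y) {J : Finset ι} (hJ : J ⊆ S) {e e' : R}
    (he : e ∈ yAlg F y J) (he' : e' ∈ yAlg F y J) : Commute e e' :=
  commute_of_mem_yAlg (fun _ hj => (h.commute_yAlg_y hJ he (hJ hj)).symm) he'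

theorem commute_yAlg_x (h : System S a b x y) {J : Finset ι} (hJ : J ⊆ S) {e : R}
    (he : e ∈ yAlg F y J) {i : ι} (hi : i ∈ S) (hiJ : i ∉ J) : Commute (x i) e :=
  commute_of_mem_yAlg (fun j hj => h.comm_xy i hi j (hJ hj) fun hij => hiJ (hij ▸ hj)) he

theorem bracket_mem [CharP F 2] (h : System S a b x y) {e : R} (he : e ∈ yAlg F y S)
    {i : ι} (hi : i ∈ S) : x i * e + e * x i ∈ yAlg F y S := by
  have h2 : ∀ r : R, r + r = 0 := fun r => by
    rw [← two_smul F, CharTwo.two_eq_zero, zero_smul]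
  unfold yAlg at he
  induction he using Algebra.adjoin_induction with
  | mem e he =>
    obtain ⟨j, hj, rfl⟩ := he
    by_cases hij : i = j
    · subst hij
      rw [add_comm, h.yx i hi]
      exact mem_yAlg y hi
    · rw [(h.comm_xy i hi j hj hij).eq, h2]
      exact zero_mem _
  | algebraMap r =>
    rw [← Algebra.commutes r (x i), h2]
    exact zero_mem _
  | add e e' _ _ ih ih' =>
    have e1 : x i * (e + e') + (e + e') * x i = (x i * e + e * x i) + (x i * e' + e' * x i) := by
      noncomm_ring
    rw [e1]
    exact add_mem ih ih'
  | mul e e' he he' ih ih' =>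
    have e1 : x i * (e * e') + (e * e') * x i =
        (x i * e + e * x i) * e' + e * (x i * e' + e' * x i) := by
      rw [← sub_eq_zero, ← neg_eq_zero, ← h2 (e * x i * e')]
      noncomm_ring
    rw [e1]
    exact add_mem (mul_mem ih he') (mul_mem he ih')

end System
end System

section Reduce

variable {F R ι : Type*} [Field F] [CharP F 2] [Ring R] [Algebra F R]
  {T : Finset ι} {a b : ι → F} {x y : ι → R}

theorem bracket_bracket {A : F} {u e : R} (hu : u * u + u = algebraMap F R A) :
    u * (u * e + e * u) + (u * e + e * u) * u = u * e + e * u := by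
  have h2 : ∀ r : R, r + r = 0 := fun r => by
    rw [← two_smul F, CharTwo.two_eq_zero, zero_smul]
  have h1 : (u * u + u) * e = e * (u * u + u) := by rw [hu, Algebra.commutes]
  have h3 : u * (u * e + e * u) + (u * e + e * u) * u =
      (u * u + u) * e + e * (u * u + u) + (u * e * u + u * e * u) - (u * e + e * u) := by
    noncomm_ring
  have h4 := h2 (u * e + e * u)
  rw [h3, h1, h2, h2, zero_add, zero_sub, neg_eq_of_add_eq_zero_left h4]

theorem System.reduce (h : System T a b x y) {ω : R} (hω : ω ∈ yAlg F y T) {t : ι → F}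
    (ht : ∀ i ∈ T, (x i * ω + ω * x i) * (x i * ω + ω * x i) = algebraMap F R (t i))
    {G : R} {g : F} (hG : G * G = algebraMap F R g) (hGx : ∀ i ∈ T, Commute G (x i))
    (hGy : ∀ i ∈ T, Commute G (y i)) :
    System T (fun i => a i + g * t i) b (fun i => x i + (x i * ω + ω * x i) * G) y := by
  have h2 : ∀ r : R, r + r = 0 := fun r => by
    rw [← two_smul F, CharTwo.two_eq_zero, zero_smul]
  have hm : ∀ i ∈ T, x i * ω + ω * x i ∈ yAlg F y T := fun i hi => h.bracket_mem hω hi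
  have hGe : ∀ e ∈ yAlg F y T, Commute G e := fun e he => commute_of_mem_yAlg hGy he
  have hy : ∀ i ∈ T, ∀ j ∈ T, Commute (y j) ((x i * ω + ω * x i) * G) := fun i hi j hj =>
    (h.commute_yAlg_y subset_rfl (hm i hi) hj).mul_right (hGy j hj).symm
  refine ⟨fun i hi => ?_, h.sq_y, fun i hi => ?_, fun i hi j hj => ?_, h.comm_y,
    fun i hi j hj hij => (h.comm_xy i hi j hj hij).add_left (hy i hi j hj).symm⟩
  · have hb := bracket_bracket (e := ω) (h.sq_x i hi)
    have hx := h.sq_x i hi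
    have hc := hGe _ (hm i hi)
    have hcx := hGx i hi
    have htt := ht i hi
    generalize x i * ω + ω * x i = w at *
    calc (x i + w * G) * (x i + w * G) + (x i + w * G)
        = (x i * x i + x i) + (x i * w * G + w * (G * x i) + w * G) + w * (G * w) * G := by
          noncomm_ring
      _ = (x i * x i + x i) + ((x i * w + w * x i) * G + w * G) + (w * w) * (G * G) := by
          rw [hcx.eq, hc.eq]
          noncomm_ring
      _ = _ := by
          rw [hb, h2, hx, htt, hG, map_add, map_mul, add_zero, Algebra.commutes]
  · have hyi := hy i hi i hi
    generalize (x i * ω + ω * x i) * G = w at *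
    calc y i * (x i + w) + (x i + w) * y i =
          (y i * x i + x i * y i) + (y i * w + w * y i) := by noncomm_ring
      _ = y i := by rw [hyi.eq, h2, add_zero, h.yx i hi]
  · have hxx := h.comm_x i hi j hj
    have hww := h.commute_yAlg subset_rfl (hm i hi) (hm j hj)
    have hGi := hGe _ (hm i hi)
    have hGj := hGe _ (hm j hj)
    have hij : x i * (x j * ω + ω * x j) + (x j * ω + ω * x j) * x i =
        x j * (x i * ω + ω * x i) + (x i * ω + ω * x i) * x j := by
      have e1 : x i * x j = x j * x i := hxx
      have e2 : x i * x j * ω + ω * (x j * x i) = x j * x i * ω + ω * (x i * x j) := by rw [e1]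
      calc _ = x i * x j * ω + ω * (x j * x i) + (x i * ω * x j + x j * ω * x i) := by
            noncomm_ring
        _ = _ := by
            rw [e2]
            noncomm_ring
    have hGxi := hGx i hi
    have hGxj := hGx j hj
    generalize x i * ω + ω * x i = w at *
    generalize x j * ω + ω * x j = w' at *
    have e2 : x i * w' + w * x j = w' * x i + x j * w := by
      have h3 := h2 (w' * x i)
      have h4 := h2 (w * x j)
      calc _ = (x i * w' + w' * x i) + w * x j - w' * x i := by abel
        _ = (x j * w + w * x j) + w * x j - w' * x i := by rw [hij]
        _ = x j * w + (w * x j + w * x j) - (w' * x i + w' * x i) + w' * x i := by abel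
        _ = _ := by rw [h3, h4]; abel
    change (x i + w * G) * (x j + w' * G) = (x j + w' * G) * (x i + w * G)
    calc _ = x i * x j + (x i * w' * G + w * (G * x j)) + w * (G * w') * G := by noncomm_ring
      _ = x i * x j + (x i * w' + w * x j) * G + (w * w') * (G * G) := by
        rw [hGxj.eq, hGj.eq]
        noncomm_ring
      _ = x j * x i + (w' * x i + x j * w) * G + (w' * w) * (G * G) := by
        rw [e2, hxx.eq, hww.eq]
      _ = x j * x i + (w' * (x i * G) + x j * w * G) + w' * (w * G) * G := by noncomm_ring
      _ = x j * x i + (w' * (G * x i) + x j * w * G) + w' * (G * w) * G := by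
        rw [hGxi.eq, hGi.eq]
      _ = _ := by noncomm_ring

theorem System.reduce_commute_x (h : System T a b x y) {ω : R} (hω : ω ∈ yAlg F y T)
    {G p q : R} (hGy : ∀ i ∈ T, Commute G (y i))
    (hpx : ∀ i ∈ T, Commute p (x i)) (hpy : ∀ i ∈ T, Commute p (y i))
    (hqx : ∀ i ∈ T, Commute q (x i)) (hqy : ∀ i ∈ T, Commute q (y i))
    (hpG : p * G + G * p = q) (hqG : Commute q G) {i : ι} (hi : i ∈ T) :
    Commute (p + ω * q) (x i + (x i * ω + ω * x i) * G) := by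
  have h2 : ∀ r : R, r + r = 0 := fun r => by
    rw [← two_smul F, CharTwo.two_eq_zero, zero_smul]
  have hm := h.bracket_mem hω hi
  have c1 : Commute G ω := commute_of_mem_yAlg hGy hω
  have c2 := commute_of_mem_yAlg hpy hm
  have c3 := commute_of_mem_yAlg hqy hm
  have c4 := h.commute_yAlg subset_rfl hω hm
  have c5 := hpx i hi
  have c6 := hqx i hi
  have c7 := commute_of_mem_yAlg hGy hm
  have key : p * ((x i * ω + ω * x i) * G) + ω * q * x i =
      x i * (ω * q) + (x i * ω + ω * x i) * G * p := by
    have e1 : p * ((x i * ω + ω * x i) * G) + (x i * ω + ω * x i) * G * p =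
        (x i * ω + ω * x i) * q := by
      rw [← mul_assoc, c2.eq, ← hpG]
      noncomm_ring
    have e2 : ω * q * x i + x i * (ω * q) = (x i * ω + ω * x i) * q := by
      rw [mul_assoc, c6.eq]
      noncomm_ring
    have e3 := e1.trans e2.symm
    calc _ = (p * ((x i * ω + ω * x i) * G) + (x i * ω + ω * x i) * G * p) + ω * q * x i -
          (x i * ω + ω * x i) * G * p := by abel
      _ = (ω * q * x i + ω * q * x i) + (x i * (ω * q) + (x i * ω + ω * x i) * G * p) -
          ((x i * ω + ω * x i) * G * p + (x i * ω + ω * x i) * G * p) := by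
        rw [e3]; abel
      _ = _ := by rw [h2, h2]; abel
  have c8 : Commute (ω * q) ((x i * ω + ω * x i) * G) :=
    ((c4.mul_right c1.symm)).mul_left (c3.mul_right hqG)
  change (p + ω * q) * (x i + (x i * ω + ω * x i) * G) =
    (x i + (x i * ω + ω * x i) * G) * (p + ω * q)
  generalize x i * ω + ω * x i = w at *
  calc _ = p * x i + (p * (w * G) + ω * q * x i) + ω * q * (w * G) := by noncomm_ring
    _ = x i * p + (x i * (ω * q) + w * G * p) + w * G * (ω * q) := by
      rw [key, c5.eq, c8.eq]
    _ = _ := by noncomm_ring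

end Reduce

section Nilpotent

variable {F R ι : Type*} [Field F] [Ring R] [Algebra F R]
  {S : Finset ι} {a b : ι → F} {x y : ι → R}

theorem System.exists_add_mul_y [DecidableEq ι] (h : System S a b x y) {J : Finset ι} {j : ι}
    (hJ : insert j J ⊆ S) {e : R} (he : e ∈ yAlg F y (insert j J)) :
    ∃ u ∈ yAlg F y J, ∃ v ∈ yAlg F y J, e = u + v * y j := by
  have hj : j ∈ S := hJ (Finset.mem_insert_self j J)
  have hJS : J ⊆ S := (Finset.subset_insert j J).trans hJ
  unfold yAlg at he
  induction he using Algebra.adjoin_induction with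
  | mem e he =>
    obtain ⟨k, hk, rfl⟩ := he
    rcases Finset.mem_insert.1 hk with rfl | hk
    · exact ⟨0, zero_mem _, 1, one_mem _, by simp⟩
    · exact ⟨y k, mem_yAlg y hk, 0, zero_mem _, by simp⟩
  | algebraMap r => exact ⟨_, Subalgebra.algebraMap_mem _ r, 0, zero_mem _, by simp⟩
  | add e e' _ _ ih ih' =>
    obtain ⟨u, hu, v, hv, rfl⟩ := ih
    obtain ⟨u', hu', v', hv', rfl⟩ := ih'
    exact ⟨u + u', add_mem hu hu', v + v', add_mem hv hv', by noncomm_ring⟩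
  | mul e e' _ _ ih ih' =>
    obtain ⟨u, hu, v, hv, rfl⟩ := ih
    obtain ⟨u', hu', v', hv', rfl⟩ := ih'
    refine ⟨u * u' + v * v' * algebraMap F R (b j), add_mem (mul_mem hu hu')
      (mul_mem (mul_mem hv hv') (Subalgebra.algebraMap_mem _ _)), u * v' + v * u',
      add_mem (mul_mem hu hv') (mul_mem hv hu'), ?_⟩
    have c1 := (h.commute_yAlg_y hJS hu' hj).eq
    have c2 := (h.commute_yAlg_y hJS hv' hj).eq
    rw [← h.sq_y j hj]
    calc _ = u * u' + v * (y j * v') * y j + (u * v' * y j + v * (y j * u')) := by noncomm_ring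
      _ = _ := by
        rw [c1, c2]
        noncomm_ring

variable [CharP F 2]

theorem System.exists_sq (h : System S a b x y) {J : Finset ι} (hJ : J ⊆ S) {e : R}
    (he : e ∈ yAlg F y J) : ∃ s : F, e * e = algebraMap F R s := by
  have h2 : ∀ r : R, r + r = 0 := fun r => by
    rw [← two_smul F, CharTwo.two_eq_zero, zero_smul]
  unfold yAlg at he
  induction he using Algebra.adjoin_induction with
  | mem e he =>
    obtain ⟨j, hj, rfl⟩ := he
    exact ⟨b j, h.sq_y j (hJ hj)⟩
  | algebraMap r => exact ⟨r * r, (map_mul _ _ _).symm⟩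
  | add e e' he he' ih ih' =>
    obtain ⟨s, hs⟩ := ih
    obtain ⟨s', hs'⟩ := ih'
    refine ⟨s + s', ?_⟩
    have c := h.commute_yAlg hJ he he'
    calc _ = e * e + e' * e' + (e * e' + e' * e) := by noncomm_ring
      _ = _ := by rw [c.eq, h2, hs, hs', map_add, add_zero]
  | mul e e' he he' ih ih' =>
    obtain ⟨s, hs⟩ := ih
    obtain ⟨s', hs'⟩ := ih'
    refine ⟨s * s', ?_⟩
    have c := h.commute_yAlg hJ he he'
    rw [c.symm.mul_mul_mul_comm, hs, hs', map_mul]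

theorem System.eq_zero_of_sq_eq_zero [Nontrivial R] [DecidableEq ι] (h : System S a b x y)
    (hS : ∀ j ∈ S, ∀ ω ∈ yAlg F y (S.erase j), ω * ω ≠ algebraMap F R (b j)) {J : Finset ι} :
    J ⊆ S → ∀ e ∈ yAlg F y J, e * e = 0 → e = 0 := by
  have h2 : ∀ r : R, r + r = 0 := fun r => by
    rw [← two_smul F, CharTwo.two_eq_zero, zero_smul]
  induction J using Finset.induction_on with
  | empty =>
    intro _ e he h0
    rw [yAlg, Finset.coe_empty, Set.image_empty, Algebra.adjoin_empty, Algebra.mem_bot] at he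
    obtain ⟨r, rfl⟩ := he
    rw [← map_mul, map_eq_zero_iff _ (algebraMap F R).injective, mul_self_eq_zero] at h0
    rw [h0, map_zero]
  | insert j J hjJ ih =>
    intro hJ e he h0
    have hj : j ∈ S := hJ (Finset.mem_insert_self j J)
    have hJS : J ⊆ S := (Finset.subset_insert j J).trans hJ
    obtain ⟨u, hu, v, hv, rfl⟩ := h.exists_add_mul_y hJ he
    rcases eq_or_ne v 0 with rfl | hv0
    · rw [zero_mul, add_zero] at h0 ⊢
      exact ih hJS u hu h0
    · exfalso
      obtain ⟨s, hs⟩ := h.exists_sq hJS hv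
      have hs0 : s ≠ 0 := by
        rintro rfl
        exact hv0 (ih hJS v hv (by rw [hs, map_zero]))
      have cu := h.commute_yAlg_y hJS hu hj
      have cv := h.commute_yAlg_y hJS hv hj
      have cuv := h.commute_yAlg hJS hu hv
      have huu : u * u = algebraMap F R (b j * s) := by
        have e1 : (u + v * y j) * (u + v * y j) =
            u * u + (u * v * y j + v * (y j * u)) + v * (y j * v) * y j := by noncomm_ring
        rw [e1, cu.eq, cv.eq] at h0
        have e2 : u * u + (u * v * y j + v * (u * y j)) + v * (v * y j) * y j =
            u * u + (u * v * y j + v * u * y j) + v * v * (y j * y j) := by noncomm_ring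
        rw [e2, cuv.eq, h2, hs, h.sq_y j hj, add_zero, ← map_mul] at h0
        have e3 := h2 (algebraMap F R (s * b j))
        rw [mul_comm, ← sub_eq_zero, ← sub_eq_zero.2 (h0.trans e3.symm)]
        abel
      refine hS j hj (s⁻¹ • (u * v)) (Subalgebra.smul_mem _ (yAlg_mono y ?_
        (mul_mem hu hv)) _) ?_
      · exact fun k hk => Finset.mem_erase.2 ⟨fun hkj => hjJ (hkj ▸ hk), hJS hk⟩
      · rw [smul_mul_smul_comm, cuv.symm.mul_mul_mul_comm, huu, hs, ← map_mul,
          Algebra.smul_def, ← map_mul]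
        congr 1
        field_simp

theorem System.two_pow_le_finrank [Nontrivial R] [DecidableEq ι] [FiniteDimensional F R]
    (h : System S a b x y) (hb : ∀ i ∈ S, b i ≠ 0) {J : Finset ι} :
    J ⊆ S → 2 ^ J.card ≤ finrank F (yAlg F y J) := by
  have h2 : ∀ r : R, r + r = 0 := fun r => by
    rw [← two_smul F, CharTwo.two_eq_zero, zero_smul]
  induction J using Finset.induction_on with
  | empty =>
    intro _
    rw [Finset.card_empty, pow_zero]
    exact finrank_pos
  | insert j J hjJ ih =>
    intro hJ
    have hj : j ∈ S := hJ (Finset.mem_insert_self j J)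
    have hJS : J ⊆ S := (Finset.subset_insert j J).trans hJ
    have hsub := yAlg_mono (F := F) y (Finset.subset_insert j J)
    let f : yAlg F y J × yAlg F y J →ₗ[F] R :=
      LinearMap.coprod (yAlg F y J).val.toLinearMap
        (LinearMap.mulRight F (y j) ∘ₗ (yAlg F y J).val.toLinearMap)
    have hfa : ∀ p, f p = p.1 + p.2 * y j := fun p => by simp [f]
    clear_value f
    have hf : Function.Injective f := by
      rw [injective_iff_map_eq_zero]
      rintro ⟨u, v⟩ huv
      have e1 : (u : R) + v * y j = 0 := by rw [← huv, hfa]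
      have cu := h.commute_yAlg_x hJS u.2 hj hjJ
      have cv := h.commute_yAlg_x hJS v.2 hj hjJ
      have e2 : (v : R) * y j = 0 := by
        have e3 : x j * (u + v * y j) + (u + v * y j) * x j = v * y j := by
          calc _ = (x j * u + u * x j) + (x j * v * y j + v * (y j * x j)) := by noncomm_ring
            _ = v * (y j * x j + x j * y j) := by
              rw [cu.eq, h2, cv.eq]
              noncomm_ring
            _ = _ := by rw [h.yx j hj]
        rw [← e3, e1, mul_zero, zero_mul, add_zero]
      have e4 : (v : R) = 0 := by
        have e5 : (v : R) * (y j * y j) = 0 := by rw [← mul_assoc, e2, zero_mul]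
        rw [h.sq_y j hj, ← Algebra.commutes, ← Algebra.smul_def] at e5
        exact (smul_eq_zero.1 e5).resolve_left (hb j hj)
      rw [e2, add_zero] at e1
      exact Prod.ext (Subtype.ext e1) (Subtype.ext e4)
    have hle : LinearMap.range f ≤ Subalgebra.toSubmodule (yAlg F y (insert j J)) := by
      rintro _ ⟨p, rfl⟩
      rw [hfa, Subalgebra.mem_toSubmodule]
      exact add_mem (hsub p.1.2)
        (mul_mem (hsub p.2.2) (mem_yAlg y (Finset.mem_insert_self j J)))
    have := Submodule.finrank_mono hle
    rw [LinearMap.finrank_range_of_inj hf, finrank_prod, Subalgebra.finrank_toSubmodule] at this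
    rw [Finset.card_insert_of_notMem hjJ, pow_succ]
    have := ih hJS
    omega

end Nilpotent

theorem System.exists_dsym {F R ι : Type} [Field F] [CharP F 2] [Ring R] [Algebra F R]
    {S : Finset ι} {a b : ι → F} {x y : ι → R}
    (hI : CubeZero F) (h : System S a b x y) (hb : ∀ i ∈ S, b i ≠ 0) {e : R}
    (he : e ∈ yAlg F y S) :
    ∃ (s : F) (t : ι → F), e * e = algebraMap F R s ∧
      (∀ i ∈ S, (x i * e + e * x i) * (x i * e + e * x i) = algebraMap F R (t i)) ∧
      ∀ f, dsym f s = ∑ i ∈ S, dsym (f * t i / b i) (b i) := by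
  classical
  have h2 : ∀ r : R, r + r = 0 := fun r => by
    rw [← two_smul F, CharTwo.two_eq_zero, zero_smul]
  unfold yAlg at he
  induction he using Algebra.adjoin_induction with
  | mem e he =>
    obtain ⟨j, hj, rfl⟩ := he
    refine ⟨b j, fun i => if i = j then b j else 0, h.sq_y j hj, fun i hi => ?_, fun f => ?_⟩
    · by_cases hij : i = j
      · subst hij
        rw [add_comm, h.yx i hi, h.sq_y i hi]
        simp
      · rw [(h.comm_xy i hi j hj hij).eq, h2]
        simp [hij]
    · rw [Finset.sum_eq_single_of_mem j hj]
      · simp [hb j hj]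
      · intro i _ hij
        simp [hij, dsym_zero_left]
  | algebraMap r =>
    refine ⟨r * r, 0, (map_mul _ _ _).symm, fun i _ => ?_, fun f => ?_⟩
    · rw [← Algebra.commutes r (x i), h2]
      simp
    · rw [← sq, dsym_sq]
      simp [dsym_zero_left]
  | add e e' he he' ih ih' =>
    obtain ⟨s, t, hs, ht, hd⟩ := ih
    obtain ⟨s', t', hs', ht', hd'⟩ := ih'
    have add_sq : ∀ {r r' : R}, Commute r r' → (r + r') * (r + r') = r * r + r' * r' := by
      intro r r' c
      calc _ = r * r + r' * r' + (r * r' + r' * r) := by noncomm_ring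
        _ = _ := by rw [c.eq, h2, add_zero]
    refine ⟨s + s', t + t', ?_, fun i hi => ?_, fun f => ?_⟩
    · rw [add_sq (h.commute_yAlg subset_rfl he he'), hs, hs', map_add]
    · have e1 : x i * (e + e') + (e + e') * x i =
          (x i * e + e * x i) + (x i * e' + e' * x i) := by noncomm_ring
      rw [e1, add_sq (h.commute_yAlg subset_rfl (h.bracket_mem he hi) (h.bracket_mem he' hi)),
        ht i hi, ht' i hi, Pi.add_apply, map_add]
    · rw [dsym_add_right, hd, hd', ← Finset.sum_add_distrib]
      refine Finset.sum_congr rfl fun i _ => ?_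
      rw [← dsym_add_left, Pi.add_apply, mul_add, add_div]
  | mul e e' he he' ih ih' =>
    obtain ⟨s, t, hs, ht, hd⟩ := ih
    obtain ⟨s', t', hs', ht', hd'⟩ := ih'
    refine ⟨s * s', fun i => t i * s' + s * t' i, ?_, fun i hi => ?_, fun f => ?_⟩
    · rw [(h.commute_yAlg subset_rfl he he').symm.mul_mul_mul_comm, hs, hs', map_mul]
    · have hm := h.bracket_mem he hi
      have hm' := h.bracket_mem he' hi
      have e1 : x i * (e * e') + (e * e') * x i =
          (x i * e + e * x i) * e' + e * (x i * e' + e' * x i) := by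
        rw [← sub_eq_zero, ← neg_eq_zero, ← h2 (e * x i * e')]
        noncomm_ring
      have c1 := h.commute_yAlg subset_rfl he he'
      have c2 := h.commute_yAlg subset_rfl hm he'
      have c3 := h.commute_yAlg subset_rfl he hm'
      have c4 := h.commute_yAlg subset_rfl hm he
      have c5 := h.commute_yAlg subset_rfl hm hm'
      have c6 := h.commute_yAlg subset_rfl he' hm'
      have hti := ht i hi
      have hti' := ht' i hi
      rw [e1]
      generalize x i * e + e * x i = w at *
      generalize x i * e' + e' * x i = w' at *
      have c : Commute (w * e') (e * w') := (c4.mul_left c1.symm).mul_right (c5.mul_left c6)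
      calc _ = (w * e') * (w * e') + (e * w') * (e * w') +
            ((w * e') * (e * w') + (e * w') * (w * e')) := by noncomm_ring
        _ = _ := by
          rw [c.eq, h2, add_zero, c2.symm.mul_mul_mul_comm, c3.symm.mul_mul_mul_comm, hti, hs',
            hs, hti', map_add, map_mul, map_mul]
    · rw [hI.dsym_mul, hd, hd', ← Finset.sum_add_distrib]
      refine Finset.sum_congr rfl fun i _ => ?_
      rw [← dsym_add_left, ← add_div]
      congr 2
      ring

section Restrict

variable {F V ι : Type*} [Field F] [AddCommGroup V] [Module F V]

open Classical in
/-- The restriction of `f` to the kernel of `q`, if `f` and `q` commute. -/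
noncomputable def restrictKer (q f : End F V) : End F (LinearMap.ker q) :=
  if h : Commute q f then
    f.restrict fun v hv => by
      have hv' : q v = 0 := hv
      have := LinearMap.congr_fun h.eq v
      simpa [hv'] using this
  else 0

theorem restrictKer_apply {q f : End F V} (h : Commute q f) (v : LinearMap.ker q) :
    (restrictKer q f v : V) = f v := by
  rw [restrictKer, dif_pos h]
  rfl

theorem System.restrictKer {S : Finset ι} {a b : ι → F} {x y : ι → End F V}
    (h : System S a b x y) {q : End F V} (hx : ∀ i ∈ S, Commute q (x i))
    (hy : ∀ i ∈ S, Commute q (y i)) :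
    System S a b (fun i => restrictKer q (x i)) (fun i => restrictKer q (y i)) := by
  refine ⟨fun i hi => ?_, fun i hi => ?_, fun i hi => ?_, fun i hi j hj => ?_,
    fun i hi j hj => ?_, fun i hi j hj hij => ?_⟩
  · ext v
    simpa [restrictKer_apply (hx i hi)] using LinearMap.congr_fun (h.sq_x i hi) (v : V)
  · ext v
    simpa [restrictKer_apply (hy i hi)] using LinearMap.congr_fun (h.sq_y i hi) (v : V)
  · ext v
    simpa [restrictKer_apply (hx i hi), restrictKer_apply (hy i hi)] using
      LinearMap.congr_fun (h.yx i hi) (v : V)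
  · ext v
    simpa [restrictKer_apply (hx i hi), restrictKer_apply (hx j hj)] using
      LinearMap.congr_fun (h.comm_x i hi j hj).eq (v : V)
  · ext v
    simpa [restrictKer_apply (hy i hi), restrictKer_apply (hy j hj)] using
      LinearMap.congr_fun (h.comm_y i hi j hj).eq (v : V)
  · ext v
    simpa [restrictKer_apply (hx i hi), restrictKer_apply (hy j hj)] using
      LinearMap.congr_fun (h.comm_xy i hi j hj hij).eq (v : V)

theorem two_mul_finrank_ker_le [FiniteDimensional F V] {q z w : End F V}
    (hw : Function.Injective w) (h : ∀ v, q v = 0 → q (z v) = w v) :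
    2 * finrank F (LinearMap.ker q) ≤ finrank F V := by
  let f : LinearMap.ker q × LinearMap.ker q →ₗ[F] V :=
    LinearMap.coprod (LinearMap.ker q).subtype (z ∘ₗ (LinearMap.ker q).subtype)
  have hf : Function.Injective f := by
    rw [injective_iff_map_eq_zero]
    rintro ⟨u, v⟩ huv
    have e1 : (u : V) + z v = 0 := by simpa [f] using huv
    have hu : q u = 0 := u.2
    have e2 := congrArg q e1
    rw [map_add, hu, zero_add, map_zero, h v v.2] at e2
    have e3 : (v : V) = 0 := hw (by rw [e2, map_zero])
    rw [e3, map_zero, add_zero] at e1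
    exact Prod.ext (Subtype.ext e1) (Subtype.ext e3)
  have := LinearMap.finrank_le_finrank_of_injective hf
  rw [finrank_prod] at this
  omega

end Restrict

section Main

variable {F ι : Type} [Field F] [CharP F 2] {V : Type} [AddCommGroup V] [Module F V]
  [FiniteDimensional F V]

/-- If the operators `x j`, `y j` satisfy the relations of a quaternion algebra and commute with
`E`, then a dimension count forces a nontrivial zero of its norm form over `E`. -/
theorem exists_norm_eq_zero {A B : F} {X Y : End F V} (hX : X * X + X = algebraMap F _ A)
    (hY : Y * Y = algebraMap F _ B) (hYX : Y * X + X * Y = Y) (E : Subalgebra F (End F V))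
    (hEc : ∀ e ∈ E, ∀ e' ∈ E, Commute e e') (hEX : ∀ e ∈ E, Commute X e)
    (hEY : ∀ e ∈ E, Commute Y e) (hE : finrank F V < 3 * finrank F E)
    (hsq : ∀ e ∈ E, ∃ s, e * e = algebraMap F (End F V) s) (hn : ∀ e ∈ E, e * e = 0 → e = 0)
    [Nontrivial V] :
    ∃ α ∈ E, ∃ β ∈ E, ∃ γ ∈ E, (α ≠ 0 ∨ β ≠ 0 ∨ γ ≠ 0) ∧
      α * α + α * β + β * β * algebraMap F _ A + γ * γ * algebraMap F _ B = 0 := by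
  have h2 : ∀ r : End F V, r + r = 0 := fun r => by
    rw [← two_smul F, CharTwo.two_eq_zero, zero_smul]
  obtain ⟨v, hv⟩ := exists_ne (0 : V)
  let g : E →ₗ[F] V := LinearMap.applyₗ v ∘ₗ E.val.toLinearMap
  let f : E × E × E →ₗ[F] V := LinearMap.coprod g (LinearMap.coprod (X ∘ₗ g) (Y ∘ₗ g))
  have hker : LinearMap.ker f ≠ ⊥ := by
    apply LinearMap.ker_ne_bot_of_finrank_lt
    rw [finrank_prod, finrank_prod]
    omega
  obtain ⟨⟨⟨α, hα⟩, ⟨β, hβ⟩, ⟨γ, hγ⟩⟩, hp, hp0⟩ := Submodule.exists_mem_ne_zero_of_ne_bot hker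
  refine ⟨α, hα, β, hβ, γ, hγ, ?_, ?_⟩
  · by_contra! h0
    obtain ⟨rfl, rfl, rfl⟩ := h0
    exact hp0 rfl
  have e1 : (α + X * β + Y * γ) v = 0 := by
    simpa [f, g, add_assoc] using hp
  have cXα := (hEX α hα).eq
  have cXβ := (hEX β hβ).eq
  have cXγ := (hEX γ hγ).eq
  have cYα := (hEY α hα).eq
  have cYβ := (hEY β hβ).eq
  have cYγ := (hEY γ hγ).eq
  have cβα := (hEc β hβ α hα).eq
  have cγα := (hEc γ hγ α hα).eq
  have cγβ := (hEc γ hγ β hβ).eq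
  have e2 : (α + X * β + Y * γ + β) * (α + X * β + Y * γ) =
      α * α + α * β + β * β * algebraMap F _ A + γ * γ * algebraMap F _ B := by
    rw [← hX, ← hY, mul_add (β * β), ← mul_assoc (β * β)]
    rw [cXβ, cYγ]
    calc _ = α * α + α * β * X + α * γ * Y + β * (X * α) + β * (X * β) * X + β * (X * γ) * Y
          + γ * (Y * α) + γ * (Y * β) * X + γ * (Y * γ) * Y + β * α + β * β * X + β * γ * Y := by
          noncomm_ring
      _ = α * α + β * α + (α * β * X + β * α * X) + (α * γ * Y + γ * α * Y) +
          β * β * X * X + β * β * X + (β * γ * X * Y + γ * β * Y * X + β * γ * Y) +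
          γ * γ * Y * Y := by
          rw [cXα, cXβ, cXγ, cYα, cYβ, cYγ]
          noncomm_ring
      _ = α * α + α * β + (α * β * X + α * β * X) + (α * γ * Y + α * γ * Y) +
          β * β * X * X + β * β * X + (β * γ * (Y * X + X * Y) + β * γ * Y) +
          γ * γ * Y * Y := by
          rw [cβα, cγα, cγβ]
          noncomm_ring
      _ = _ := by
          rw [hYX, h2, h2, h2]
          noncomm_ring
  have hN : α * α + α * β + β * β * algebraMap F _ A + γ * γ * algebraMap F _ B ∈ E :=
    add_mem (add_mem (add_mem (mul_mem hα hα) (mul_mem hα hβ))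
      (mul_mem (mul_mem hβ hβ) (E.algebraMap_mem _))) (mul_mem (mul_mem hγ hγ) (E.algebraMap_mem _))
  generalize α * α + α * β + β * β * algebraMap F _ A + γ * γ * algebraMap F _ B = N at *
  obtain ⟨s, hs⟩ := hsq N hN
  refine hn N hN ?_
  have e3 : N v = 0 := by rw [← e2, Module.End.mul_apply, e1, map_zero]
  have e4 : s • v = 0 := by
    rw [← Module.algebraMap_end_apply (R := F) (S := F), ← hs, Module.End.mul_apply, e3, map_zero]
  rw [hs, (smul_eq_zero.1 e4).resolve_right hv, map_zero]

end Main

/-- If the tensor product of the quaternion algebras `[a i, b i)`, `i ∈ S`, acts on a nonzero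
space of dimension at most `2 ^ |S|` (so that it is split), then the classes of the norm forms
add up to zero in the Witt group. -/
theorem System.sum_pf_eq_zero {F ι : Type} [Field F] [CharP F 2] (hI : CubeZero F) (n : ℕ) :
    ∀ {V : Type} [AddCommGroup V] [Module F V] [FiniteDimensional F V] [Nontrivial V]
      {S : Finset ι} {a b : ι → F} {x y : ι → End F V}, System S a b x y → S.card = n →
      (∀ i ∈ S, b i ≠ 0) → finrank F V ≤ 2 ^ n → ∑ i ∈ S, pf (a i) (b i) = 0 := by
  classical
  induction n with
  | zero =>
    intro V _ _ _ _ S a b x y _ hc _ _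
    rw [Finset.card_eq_zero.1 hc, Finset.sum_empty]
  | succ n ih =>
    intro V _ _ _ _ S a b x y h hc hb hV
    have h2 : ∀ r : End F V, r + r = 0 := fun r => by
      rw [← two_smul F, CharTwo.two_eq_zero, zero_smul]
    have yinj : ∀ j ∈ S, Function.Injective (y j) := by
      intro j hj
      rw [injective_iff_map_eq_zero]
      intro v hv
      have e := LinearMap.congr_fun (h.sq_y j hj) v
      rw [Module.End.mul_apply, hv, map_zero, Module.algebraMap_end_apply] at e
      exact (smul_eq_zero.1 e.symm).resolve_left (hb j hj)
    have step : ∀ j ∈ S, ∀ ω ∈ yAlg F y (S.erase j), ∀ (G p q z r : End F V) (g : F),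
        G * G = algebraMap F _ g → (∀ i ∈ S.erase j, Commute G (x i)) →
        (∀ i ∈ S.erase j, Commute G (y i)) → (∀ i ∈ S.erase j, Commute p (x i)) →
        (∀ i ∈ S.erase j, Commute p (y i)) → (∀ i ∈ S.erase j, Commute q (x i)) →
        (∀ i ∈ S.erase j, Commute q (y i)) → p * G + G * p = q → Commute q G →
        (p + ω * q) * r = 0 → r ≠ 0 →
        (∀ v, (p + ω * q) v = 0 → (p + ω * q) (z v) = y j v) →
        (∀ s, ω * ω = algebraMap F _ s → pf (a j) (b j) = dsym g s) →
        ∑ i ∈ S, pf (a i) (b i) = 0 := by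
      intro j hj ω hω G p q z r g hG hGx hGy hpx hpy hqx hqy hpG hqG hr hr0 hz hw
      have hT := h.mono (Finset.erase_subset j S)
      have hbT : ∀ i ∈ S.erase j, b i ≠ 0 := fun i hi => hb i (Finset.mem_of_mem_erase hi)
      obtain ⟨s, t, hs, ht, hd⟩ := hT.exists_dsym hI hbT hω
      have hsys := (hT.reduce hω ht hG hGx hGy).restrictKer (q := p + ω * q)
        (fun i hi => hT.reduce_commute_x hω hGy hpx hpy hqx hqy hpG hqG hi)
        (fun i hi => (hpy i hi).add_left
          ((hT.commute_yAlg_y subset_rfl hω hi).symm.mul_left (hqy i hi)))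
      have hdim := two_mul_finrank_ker_le (yinj j hj) hz
      have hnt : Nontrivial (LinearMap.ker (p + ω * q)) := by
        rw [Submodule.nontrivial_iff_ne_bot]
        intro hbot
        refine hr0 (LinearMap.ext fun v => ?_)
        have : r v ∈ LinearMap.ker (p + ω * q) := LinearMap.congr_fun hr v
        rw [hbot] at this
        exact this
      have key := ih hsys (by rw [Finset.card_erase_of_mem hj, hc]; rfl) hbT
        (by rw [pow_succ] at hV; omega)
      rw [← Finset.add_sum_erase S _ hj, hw s hs, hd, ← Finset.sum_add_distrib, ← key]
      refine Finset.sum_congr rfl fun i hi => ?_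
      rw [pf_add_left, pf_eq_dsym (g * t i) (hbT i hi), add_comm]
    have ne : ∀ j, ∀ i ∈ S.erase j, i ≠ j := fun j i hi => Finset.ne_of_mem_erase hi
    have mem : ∀ j, ∀ i ∈ S.erase j, i ∈ S := fun j i hi => Finset.mem_of_mem_erase hi
    by_cases hex : ∃ j ∈ S, ∃ ω ∈ yAlg F y (S.erase j), ω * ω = algebraMap F _ (b j)
    · obtain ⟨j, hj, ω, hω, hωb⟩ := hex
      have hbj := hb j hj
      have hsy := h.sq_y j hj
      have hinv : (b j)⁻¹ • (y j * y j) = 1 := by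
        rw [hsy, Algebra.smul_def, ← map_mul, inv_mul_cancel₀ hbj, map_one]
      have hxy : x j * y j = y j * x j + y j := by
        have e := h.yx j hj
        have e' := h2 (y j * x j)
        calc _ = (y j * x j + x j * y j) + (y j * x j) - (y j * x j + y j * x j) := by abel
          _ = _ := by rw [e, e', sub_zero, add_comm]
      have cyω := h.commute_yAlg_y (Finset.erase_subset j S) hω hj
      have cxω := h.commute_yAlg_x (Finset.erase_subset j S) hω hj (Finset.notMem_erase j S)
      have cyy : ∀ i ∈ S.erase j, Commute (y j) (y i) := fun i hi => h.comm_y j hj i (mem j i hi)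
      have cyx : ∀ i ∈ S.erase j, Commute (y j) (x i) := fun i hi =>
        (h.comm_xy i (mem j i hi) j hj (ne j i hi)).symm
      have cxy : ∀ i ∈ S.erase j, Commute (x j) (y i) := fun i hi =>
        h.comm_xy j hj i (mem j i hi) (ne j i hi).symm
      have cxx : ∀ i ∈ S.erase j, Commute (x j) (x i) := fun i hi => h.comm_x j hj i (mem j i hi)
      refine step j hj ω hω ((b j)⁻¹ • (y j * x j)) (y j) 1 (x j) (y j + ω) (a j / b j) ?_
        (fun i hi => ((cyx i hi).mul_left (cxx i hi)).smul_left _)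
        (fun i hi => ((cyy i hi).mul_left (cxy i hi)).smul_left _) cyx cyy
        (fun _ _ => Commute.one_left _) (fun _ _ => Commute.one_left _) ?_ (Commute.one_left _)
        ?_ ?_ ?_ ?_
      · have e : y j * x j * (y j * x j) = b j • algebraMap F _ (a j) := by
          calc _ = y j * (x j * y j) * x j := by noncomm_ring
            _ = (y j * y j) * (x j * x j + x j) := by rw [hxy]; noncomm_ring
            _ = _ := by rw [hsy, h.sq_x j hj, Algebra.smul_def]
        rw [smul_mul_smul_comm, e, smul_smul, Algebra.smul_def, ← map_mul]
        congr 1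
        field_simp
      · rw [mul_smul_comm, smul_mul_assoc, ← smul_add, ← hinv]
        congr 1
        rw [mul_assoc, ← mul_add, h.yx j hj]
      · rw [mul_one]
        calc _ = y j * y j + ω * ω + (y j * ω + ω * y j) := by noncomm_ring
          _ = 0 := by rw [cyω.eq, hsy, hωb, h2, h2, add_zero]
      · intro h0
        have e1 : x j * (y j + ω) + (y j + ω) * x j = y j := by
          calc _ = (y j * x j + x j * y j) + (x j * ω + ω * x j) := by noncomm_ring
            _ = _ := by rw [h.yx j hj, cxω.eq, h2, add_zero]
        rw [h0, mul_zero, zero_mul, add_zero] at e1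
        obtain ⟨v, hv⟩ := exists_ne (0 : V)
        exact hv (yinj j hj (by simp [← e1]))
      · intro v hv
        have e1 : (y j + ω * 1) * x j = x j * (y j + ω * 1) + y j := by
          have e2 := h2 (y j)
          rw [mul_one, add_mul, mul_add, hxy, cxω.eq]
          calc _ = y j * x j + ω * x j + 0 := by rw [add_zero]
            _ = y j * x j + ω * x j + (y j + y j) := by rw [e2]
            _ = _ := by abel
        calc (y j + ω * 1) (x j v) = (x j * (y j + ω * 1) + y j) v := LinearMap.congr_fun e1 v
          _ = x j ((y j + ω * 1) v) + y j v := rfl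
          _ = y j v := by rw [hv, map_zero, zero_add]
      · intro s hs
        have : s = b j := (algebraMap F (End F V)).injective (hs.symm.trans hωb)
        rw [this, pf_eq_dsym _ hbj]
    · push Not at hex
      have hnil := fun {J : Finset ι} (hJ : J ⊆ S) => h.eq_zero_of_sq_eq_zero hex hJ
      obtain ⟨j, hj⟩ : S.Nonempty := by
        rw [← Finset.card_pos, hc]
        exact n.succ_pos
      have hbj := hb j hj
      have hsy := h.sq_y j hj
      have hES := Finset.erase_subset j S
      have hxy : x j * y j = y j * x j + y j := by
        have e := h.yx j hj
        have e' := h2 (y j * x j)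
        calc _ = (y j * x j + x j * y j) + (y j * x j) - (y j * x j + y j * x j) := by abel
          _ = _ := by rw [e, e', sub_zero, add_comm]
      have cy : ∀ e ∈ yAlg F y (S.erase j), Commute (y j) e := fun e he =>
        h.commute_yAlg_y hES he hj
      have cx : ∀ e ∈ yAlg F y (S.erase j), Commute (x j) e := fun e he =>
        h.commute_yAlg_x hES he hj (Finset.notMem_erase j S)
      have cE : ∀ e ∈ yAlg F y (S.erase j), ∀ e' ∈ yAlg F y (S.erase j), Commute e e' :=
        fun e he e' he' => h.commute_yAlg hES he he'
      have hfin := h.two_pow_le_finrank hb hES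
      rw [Finset.card_erase_of_mem hj, hc, Nat.add_sub_cancel] at hfin
      obtain ⟨α, hα, β, hβ, γ, hγ, hne, hN⟩ := exists_norm_eq_zero (h.sq_x j hj) hsy (h.yx j hj)
        (yAlg F y (S.erase j)) cE cx cy
        (by rw [pow_succ] at hV; have := Nat.two_pow_pos n; omega)
        (fun e he => h.exists_sq hES he) (hnil hES)
      have hβ0 : β ≠ 0 := by
        rintro rfl
        rw [mul_zero, mul_zero, zero_mul, add_zero, add_zero, ← hsy] at hN
        have e1 : (α + γ * y j) * (α + γ * y j) = 0 := by
          calc _ = α * α + α * γ * y j + γ * (y j * α) + γ * (y j * γ) * y j := by noncomm_ring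
            _ = (α * α + γ * γ * (y j * y j)) + (α * γ * y j + γ * α * y j) := by
              rw [(cy α hα).eq, (cy γ hγ).eq]
              noncomm_ring
            _ = 0 := by rw [hN, (cE α hα γ hγ).eq, h2, add_zero]
        have e2 := hnil subset_rfl (α + γ * y j)
          (add_mem (yAlg_mono y hES hα) (mul_mem (yAlg_mono y hES hγ) (mem_yAlg y hj))) e1
        have e3 : x j * (α + γ * y j) + (α + γ * y j) * x j = γ * y j := by
          calc _ = (x j * α + α * x j) + (x j * γ * y j + γ * (y j * x j)) := by noncomm_ring
            _ = γ * (y j * x j + x j * y j) := by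
              rw [(cx α hα).eq, (cx γ hγ).eq, h2]
              noncomm_ring
            _ = _ := by rw [h.yx j hj]
        rw [e2, mul_zero, zero_mul, add_zero] at e3
        have e4 : γ = 0 := by
          have e5 : γ * (y j * y j) = 0 := by rw [← mul_assoc, ← e3, zero_mul]
          rw [hsy, ← Algebra.commutes, ← Algebra.smul_def] at e5
          exact (smul_eq_zero.1 e5).resolve_left hbj
        rw [e4, zero_mul, add_zero] at e2
        simp [e2, e4] at hne
      obtain ⟨d, hd⟩ := h.exists_sq hES hβ
      have hd0 : d ≠ 0 := by
        rintro rfl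
        exact hβ0 (hnil hES β hβ (by rw [hd, map_zero]))
      have hz : d⁻¹ • (α * β) ∈ yAlg F y (S.erase j) :=
        Subalgebra.smul_mem _ (mul_mem hα hβ) _
      have hω : d⁻¹ • (γ * β) ∈ yAlg F y (S.erase j) :=
        Subalgebra.smul_mem _ (mul_mem hγ hβ) _
      have hββ : d⁻¹ • (β * β) = 1 := by
        rw [hd, Algebra.smul_def, ← map_mul, inv_mul_cancel₀ hd0, map_one]
      have hz2 : d⁻¹ • (α * β) * d⁻¹ • (α * β) = d⁻¹ • (α * α) := by
        rw [smul_mul_smul_comm, (cE α hα β hβ).symm.mul_mul_mul_comm, mul_smul,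
          ← mul_smul_comm d⁻¹, hββ, mul_one]
      have hω2 : d⁻¹ • (γ * β) * d⁻¹ • (γ * β) = d⁻¹ • (γ * γ) := by
        rw [smul_mul_smul_comm, (cE γ hγ β hβ).symm.mul_mul_mul_comm, mul_smul,
          ← mul_smul_comm d⁻¹, hββ, mul_one]
      have hrel : d⁻¹ • (α * β) * d⁻¹ • (α * β) + d⁻¹ • (α * β) + algebraMap F _ (a j) +
          d⁻¹ • (γ * β) * d⁻¹ • (γ * β) * algebraMap F _ (b j) = 0 := by
        rw [hz2, hω2]
        calc _ = d⁻¹ • (α * α) + d⁻¹ • (α * β) + d⁻¹ • (β * β) * algebraMap F _ (a j) +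
              d⁻¹ • (γ * γ) * algebraMap F _ (b j) := by rw [hββ, one_mul]
          _ = d⁻¹ • (α * α + α * β + β * β * algebraMap F _ (a j) +
              γ * γ * algebraMap F _ (b j)) := by
            simp only [smul_add, smul_mul_assoc]
          _ = 0 := by rw [hN, smul_zero]
      generalize d⁻¹ • (α * β) = ζ at hz hrel
      generalize d⁻¹ • (γ * β) = ω at hω hrel
      obtain ⟨s, hs⟩ := h.exists_sq hES hω
      obtain ⟨c', hc'⟩ := h.exists_sq hES hz
      obtain ⟨c, rfl⟩ : ∃ c : F, ζ = algebraMap F _ c := by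
        refine ⟨-(c' + a j + s * b j), ?_⟩
        rw [hc', hs] at hrel
        rw [map_neg, map_add, map_add, map_mul, ← sub_eq_zero, ← hrel]
        abel
      have haj : a j = c ^ 2 + c + b j * s := by
        apply (algebraMap F (End F V)).injective
        rw [hs, ← map_mul, ← map_mul, ← map_add, ← map_add, ← map_add,
          map_eq_zero_iff _ (algebraMap F (End F V)).injective] at hrel
        congr 1
        have h0 : (2 : F) = 0 := CharTwo.two_eq_zero
        linear_combination hrel - (c ^ 2 + c + b j * s) * h0
      have cyy : ∀ i ∈ S.erase j, Commute (y j) (y i) := fun i hi => h.comm_y j hj i (mem j i hi)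
      have cyx : ∀ i ∈ S.erase j, Commute (y j) (x i) := fun i hi =>
        (h.comm_xy i (mem j i hi) j hj (ne j i hi)).symm
      have cxy : ∀ i ∈ S.erase j, Commute (x j) (y i) := fun i hi =>
        h.comm_xy j hj i (mem j i hi) (ne j i hi).symm
      have cxx : ∀ i ∈ S.erase j, Commute (x j) (x i) := fun i hi => h.comm_x j hj i (mem j i hi)
      have hK : (x j + algebraMap F _ c + ω * y j) * y j =
          y j * (x j + algebraMap F _ c + ω * y j) + y j := by
        have e1 : ω * y j * y j = y j * (ω * y j) := by rw [← mul_assoc, (cy ω hω).eq]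
        rw [add_mul, add_mul, hxy, Algebra.commutes, e1]
        noncomm_ring
      refine step j hj ω hω (y j) (x j + algebraMap F _ c) (y j) (y j)
        (x j + algebraMap F _ c + ω * y j + 1) (b j) hsy cyx cyy
        (fun i hi => (cxx i hi).add_left (Algebra.commutes c (x i)))
        (fun i hi => (cxy i hi).add_left (Algebra.commutes c (y i))) cyx cyy ?_
        (Commute.refl _) ?_ ?_ ?_ ?_
      · have e1 : algebraMap F (End F V) c * y j = y j * algebraMap F _ c := Algebra.commutes _ _
        calc _ = (y j * x j + x j * y j) + (algebraMap F _ c * y j + y j * algebraMap F _ c) := by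
              noncomm_ring
          _ = y j := by rw [e1, h2, add_zero, h.yx j hj]
      · have e1 : algebraMap F (End F V) c * x j = x j * algebraMap F _ c := Algebra.commutes _ _
        have e2 : algebraMap F (End F V) c * ω = ω * algebraMap F _ c := Algebra.commutes _ _
        have e3 : algebraMap F (End F V) c * y j = y j * algebraMap F _ c := Algebra.commutes _ _
        have cxω := (cx ω hω).eq
        have cyω := (cy ω hω).eq
        have hx := h.sq_x j hj
        have hyx := h.yx j hj
        have e4 : (x j + algebraMap F _ c + ω * y j) * (x j + algebraMap F _ c + ω * y j + 1) =
            (x j * x j + x j) + (algebraMap F _ c * algebraMap F _ c + algebraMap F _ c) +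
            (x j * algebraMap F _ c + x j * algebraMap F _ c) +
            (ω * y j * algebraMap F _ c + ω * y j * algebraMap F _ c) +
            (ω * (y j * x j + x j * y j) + ω * y j) + ω * ω * (y j * y j) := by
          calc _ = (x j * x j + x j) + (algebraMap F _ c * algebraMap F _ c + algebraMap F _ c) +
                (x j * algebraMap F _ c + algebraMap F _ c * x j) +
                (ω * y j * algebraMap F _ c + algebraMap F _ c * ω * y j) +
                (ω * y j * x j + x j * ω * y j + ω * y j) + ω * (y j * ω) * y j := by
                noncomm_ring
            _ = _ := by
              rw [e1, e2, cxω, cyω, mul_assoc ω (algebraMap F _ c), e3]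
              noncomm_ring
        rw [e4, h2, h2, hyx, h2, hx, hsy, hs, add_zero, add_zero, add_zero, ← map_mul, ← map_add,
          ← map_mul, ← map_add, ← map_add, map_eq_zero_iff _ (algebraMap F (End F V)).injective]
        have h0 : (2 : F) = 0 := CharTwo.two_eq_zero
        linear_combination haj + (c ^ 2 + c + s * b j) * h0
      · intro h0
        have e0 : x j + algebraMap F _ c + ω * y j = 1 := by
          have := h2 (1 : End F V)
          exact add_right_cancel (h0.trans this.symm)
        rw [e0, one_mul, mul_one] at hK
        have e1 : y j = 0 := add_left_cancel (hK.symm.trans (add_zero _).symm)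
        obtain ⟨v, hv⟩ := exists_ne (0 : V)
        exact hv (yinj j hj (by simp [e1]))
      · intro v hv
        have e2 := LinearMap.congr_fun hK v
        rw [Module.End.mul_apply, LinearMap.add_apply (y j * _), Module.End.mul_apply, hv,
          map_zero, zero_add] at e2
        exact e2
      · intro s' hs'
        have : s' = s := (algebraMap F (End F V)).injective (hs'.symm.trans hs)
        rw [this, haj, pf_add_left, pf_artinSchreier c hbj, zero_add, pf_eq_dsym _ hbj,
          mul_div_cancel_left₀ _ hbj, dsym_comm]

section

/-- A full set of matrix units of an algebra. -/
structure MatrixUnits {M : Type*} [Ring M] (n : ℕ) (E : Fin n → Fin n → M) : Prop where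
  mul_same : ∀ i j k, E i j * E j k = E i k
  mul_ne : ∀ i j k l, j ≠ k → E i j * E k l = 0
  sum_eq : ∑ i, E i i = 1

theorem matrixUnits_single {A : Type*} [Ring A] (n : ℕ) :
    MatrixUnits n fun i j : Fin n => Matrix.single i j (1 : A) where
  mul_same i j k := by simp
  mul_ne i j k l h := by simp [h]
  sum_eq := by
    ext i j
    rw [Matrix.sum_apply, Finset.sum_eq_single i]
    · simp [Matrix.single_apply, Matrix.one_apply]
    · intro k _ hk
      simp [hk]
    · simp

theorem MatrixUnits.map {M N : Type*} [Ring M] [Ring N] {n : ℕ} {E : Fin n → Fin n → M}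
    (h : MatrixUnits n E) (f : M →+* N) : MatrixUnits n fun i j => f (E i j) where
  mul_same i j k := by rw [← map_mul, h.mul_same]
  mul_ne i j k l hjk := by rw [← map_mul, h.mul_ne i j k l hjk, map_zero]
  sum_eq := by rw [← map_sum, h.sum_eq, map_one]

section Corner

variable {F M : Type*} [Field F] [Ring M] [Algebra F M] {n n' : ℕ}
  {E : Fin n → Fin n → M} {U : Fin n' → Fin n' → M}

/-- The kernel of this operator is the corner `e M f`, for idempotents `e` and `f`. -/
def cornerOp (F : Type*) {M : Type*} [Field F] [Ring M] [Algebra F M] (e f : M) : End F M :=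
  LinearMap.mulLeft F e * LinearMap.mulRight F f - 1

theorem mem_ker_cornerOp {e f v : M} :
    v ∈ LinearMap.ker (cornerOp F e f) ↔ e * v * f = v := by
  rw [LinearMap.mem_ker, cornerOp, LinearMap.sub_apply, sub_eq_zero]
  simp [mul_assoc]

theorem finrank_corner_le [FiniteDimensional F M] (hE : MatrixUnits n E) (hU : MatrixUnits n' U)
    (i₀ : Fin n) (l₀ : Fin n') :
    n' * n * finrank F (LinearMap.ker (cornerOp F (U l₀ l₀) (E i₀ i₀))) ≤ finrank F M := by
  let V := LinearMap.ker (cornerOp F (U l₀ l₀) (E i₀ i₀))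
  let f : (Fin n' × Fin n → V) →ₗ[F] M := ∑ p : Fin n' × Fin n,
    LinearMap.mulLeft F (U p.1 l₀) ∘ₗ LinearMap.mulRight F (E i₀ p.2) ∘ₗ V.subtype ∘ₗ
      LinearMap.proj p
  have hf : Function.Injective f := by
    rw [injective_iff_map_eq_zero]
    intro w hw
    funext p
    apply Subtype.ext
    have e1 : ∑ r : Fin n' × Fin n, U r.1 l₀ * ((w r : M) * E i₀ r.2) = 0 := by
      simpa [f] using hw
    have e2 : U l₀ p.1 * (∑ r : Fin n' × Fin n, U r.1 l₀ * ((w r : M) * E i₀ r.2)) * E p.2 i₀ =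
        w p := by
      rw [Finset.mul_sum, Finset.sum_mul, Finset.sum_eq_single p]
      · calc _ = (U l₀ p.1 * U p.1 l₀) * w p * (E i₀ p.2 * E p.2 i₀) := by
              simp only [mul_assoc]
          _ = w p := by
              rw [hU.mul_same, hE.mul_same]
              exact mem_ker_cornerOp.1 (w p).2
      · intro r _ hr
        have e3 : U l₀ p.1 * (U r.1 l₀ * ((w r : M) * E i₀ r.2)) * E p.2 i₀ =
            (U l₀ p.1 * U r.1 l₀) * w r * (E i₀ r.2 * E p.2 i₀) := by
          simp only [mul_assoc]
        rw [e3]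
        by_cases h1 : p.1 = r.1
        · have h2 : r.2 ≠ p.2 := fun h2 => hr (Prod.ext h1.symm h2)
          rw [hE.mul_ne _ _ _ _ h2, mul_zero]
        · rw [hU.mul_ne _ _ _ _ h1, zero_mul, zero_mul]
      · simp
    rw [← e2, e1, mul_zero, zero_mul]
    rfl
  have := LinearMap.finrank_le_finrank_of_injective hf
  rw [finrank_pi_fintype] at this
  simpa using this

theorem nontrivial_corner [Nontrivial M] (hE : MatrixUnits n E) (hU : MatrixUnits n' U)
    (i₀ : Fin n) (l₀ : Fin n') :
    Nontrivial (LinearMap.ker (cornerOp F (U l₀ l₀) (E i₀ i₀))) := by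
  rw [Submodule.nontrivial_iff_ne_bot]
  intro hbot
  have h0 : ∀ v, U l₀ l₀ * v * E i₀ i₀ = 0 := by
    intro v
    have : U l₀ l₀ * v * E i₀ i₀ ∈ LinearMap.ker (cornerOp F (U l₀ l₀) (E i₀ i₀)) := by
      rw [mem_ker_cornerOp]
      calc _ = (U l₀ l₀ * U l₀ l₀) * v * (E i₀ i₀ * E i₀ i₀) := by simp only [mul_assoc]
        _ = _ := by rw [hU.mul_same, hE.mul_same]
    rw [hbot] at this
    exact this
  have h1 : U l₀ l₀ = 0 := by
    calc U l₀ l₀ = U l₀ l₀ * ∑ i, E i i := by rw [hE.sum_eq, mul_one]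
      _ = ∑ i, U l₀ l₀ * E i i₀ * E i₀ i₀ * E i₀ i := by
        rw [Finset.mul_sum]
        refine Finset.sum_congr rfl fun i _ => ?_
        rw [mul_assoc _ (E i i₀), hE.mul_same, mul_assoc, hE.mul_same]
      _ = 0 := by simp [h0]
  have h2 : (1 : M) = 0 := by
    rw [← hU.sum_eq]
    refine Finset.sum_eq_zero fun l _ => ?_
    rw [← hU.mul_same l l₀ l, ← hU.mul_same l l₀ l₀, h1, mul_zero, zero_mul]
  exact one_ne_zero h2

end Corner

section TwoSided

variable {F A M κ μ : Type*} [Field F] [Ring A] [Ring M] [Algebra F A] [Algebra F M]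

theorem System.map {S : Finset κ} {a b : κ → F} {x y : κ → A} (h : System S a b x y)
    (f : A →ₐ[F] M) : System S a b (fun i => f (x i)) (fun i => f (y i)) where
  sq_x i hi := by rw [← map_mul, ← map_add, h.sq_x i hi, AlgHom.commutes]
  sq_y i hi := by rw [← map_mul, h.sq_y i hi, AlgHom.commutes]
  yx i hi := by rw [← map_mul, ← map_mul, ← map_add, h.yx i hi]
  comm_x i hi j hj := (h.comm_x i hi j hj).map f
  comm_y i hi j hj := (h.comm_y i hi j hj).map f
  comm_xy i hi j hj hij := (h.comm_xy i hi j hj hij).map f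

/-- Two systems acting from the right and from the left. -/
theorem System.mulRight_mulLeft [Fintype κ] [Fintype μ] {a b : κ → F} {x y : κ → M}
    (h : System Finset.univ a b x y) {c e : μ → F} {z w : μ → M}
    (h' : System Finset.univ c e z w) :
    System Finset.univ (Sum.elim a c) (Sum.elim b e)
      (Sum.elim (fun i => LinearMap.mulRight F (x i)) (fun i => LinearMap.mulLeft F (z i)))
      (Sum.elim (fun i => LinearMap.mulRight F (y i)) (fun i => LinearMap.mulLeft F (w i))) := by
  have hRL : ∀ r s : M, Commute (LinearMap.mulRight F r) (LinearMap.mulLeft F s) := fun r s =>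
    LinearMap.ext fun v => by simp [mul_assoc]
  have hRR : ∀ r s : M, Commute r s → Commute (LinearMap.mulRight F r) (LinearMap.mulRight F s) :=
    fun r s hrs => LinearMap.ext fun v => by simp [mul_assoc, hrs.eq]
  have hLL : ∀ r s : M, Commute r s → Commute (LinearMap.mulLeft F r) (LinearMap.mulLeft F s) :=
    fun r s hrs => LinearMap.ext fun v => by simp [← mul_assoc, hrs.eq]
  refine ⟨?_, ?_, ?_, ?_, ?_, ?_⟩
  · rintro (i | i) -
    · ext v
      have := h.sq_x i (Finset.mem_univ i)
      simp [mul_assoc, ← mul_add, this, Algebra.smul_def, Algebra.commutes]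
    · ext v
      have := h'.sq_x i (Finset.mem_univ i)
      simp [← mul_assoc, ← add_mul, this, Algebra.smul_def]
  · rintro (i | i) -
    · ext v
      have := h.sq_y i (Finset.mem_univ i)
      simp [mul_assoc, this, Algebra.smul_def, Algebra.commutes]
    · ext v
      have := h'.sq_y i (Finset.mem_univ i)
      simp [← mul_assoc, this, Algebra.smul_def]
  · rintro (i | i) -
    · ext v
      have := h.yx i (Finset.mem_univ i)
      simp only [Sum.elim_inl, LinearMap.add_apply, Module.End.mul_apply,
        LinearMap.mulRight_apply, mul_assoc, ← mul_add]
      rw [add_comm, this]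
    · ext v
      have := h'.yx i (Finset.mem_univ i)
      simp [← mul_assoc, ← add_mul, this]
  · rintro (i | i) - (j | j) -
    · exact hRR _ _ (h.comm_x i (Finset.mem_univ i) j (Finset.mem_univ j))
    · exact hRL _ _
    · exact (hRL _ _).symm
    · exact hLL _ _ (h'.comm_x i (Finset.mem_univ i) j (Finset.mem_univ j))
  · rintro (i | i) - (j | j) -
    · exact hRR _ _ (h.comm_y i (Finset.mem_univ i) j (Finset.mem_univ j))
    · exact hRL _ _
    · exact (hRL _ _).symm
    · exact hLL _ _ (h'.comm_y i (Finset.mem_univ i) j (Finset.mem_univ j))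
  · rintro (i | i) - (j | j) - hij
    · exact hRR _ _ (h.comm_xy i (Finset.mem_univ i) j (Finset.mem_univ j)
        fun h => hij (congrArg _ h))
    · exact hRL _ _
    · exact (hRL _ _).symm
    · exact hLL _ _ (h'.comm_xy i (Finset.mem_univ i) j (Finset.mem_univ j)
        fun h => hij (congrArg _ h))

theorem commute_cornerOp_mulRight {e f r : M} (h : Commute f r) :
    Commute (cornerOp F e f) (LinearMap.mulRight F r) := by
  refine Commute.sub_left ?_ (Commute.one_left _)
  ext v
  simp [mul_assoc, h.eq]

theorem commute_cornerOp_mulLeft {e f r : M} (h : Commute e r) :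
    Commute (cornerOp F e f) (LinearMap.mulLeft F r) := by
  refine Commute.sub_left ?_ (Commute.one_left _)
  ext v
  simp [← mul_assoc, h.eq]

end TwoSided

theorem commute_single_scalar {F A : Type*} [Field F] [Ring A] [Algebra F A] (n : ℕ)
    (i j : Fin n) (r : A) :
    Commute (Matrix.single i j (1 : A)) (Matrix.scalar (Fin n) r) := by
  ext k l
  simp [Matrix.mul_diagonal, Matrix.diagonal_mul, Matrix.single_apply]

theorem le_two_pow_of_mul_le {n n' v D s t : ℕ} (hn : 0 < n) (hn' : 0 < n')
    (h : n' * n * v ≤ D) (hs : D ≤ n * n * 4 ^ s) (ht : D ≤ n' * n' * 4 ^ t) :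
    v ≤ 2 ^ (s + t) := by
  have h1 : (n' * n * v) ^ 2 ≤ (n' * n * 2 ^ (s + t)) ^ 2 := by
    calc (n' * n * v) ^ 2 ≤ D ^ 2 := Nat.pow_le_pow_left h 2
      _ ≤ (n * n * 4 ^ s) * (n' * n' * 4 ^ t) := by
        rw [sq]
        exact Nat.mul_le_mul hs ht
      _ = (n' * n * 2 ^ (s + t)) ^ 2 := by
        have : (4 : ℕ) = 2 ^ 2 := rfl
        rw [this, ← pow_mul, ← pow_mul]
        ring
  exact Nat.le_of_mul_le_mul_left ((Nat.pow_le_pow_iff_left two_ne_zero).1 h1)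
    (Nat.mul_pos hn' hn)

theorem sum_pf_add_sum_pf_eq_zero {F A B κ μ : Type} [Field F] [CharP F 2] (hI : CubeZero F)
    [Ring A] [Ring B] [Algebra F A] [Algebra F B] [FiniteDimensional F A] [FiniteDimensional F B]
    [Nontrivial A] [Fintype κ] [Fintype μ] {a b : κ → F} {x y : κ → A} {c e : μ → F}
    {z w : μ → B} (hA : System Finset.univ a b x y) (hB : System Finset.univ c e z w)
    (hb : ∀ i, b i ≠ 0) (he : ∀ i, e i ≠ 0) (hdA : finrank F A ≤ 4 ^ Fintype.card κ)
    (hdB : finrank F B ≤ 4 ^ Fintype.card μ) (h : BrauerEquiv F A B) :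
    ∑ i, pf (a i) (b i) + ∑ i, pf (c i) (e i) = 0 := by
  obtain ⟨n, n', hn, hn', ⟨Φ⟩⟩ := h
  let M := Matrix (Fin n) (Fin n) A
  have i₀ : Fin n := ⟨0, hn⟩
  have l₀ : Fin n' := ⟨0, hn'⟩
  have : Nonempty (Fin n) := ⟨i₀⟩
  have hE := matrixUnits_single (A := A) n
  have hU := (matrixUnits_single (A := B) n').map (Φ.symm : _ →+* M)
  let fA : A →ₐ[F] M := Matrix.scalarAlgHom (Fin n) F
  let fB : B →ₐ[F] M := Φ.symm.toAlgHom.comp (Matrix.scalarAlgHom (Fin n') F)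
  have hsys := (hA.map fA).mulRight_mulLeft (hB.map fB)
  have hcA : ∀ r, Commute (Matrix.single i₀ i₀ (1 : A)) (fA r) := fun r =>
    commute_single_scalar (F := F) n i₀ i₀ r
  have hcB : ∀ r, Commute (Φ.symm (Matrix.single l₀ l₀ (1 : B))) (fB r) := fun r =>
    (commute_single_scalar (F := F) n' l₀ l₀ r).map Φ.symm
  have hres := hsys.restrictKer
    (q := cornerOp F (Φ.symm (Matrix.single l₀ l₀ (1 : B))) (Matrix.single i₀ i₀ (1 : A)))
    (by
      rintro (i | i) -
      exacts [commute_cornerOp_mulRight (hcA _), commute_cornerOp_mulLeft (hcB _)])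
    (by
      rintro (i | i) -
      exacts [commute_cornerOp_mulRight (hcA _), commute_cornerOp_mulLeft (hcB _)])
  have hdim := finrank_corner_le (F := F) hE hU i₀ l₀
  have hnt : Nontrivial (LinearMap.ker (cornerOp F (Φ.symm (Matrix.single l₀ l₀ (1 : B)))
    (Matrix.single i₀ i₀ (1 : A)))) := nontrivial_corner (F := F) hE hU i₀ l₀
  have hM1 : finrank F M = n * n * finrank F A := by
    simp [M, finrank_matrix]
  have hM2 : finrank F M = n' * n' * finrank F B := by
    rw [Φ.toLinearEquiv.finrank_eq]
    simp [finrank_matrix]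
  have key := System.sum_pf_eq_zero hI (Fintype.card κ + Fintype.card μ) hres (by simp)
    (by rintro (i | i) - <;> simp [hb, he]) (by
      have hdim' : n' * n * finrank F (LinearMap.ker (cornerOp F
        (Φ.symm (Matrix.single l₀ l₀ (1 : B))) (Matrix.single i₀ i₀ (1 : A)))) ≤
          finrank F M := hdim
      refine le_two_pow_of_mul_le hn hn' hdim' ?_ ?_
      · rw [hM1]
        exact Nat.mul_le_mul_left _ hdA
      · rw [hM2]
        exact Nat.mul_le_mul_left _ hdB)
  rwa [Fintype.sum_sum_type] at key

end

section Symbol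

variable {F : Type} [Field F]

/-- The first generator of a symbol algebra. -/
def symX (a b : F) : SymbolAlg F 2 a b :=
  RingQuot.mkAlgHom F (SymbolRel F 2 a b) (FreeAlgebra.ι F 0)

/-- The second generator of a symbol algebra. -/
def symY (a b : F) : SymbolAlg F 2 a b :=
  RingQuot.mkAlgHom F (SymbolRel F 2 a b) (FreeAlgebra.ι F 1)

theorem symX_sq (a b : F) : symX a b * symX a b - symX a b = algebraMap F _ a := by
  have := RingQuot.mkAlgHom_rel F (SymbolRel.x (F := F) (p := 2) (a := a) (b := b))
  rwa [map_sub, sq, map_mul, AlgHom.commutes] at this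

theorem symY_sq (a b : F) : symY a b * symY a b = algebraMap F _ b := by
  have := RingQuot.mkAlgHom_rel F (SymbolRel.y (F := F) (p := 2) (a := a) (b := b))
  rwa [sq, map_mul, AlgHom.commutes] at this

theorem symY_mul_symX (a b : F) :
    symY a b * symX a b - symX a b * symY a b = symY a b := by
  have := RingQuot.mkAlgHom_rel F (SymbolRel.comm (F := F) (p := 2) (a := a) (b := b))
  rwa [map_sub, map_mul, map_mul] at this

/-- The standard generating family `1, x, y, y x` of a quaternion algebra. -/
def symSpan (a b : F) : Submodule F (SymbolAlg F 2 a b) :=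
  Submodule.span F
    (Set.range ![1, symX a b, symY a b, symY a b * symX a b])

theorem mem_symSpan (a b : F) :
    1 ∈ symSpan a b ∧ symX a b ∈ symSpan a b ∧ symY a b ∈ symSpan a b ∧
      symY a b * symX a b ∈ symSpan a b :=
  ⟨Submodule.subset_span ⟨0, rfl⟩, Submodule.subset_span ⟨1, rfl⟩,
    Submodule.subset_span ⟨2, rfl⟩, Submodule.subset_span ⟨3, rfl⟩⟩

theorem mul_mem_symSpan {a b : F} {r : SymbolAlg F 2 a b}
    (h : ∀ i, r * ![1, symX a b, symY a b, symY a b * symX a b] i ∈ symSpan a b)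
    {v : SymbolAlg F 2 a b} (hv : v ∈ symSpan a b) : r * v ∈ symSpan a b := by
  refine Submodule.span_induction (p := fun v _ => r * v ∈ symSpan a b) ?_ ?_ ?_ ?_ hv
  · rintro _ ⟨i, rfl⟩
    exact h i
  · rw [mul_zero]
    exact zero_mem _
  · intro v w _ _ hv hw
    rw [mul_add]
    exact add_mem hv hw
  · intro s v _ hv
    rw [mul_smul_comm]
    exact Submodule.smul_mem _ s hv

theorem symX_mul_mem_symSpan {a b : F} {v : SymbolAlg F 2 a b} (hv : v ∈ symSpan a b) :
    symX a b * v ∈ symSpan a b := by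
  obtain ⟨h1, hx, hy, hyx⟩ := mem_symSpan a b
  have exx : symX a b * symX a b = symX a b + a • 1 := by
    rw [← Algebra.algebraMap_eq_smul_one, ← symX_sq]
    abel
  have exy : symX a b * symY a b = symY a b * symX a b - symY a b := by
    rw [eq_sub_iff_add_eq, add_comm, ← eq_sub_iff_add_eq, symY_mul_symX]
  refine mul_mem_symSpan (fun i => ?_) hv
  fin_cases i
  · simpa using hx
  · change symX a b * symX a b ∈ _
    rw [exx]
    exact add_mem hx (Submodule.smul_mem _ _ h1)
  · change symX a b * symY a b ∈ _
    rw [exy]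
    exact sub_mem hyx hy
  · change symX a b * (symY a b * symX a b) ∈ _
    rw [← mul_assoc, exy, sub_mul, mul_assoc, exx, mul_add, add_sub_cancel_left, mul_smul_comm,
      mul_one]
    exact Submodule.smul_mem _ _ hy

theorem symY_mul_mem_symSpan {a b : F} {v : SymbolAlg F 2 a b} (hv : v ∈ symSpan a b) :
    symY a b * v ∈ symSpan a b := by
  obtain ⟨h1, hx, hy, hyx⟩ := mem_symSpan a b
  have eyy : symY a b * symY a b = b • 1 := by
    rw [← Algebra.algebraMap_eq_smul_one, ← symY_sq]
  refine mul_mem_symSpan (fun i => ?_) hv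
  fin_cases i
  · simpa using hy
  · exact hyx
  · change symY a b * symY a b ∈ _
    rw [eyy]
    exact Submodule.smul_mem _ _ h1
  · change symY a b * (symY a b * symX a b) ∈ _
    rw [← mul_assoc, eyy, smul_mul_assoc, one_mul]
    exact Submodule.smul_mem _ _ hx

theorem symSpan_eq_top (a b : F) : symSpan a b = ⊤ := by
  have key : ∀ t : FreeAlgebra F (Fin 2), ∀ v ∈ symSpan a b,
      RingQuot.mkAlgHom F (SymbolRel F 2 a b) t * v ∈ symSpan a b := by
    intro t
    induction t using FreeAlgebra.induction with
    | grade0 r =>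
      intro v hv
      rw [AlgHom.commutes, ← Algebra.smul_def]
      exact Submodule.smul_mem _ r hv
    | grade1 i =>
      intro v hv
      fin_cases i
      exacts [symX_mul_mem_symSpan hv, symY_mul_mem_symSpan hv]
    | mul s t hs ht =>
      intro v hv
      rw [map_mul, mul_assoc]
      exact hs _ (ht v hv)
    | add s t hs ht =>
      intro v hv
      rw [map_add, add_mul]
      exact add_mem (hs v hv) (ht v hv)
  refine Submodule.eq_top_iff'.2 fun r => ?_
  obtain ⟨t, rfl⟩ := RingQuot.mkAlgHom_surjective F (SymbolRel F 2 a b) r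
  rw [← mul_one (RingQuot.mkAlgHom F (SymbolRel F 2 a b) t)]
  exact key t 1 (mem_symSpan a b).1

instance finiteDimensional_symbolAlg (a b : F) : FiniteDimensional F (SymbolAlg F 2 a b) :=
  ⟨symSpan_eq_top a b ▸ (Submodule.fg_span (Set.finite_range _) : (symSpan a b).FG)⟩

theorem finrank_symbolAlg_le (a b : F) : finrank F (SymbolAlg F 2 a b) ≤ 4 := by
  rw [← finrank_top, ← symSpan_eq_top]
  exact (finrank_range_le_card _).trans (by simp)

theorem nontrivial_symbolAlg [CharP F 2] (a b : F) : Nontrivial (SymbolAlg F 2 a b) := by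
  have h : (2 : F) = 0 := CharTwo.two_eq_zero
  let X : Matrix (Fin 4) (Fin 4) F := !![0, a, 0, 0; 1, 1, 0, 0; 0, 0, -1, a; 0, 0, 1, 0]
  let Y : Matrix (Fin 4) (Fin 4) F := !![0, 0, b, 0; 0, 0, 0, b; 1, 0, 0, 0; 0, 1, 0, 0]
  let f : FreeAlgebra F (Fin 2) →ₐ[F] Matrix (Fin 4) (Fin 4) F := FreeAlgebra.lift F ![X, Y]
  have hf : ∀ s t, SymbolRel F 2 a b s t → f s = f t := by
    rintro _ _ (_ | _ | _)
    · simp only [f, map_sub, map_pow, FreeAlgebra.lift_ι_apply, AlgHom.commutes]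
      ext i j
      fin_cases i <;> fin_cases j <;>
        simp [X, sq, Matrix.algebraMap_matrix_apply]
      all_goals grind
    · simp only [f, map_pow, FreeAlgebra.lift_ι_apply, AlgHom.commutes]
      ext i j
      fin_cases i <;> fin_cases j <;>
        simp [Y, sq, Matrix.mul_apply, Fin.sum_univ_four, Matrix.algebraMap_matrix_apply]
    · simp only [f, map_sub, map_mul, FreeAlgebra.lift_ι_apply]
      ext i j
      fin_cases i <;> fin_cases j <;>
        simp [X, Y]
      all_goals grind
  exact (RingQuot.liftAlgHom F ⟨f, fun s t => hf s t⟩ :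
    SymbolAlg F 2 a b →ₐ[F] Matrix (Fin 4) (Fin 4) F).toRingHom.domain_nontrivial

end Symbol

section Tensor

variable {F : Type} [Field F] {m : ℕ}

theorem commute_singleAlgHom {A : Fin m → Type*} [∀ i, Ring (A i)] [∀ i, Algebra F (A i)]
    {i j : Fin m} (hij : i ≠ j) (r : A i) (s : A j) :
    Commute (PiTensorProduct.singleAlgHom (R := F) i r)
      (PiTensorProduct.singleAlgHom (R := F) j s) :=
  (Pi.mulSingle_commute hij r s).tprod

theorem tensor_system [CharP F 2] (a b : Fin m → F) :
    System Finset.univ a b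
      (fun i => PiTensorProduct.singleAlgHom (R := F) (A := fun i => SymbolAlg F 2 (a i) (b i))
        i (symX (a i) (b i)))
      (fun i => PiTensorProduct.singleAlgHom (R := F) (A := fun i => SymbolAlg F 2 (a i) (b i))
        i (symY (a i) (b i))) := by
  have hneg : ∀ i, ∀ r : SymbolAlg F 2 (a i) (b i), -r = r := fun i r => by
    rw [← neg_one_smul F, CharTwo.neg_eq, one_smul]
  refine ⟨fun i _ => ?_, fun i _ => ?_, fun i _ => ?_, fun i _ j _ => ?_, fun i _ j _ => ?_,
    fun i _ j _ hij => commute_singleAlgHom hij _ _⟩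
  · have := symX_sq (a i) (b i)
    rw [sub_eq_add_neg, hneg] at this
    rw [← map_mul, ← map_add, this, AlgHom.commutes]
  · rw [← map_mul, symY_sq, AlgHom.commutes]
  · have := symY_mul_symX (a i) (b i)
    rw [sub_eq_add_neg, hneg] at this
    rw [← map_mul, ← map_mul, ← map_add, this]
  · rcases eq_or_ne i j with rfl | hij
    exacts [Commute.refl _, commute_singleAlgHom hij _ _]
  · rcases eq_or_ne i j with rfl | hij
    exacts [Commute.refl _, commute_singleAlgHom hij _ _]

/-- A basis of a tensor product of quaternion algebras. -/
noncomputable def tensorBasis (a b : Fin m → F) :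
    Basis ((i : Fin m) → Fin (finrank F (SymbolAlg F 2 (a i) (b i)))) F
      (⨂[F] i, SymbolAlg F 2 (a i) (b i)) :=
  Basis.piTensorProduct fun i => finBasis F (SymbolAlg F 2 (a i) (b i))

theorem finiteDimensional_tensor (a b : Fin m → F) :
    FiniteDimensional F (⨂[F] i, SymbolAlg F 2 (a i) (b i)) :=
  (tensorBasis a b).finiteDimensional_of_finite

theorem finrank_tensor_le (a b : Fin m → F) :
    finrank F (⨂[F] i, SymbolAlg F 2 (a i) (b i)) ≤ 4 ^ m := by
  rw [finrank_eq_card_basis (tensorBasis a b)]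
  simp only [Fintype.card_pi, Fintype.card_fin]
  exact (Finset.prod_le_pow_card _ _ 4 fun i _ => finrank_symbolAlg_le _ _).trans (by simp)

theorem nontrivial_tensor [CharP F 2] (a b : Fin m → F) :
    Nontrivial (⨂[F] i, SymbolAlg F 2 (a i) (b i)) := by
  have : ∀ i, Nonempty (Fin (finrank F (SymbolAlg F 2 (a i) (b i)))) := fun i =>
    have := nontrivial_symbolAlg (a i) (b i)
    ⟨0, finrank_pos⟩
  exact ⟨_, 0, (tensorBasis a b).ne_zero (Classical.arbitrary _)⟩

end Tensor

theorem sum_pf_eq_of_brauerEquiv {F : Type} [Field F] [CharP F 2] (hI : CubeZero F) {m k : ℕ}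
    {a b : Fin m → F} {c e : Fin k → F} (hb : ∀ i, b i ≠ 0) (he : ∀ i, e i ≠ 0)
    (h : BrauerEquiv F (PiTensorProduct F fun i => SymbolAlg F 2 (a i) (b i))
      (PiTensorProduct F fun i => SymbolAlg F 2 (c i) (e i))) :
    ∑ i, pf (a i) (b i) = ∑ i, pf (c i) (e i) := by
  have := finiteDimensional_tensor a b
  have := finiteDimensional_tensor c e
  have := nontrivial_tensor a b
  refine Witt.eq_of_add_eq_zero (sum_pf_add_sum_pf_eq_zero hI (tensor_system a b)
    (tensor_system c e) hb he ?_ ?_ h)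
  · rw [Fintype.card_fin]
    exact finrank_tensor_le a b
  · rw [Fintype.card_fin]
    exact finrank_tensor_le c e

section Family

variable {F : Type} [Field F] {n : ℕ}

/-- The quadratic form `[a₁, b₁] ⊥ ⋯ ⊥ [aₙ, bₙ]`. -/
def famForm (a b : Fin n → F) : QuadraticForm F (Fin n → F × F) :=
  QuadraticMap.pi fun i => binForm (a i) (b i)

theorem famForm_apply (a b : Fin n → F) (v : Fin n → F × F) :
    famForm a b v = binSum F a b v := by
  simp [famForm, binSum]

/-- Multiplication of all second coordinates by a nonzero scalar. -/
def scaleSnd {c : F} (hc : c ≠ 0) : (Fin n → F × F) ≃ₗ[F] (Fin n → F × F) :=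
  LinearEquiv.piCongrRight fun _ =>
    LinearEquiv.prodCongr (LinearEquiv.refl F F) (LinearEquiv.smulOfNeZero F F c hc)

theorem binSum_scaleSnd {c : F} (hc : c ≠ 0) (a b : Fin n → F) (v : Fin n → F × F) :
    binSum F (fun i => c * a i) (fun i => b i / c) (scaleSnd hc v) = c * binSum F a b v := by
  rw [binSum, binSum, Finset.mul_sum]
  refine Finset.sum_congr rfl fun i _ => ?_
  have h1 : (scaleSnd hc v i).1 = (v i).1 := rfl
  have h2 : (scaleSnd hc v i).2 = c * (v i).2 := rfl
  rw [h1, h2]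
  field_simp

theorem anisoBin_scale {a b : Fin n → F} (h : AnisoBin F a b) {c : F} (hc : c ≠ 0) :
    AnisoBin F (fun i => c * a i) (fun i => b i / c) := by
  intro v hv
  obtain ⟨w, rfl⟩ := (scaleSnd hc).surjective v
  rw [binSum_scaleSnd, mul_eq_zero, or_iff_right hc] at hv
  rw [h w hv, map_zero]

theorem anisoBin_left_ne_zero {a b : Fin n → F} (h : AnisoBin F a b) (i : Fin n) : a i ≠ 0 := by
  intro hi
  have h0 := congrFun (h (Pi.single i (1, 0)) ?_) i
  · rw [Pi.single_eq_same] at h0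
    exact one_ne_zero (congrArg Prod.fst h0)
  · refine Finset.sum_eq_zero fun j _ => ?_
    rcases eq_or_ne j i with rfl | hj
    · simp [hi]
    · simp [hj]

theorem exists_polar_eq_zero_ne_zero {V : Type*} [AddCommGroup V] [Module F V]
    [FiniteDimensional F V] {Q : QuadraticForm F V} (hQ : Nonsing Q) (hd : 2 < finrank F V)
    {v : V} (hv : v ≠ 0) : ∃ w, QuadraticMap.polar Q v w = 0 ∧ Q w ≠ 0 := by
  by_contra! h
  have hiso : ∀ w ∈ LinearMap.BilinForm.orthogonal Q.polarBilin (F ∙ v), Q w = 0 :=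
    fun w hw => h w (hw v (Submodule.mem_span_singleton_self v))
  have hfo := LinearMap.BilinForm.finrank_orthogonal hQ.nondegenerate (F ∙ v)
  rw [finrank_span_singleton hv] at hfo
  have := (orthogonal_eq_self hQ hiso (by omega)).2
  omega

theorem finrank_famForm (n : ℕ) : finrank F (Fin n → F × F) = 2 * n := by
  simp [finrank_pi_fintype, mul_comm]

variable [CharP F 2]

theorem famForm_nonsing (a b : Fin n → F) : Nonsing (famForm a b) := by
  intro x hx
  funext i
  refine binForm_nonsing (a i) (b i) _ fun y => ?_
  have h := hx (Pi.single i y)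
  rw [famForm, QuadraticMap.Ring.polar_pi] at h
  rw [Finset.sum_eq_single i] at h
  · rwa [Pi.single_eq_same] at h
  · intro j _ hj
    rw [Pi.single_eq_of_ne hj, QuadraticMap.polar_zero_right]
  · simp

/-- The quadratic space of `[a₁, b₁] ⊥ ⋯ ⊥ [aₙ, bₙ]`. -/
def famSpace (a b : Fin n → F) : QSpace F where
  V := Fin n → F × F
  Q := famForm a b
  nonsing := famForm_nonsing a b

theorem mk_famSpace (a b : Fin n → F) : Witt.mk (famSpace a b) = ∑ i, br (a i) (b i) := by
  induction n with
  | zero =>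
    rw [Finset.univ_eq_empty, Finset.sum_empty]
    refine Witt.mk_eq_zero_iff.2 ⟨⊤, fun x _ => ?_, ?_⟩
    · exact (famForm_apply a b x).trans Finset.sum_empty
    · change finrank F (Fin 0 → F × F) ≤ _
      rw [finrank_zero_of_subsingleton]
      exact Nat.zero_le _
  | succ n ih =>
    rw [Fin.sum_univ_succ, ← ih (fun i => a i.succ) (fun i => b i.succ)]
    have h (x : (F × F) × (Fin n → F × F)) : famForm a b (Fin.consLinearEquiv F (fun _ => F × F) x)
        = binForm (a 0) (b 0) x.1 + famForm (fun i => a i.succ) (fun i => b i.succ) x.2 := by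
      simp [famForm, Fin.sum_univ_succ]
    exact (Witt.mk_eq_of_linearEquiv
      (X := (binSpace (a 0) (b 0)).sum (famSpace (fun i => a i.succ) fun i => b i.succ))
      (Y := famSpace a b) (Fin.consLinearEquiv F fun _ => F × F) h).symm

theorem hyp_famForm_prod {k : ℕ} {a b : Fin n → F} {c d : Fin k → F}
    (h : ∑ i, br (a i) (b i) = ∑ i, br (c i) (d i)) :
    Hyp ((famForm a b).prod (famForm c d)) := by
  rw [← mk_famSpace, ← mk_famSpace] at h
  exact Witt.mk_eq_iff.1 h

theorem hyp_famForm_prod_prod {k : ℕ} {a b : Fin n → F} {c d : Fin k → F} {s t : F}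
    (h : ∑ i, br (a i) (b i) = br s t + ∑ i, br (c i) (d i)) :
    Hyp ((famForm a b).prod ((binForm s t).prod (famForm c d))) := by
  rw [← mk_famSpace, ← mk_famSpace] at h
  exact (Witt.mk_eq_iff (X := famSpace a b) (Y := (binSpace s t).sum (famSpace c d))).1 h

theorem sum_br {ι : Type*} (s : Finset ι) (c : F) (d : ι → F) :
    ∑ i ∈ s, br c (d i) = br c (∑ i ∈ s, d i) :=
  (map_sum (AddMonoidHom.mk' (br c) fun x y => br_add_right c x y) d s).symm

/-- A form whose diagonal products sum to zero lies in the second power of the fundamental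
ideal, hence is isometric to its nonzero multiples up to Witt equivalence. -/
theorem CubeZero.sum_br_scale (hI : CubeZero F) {a b : Fin n → F} (ha : ∀ i, a i ≠ 0)
    (hab : ∑ i, a i * b i = 0) {c : F} (hc : c ≠ 0) :
    ∑ i, br (c * a i) (b i / c) = ∑ i, br (a i) (b i) := by
  have e1 : ∀ i, br (a i) (b i) = sc (a i * b i) (a i) := fun i => by
    rw [sc, mul_div_cancel_left₀ _ (ha i)]
  have e2 : ∀ i, br (c * a i) (b i / c) = sc (a i * b i) (c * a i) := fun i => by
    rw [sc, mul_comm c, mul_div_mul_left _ _ (ha i)]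
  have e3 : ∀ i, br (c * a i) (b i / c) =
      br (a i) (b i) + (br 1 (a i * b i) + br c (a i * b i / c)) := fun i => by
    have h := hI.sc_add (a i * b i) hc (ha i)
    rw [e1, e2]
    apply Witt.eq_of_add_eq_zero
    rw [← h]
    simp only [sc, div_one]
    abel
  have e4 : ∑ i, br 1 (a i * b i) = 0 := by rw [sum_br, hab, br_zero_right]
  have e5 : ∑ i, br c (a i * b i / c) = 0 := by
    rw [sum_br, ← Finset.sum_div, hab, zero_div, br_zero_right]
  rw [Finset.sum_congr rfl fun i _ => e3 i, Finset.sum_add_distrib, Finset.sum_add_distrib, e4,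
    e5, add_zero, add_zero]

/-- Adding a form `[1, δ]` to an anisotropic form of dimension at least four gives an anisotropic
form if the Arf invariant becomes trivial. -/
theorem CubeZero.anisoBin (hI : CubeZero F) {a b b' : Fin n → F} {δ : F} (hn : 2 ≤ n)
    (h : AnisoBin F a b) (hab : ∑ i, a i * b' i = 0)
    (hδ : ∑ i, br (a i) (b i) = br 1 δ + ∑ i, br (a i) (b' i)) : AnisoBin F a b' := by
  intro v hv
  by_contra hv0
  rw [← famForm_apply] at hv
  have hdim := finrank_famForm (F := F) n
  obtain ⟨w, hvw, hw⟩ := exists_polar_eq_zero_ne_zero (famForm_nonsing a b') (by omega) hv0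
  have hc := inv_ne_zero hw
  set c := (famForm a b' w)⁻¹ with hcdef
  rw [← hI.sum_br_scale (anisoBin_left_ne_zero h) hab hc] at hδ
  let f : F × F →ₗ[F] (F × F) × (Fin n → F × F) :=
    LinearMap.prod (LinearMap.inl F F F ∘ₗ LinearMap.snd F F F)
      ((scaleSnd hc).toLinearMap ∘ₗ LinearMap.coprod (LinearMap.toSpanSingleton F _ v)
        (LinearMap.toSpanSingleton F _ w))
  have hf : Function.Injective f := by
    rw [injective_iff_map_eq_zero]
    intro p hp
    have h2 : p.2 = 0 := congrArg (fun q => q.1.1) hp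
    have h1 : scaleSnd hc (p.1 • v + p.2 • w) = 0 := congrArg Prod.snd hp
    rw [h2, zero_smul, add_zero, map_eq_zero_iff _ (scaleSnd hc).injective, smul_eq_zero,
      or_iff_left hv0] at h1
    exact Prod.ext h1 h2
  have key := finrank_add_le_of_hyp_prod (famForm_nonsing a b)
    ((binForm_nonsing 1 δ).prod (famForm_nonsing _ _))
    (fun x hx => h x (famForm_apply a b x ▸ hx)) (hyp_famForm_prod_prod hδ) (LinearMap.range f) (by
      rintro _ ⟨p, rfl⟩
      have e1 : famForm a b' (p.1 • v + p.2 • w) = p.2 * p.2 * famForm a b' w := by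
        rw [QuadraticMap.map_add (famForm a b'), QuadraticMap.map_smul, QuadraticMap.map_smul, hv,
          QuadraticMap.polar_smul_left, QuadraticMap.polar_smul_right, hvw]
        simp
      have e2 : (f p).2 = scaleSnd hc (p.1 • v + p.2 • w) := rfl
      have e3 : (f p).1 = (p.2, 0) := rfl
      rw [QuadraticMap.prod_apply, e2, e3, famForm_apply, binSum_scaleSnd, ← famForm_apply, e1,
        binForm_apply, mul_left_comm, hcdef, inv_mul_cancel₀ hw]
      linear_combination p.2 ^ 2 * (CharTwo.two_eq_zero : (2 : F) = 0))
  rw [LinearMap.finrank_range_of_inj hf, finrank_prod, hdim, finrank_prod, finrank_prod,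
    finrank_self] at key
  omega

theorem sum_pf_eq (c e : Fin n → F) :
    ∑ i, pf (c i) (e i) = ∑ i, br ((Fin.cons 1 e : Fin (n + 1) → F) i)
      ((Fin.cons (∑ i, c i) fun i => c i / e i : Fin (n + 1) → F) i) := by
  simp [Fin.sum_univ_succ, pf, Finset.sum_add_distrib, sum_br]

end Family

theorem exists_sum_pf_minimal {F : Type} [Field F] [CharP F 2] (hI : CubeZero F) {m : ℕ}
    {α β : Fin (m + 1) → F} (h : AnisoBin F α β) (hm : 1 ≤ m) :
    ∃ a b : Fin m → F, (∀ i, b i ≠ 0) ∧ ∀ (k : ℕ) (c e : Fin k → F),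
      ∑ i, pf (a i) (b i) = ∑ i, pf (c i) (e i) → m ≤ k := by
  have hα := anisoBin_left_ne_zero h 0
  replace h := anisoBin_scale h (inv_ne_zero hα)
  set A : Fin (m + 1) → F := fun i => (α 0)⁻¹ * α i with hA
  set B : Fin (m + 1) → F := fun i => β i / (α 0)⁻¹
  have hA0 : A 0 = 1 := inv_mul_cancel₀ hα
  have hne := anisoBin_left_ne_zero h
  let a : Fin m → F := fun i => A i.succ * B i.succ
  let b : Fin m → F := fun i => A i.succ
  let B' : Fin (m + 1) → F := Fin.cons (∑ i, a i) fun i => a i / b i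
  have hcons : (Fin.cons 1 b : Fin (m + 1) → F) = A := by
    rw [← hA0]
    exact Fin.cons_self_tail A
  have hB' : ∀ i : Fin m, B' i.succ = B i.succ := fun i => mul_div_cancel_left₀ _ (hne i.succ)
  have hsum : ∑ i, A i * B' i = 0 := by
    rw [Fin.sum_univ_succ, hA0, one_mul]
    simp only [hB']
    exact CharTwo.add_self_eq_zero _
  have hB0 : B 0 = (B 0 + B' 0) + B' 0 := by
    rw [add_assoc, CharTwo.add_self_eq_zero, add_zero]
  have haniso : AnisoBin F A B' := by
    refine hI.anisoBin (δ := B 0 + B' 0) (by omega) h hsum ?_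
    rw [Fin.sum_univ_succ, Fin.sum_univ_succ, hA0, ← add_assoc, ← br_add_right, ← hB0]
    simp only [hB']
  refine ⟨a, b, fun i => hne i.succ, fun k c e hce => ?_⟩
  rw [sum_pf_eq, sum_pf_eq, hcons] at hce
  have key := finrank_add_le_of_hyp_prod (famForm_nonsing A B') (famForm_nonsing _ _)
    (fun x hx => haniso x (famForm_apply A B' x ▸ hx)) (hyp_famForm_prod hce) ⊥ (by simp)
  rw [finrank_famForm, finrank_famForm, finrank_bot] at key
  omega

end CharTwoWitt

open scoped PiTensorProduct in
/-- If `char F = 2`, `I_q³F = 0` (every quadratic 3-fold Pfister form is isotropic) and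
`2 ≤ u(F) < ∞`, then there is an exponent-2 algebra (a tensor product of `u(F)/2 - 1`
quaternion algebras) whose symbol length is exactly `u(F)/2 - 1`: it is not Brauer
equivalent to any tensor product of fewer quaternion algebras. Hence the bound
`u(F)/2 - 1` is sharp. -/
theorem symbolLength_sharp (F : Type) [Field F] [CharP F 2] (u : ℕ) (hu : 2 ≤ u)
    (hu₁ : ∀ (n : ℕ) (a b : Fin n → F), AnisoBin F a b → 2 * n ≤ u)
    (hu₂ : ∃ (n : ℕ) (a b : Fin n → F), AnisoBin F a b ∧ 2 * n = u)
    (hI3 : ∀ a b c : F, a ≠ 0 → b ≠ 0 → ∃ v : Fin 4 → F × F, v ≠ 0 ∧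
      ∑ i, (![1, a, b, a * b] i) * ((v i).1 ^ 2 + (v i).1 * (v i).2 + c * (v i).2 ^ 2) = 0) :
    ∃ (m : ℕ) (a b : Fin m → F), m = u / 2 - 1 ∧ (∀ i, b i ≠ 0) ∧
      ∀ (k : ℕ) (c e : Fin k → F), (∀ i, e i ≠ 0) →
        BrauerEquiv F (⨂[F] i, SymbolAlg F 2 (a i) (b i))
          (⨂[F] i, SymbolAlg F 2 (c i) (e i)) → m ≤ k := by
  obtain ⟨n, α, β, h, rfl⟩ := hu₂
  obtain ⟨m, rfl⟩ : ∃ m, n = m + 1 := ⟨n - 1, by omega⟩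
  have hm : m = 2 * (m + 1) / 2 - 1 := by omega
  rcases Nat.eq_zero_or_pos m with rfl | hm0
  · exact ⟨0, 0, 0, hm, fun i => i.elim0, fun k _ _ _ _ => k.zero_le⟩
  · obtain ⟨a, b, hb, hmin⟩ := CharTwoWitt.exists_sum_pf_minimal hI3 h hm0
    exact ⟨m, a, b, hm, hb, fun k c e he hBr =>
      hmin k c e (CharTwoWitt.sum_pf_eq_of_brauerEquiv hI3 hb he hBr)⟩
end

section
/- Let F be a field of characteristic 2 and φ an anisotropic nonsingular quadratic form over F of even dimension 2n with trivial Arf invariant, where n ≥ 2. If I_q³F = 0, then the Clifford invariant E(φ), a tensor product of n−1 quaternion algebras, is not Brauer equivalent to any tensor product of fewer than n−1 quaternion algebras. -/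
open scoped TensorProduct

section QuadraticForms

variable {F : Type} [Field F]

/-- The orthogonal sum of the binary forms `d (r² + r s + c s²)`, `(d, c) = x i`. -/
def normSum {ι : Type} [Fintype ι] (x : ι → Fˣ × F) (v : ι → F × F) : F :=
  ∑ i, ((x i).1 : F) * ((v i).1 ^ 2 + (v i).1 * (v i).2 + (x i).2 * (v i).2 ^ 2)

/-- A form `normSum x` is hyperbolic if it has a totally singular subspace of half dimension. -/
def IsHyperbolicSum {ι : Type} [Fintype ι] (x : ι → Fˣ × F) : Prop :=
  ∃ N : Submodule F (ι → F × F), Fintype.card ι ≤ Module.finrank F N ∧ ∀ v ∈ N, normSum x v = 0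

/-- The polar form of `normSum x` in characteristic two. -/
def normSumPolar {ι : Type} [Fintype ι] (x : ι → Fˣ × F) : LinearMap.BilinForm F (ι → F × F) :=
  LinearMap.mk₂ F (fun v w => ∑ i, ((x i).1 : F) * ((v i).1 * (w i).2 + (v i).2 * (w i).1))
    (fun v v' w => by
      rw [← Finset.sum_add_distrib]
      refine Finset.sum_congr rfl fun i _ => ?_
      simp only [Pi.add_apply, Prod.fst_add, Prod.snd_add]; ring)
    (fun c v w => by
      rw [smul_eq_mul, Finset.mul_sum]
      refine Finset.sum_congr rfl fun i _ => ?_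
      simp only [Pi.smul_apply, Prod.smul_fst, Prod.smul_snd, smul_eq_mul]; ring)
    (fun v w w' => by
      rw [← Finset.sum_add_distrib]
      refine Finset.sum_congr rfl fun i _ => ?_
      simp only [Pi.add_apply, Prod.fst_add, Prod.snd_add]; ring)
    (fun c v w => by
      rw [smul_eq_mul, Finset.mul_sum]
      refine Finset.sum_congr rfl fun i _ => ?_
      simp only [Pi.smul_apply, Prod.smul_fst, Prod.smul_snd, smul_eq_mul]; ring)

theorem normSumPolar_apply {ι : Type} [Fintype ι] (x : ι → Fˣ × F) (v w : ι → F × F) :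
    normSumPolar x v w = ∑ i, ((x i).1 : F) * ((v i).1 * (w i).2 + (v i).2 * (w i).1) := rfl

theorem normSum_add [CharP F 2] {ι : Type} [Fintype ι] (x : ι → Fˣ × F) (v w : ι → F × F) :
    normSum x (v + w) = normSum x v + normSum x w + normSumPolar x v w := by
  have h2 : (2 : F) = 0 := CharTwo.two_eq_zero
  simp only [normSum, normSumPolar_apply, ← Finset.sum_add_distrib]
  refine Finset.sum_congr rfl fun i _ => ?_
  simp only [Pi.add_apply, Prod.fst_add, Prod.snd_add]
  linear_combination ((x i).1 : F) * ((v i).1 * (w i).1 + (x i).2 * (v i).2 * (w i).2) * h2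

theorem normSumPolar_ker {ι : Type} [Fintype ι] (x : ι → Fˣ × F) :
    LinearMap.ker (normSumPolar x) = ⊥ := by
  classical
  rw [LinearMap.ker_eq_bot']
  intro v hv
  funext i
  have h (u : F × F) : (v i).1 * u.2 + (v i).2 * u.1 = 0 := by
    have := LinearMap.congr_fun hv (Pi.single i u)
    rw [normSumPolar_apply, Finset.sum_eq_single i] at this
    · simpa using this
    · intro j _ hj
      simp [Pi.single_eq_of_ne hj]
    · simp
  ext
  · simpa using h (0, 1)
  · simpa using h (1, 0)

theorem finrank_add_finrank_le_of_normSumPolar_eq_zero {ι : Type} [Fintype ι] (x : ι → Fˣ × F)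
    (S T : Submodule F (ι → F × F)) (h : ∀ s ∈ S, ∀ t ∈ T, normSumPolar x s t = 0) :
    Module.finrank F S + Module.finrank F T ≤ 2 * Fintype.card ι := by
  have h1 := LinearMap.BilinForm.finrank_add_finrank_orthogonal' (B := normSumPolar x) S
  rw [normSumPolar_ker, inf_bot_eq, finrank_bot, add_zero] at h1
  have h2 : T ≤ (normSumPolar x).orthogonal S := fun t ht s hs => h s hs t ht
  have h3 := Submodule.finrank_mono h2
  have h4 : Module.finrank F (ι → F × F) = 2 * Fintype.card ι := by
    simp [Module.finrank_pi_fintype, mul_comm]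
  omega

theorem Submodule.finrank_map_add_finrank_inf_ker {K V W : Type*} [Field K] [AddCommGroup V]
    [Module K V] [FiniteDimensional K V] [AddCommGroup W] [Module K W] (f : V →ₗ[K] W)
    (S : Submodule K V) :
    Module.finrank K (S.map f) + Module.finrank K (S ⊓ LinearMap.ker f : Submodule K V) =
      Module.finrank K S := by
  have h := LinearMap.finrank_range_add_finrank_ker (f.domRestrict S)
  rw [LinearMap.range_domRestrict] at h
  rw [← h, ← Submodule.map_comap_subtype, ← LinearMap.ker_comp, Submodule.finrank_map_subtype_eq]
  rfl

theorem IsHyperbolicSum.sumElim {ι κ : Type} [Fintype ι] [Fintype κ] {x : ι → Fˣ × F}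
    {y : κ → Fˣ × F} (hx : IsHyperbolicSum x) (hy : IsHyperbolicSum y) :
    IsHyperbolicSum (Sum.elim x y) := by
  obtain ⟨N, hN, hN0⟩ := hx
  obtain ⟨M, hM, hM0⟩ := hy
  set f : (N × M) →ₗ[F] (ι ⊕ κ → F × F) :=
    (LinearEquiv.sumArrowLequivProdArrow ι κ F (F × F)).symm.toLinearMap ∘ₗ
      N.subtype.prodMap M.subtype with hf
  have hinj : Function.Injective f := by
    rw [hf, LinearMap.coe_comp, LinearMap.coe_prodMap]
    exact (LinearEquiv.injective _).comp (N.subtype_injective.prodMap M.subtype_injective)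
  refine ⟨LinearMap.range f, ?_, ?_⟩
  · rw [LinearMap.finrank_range_of_inj hinj, Module.finrank_prod, Fintype.card_sum]
    omega
  · rintro _ ⟨⟨v, w⟩, rfl⟩
    have h1 := hN0 v v.2
    have h2 := hM0 w w.2
    simp only [normSum] at h1 h2 ⊢
    rw [Fintype.sum_sum_type]
    simp [hf, h1, h2]

theorem IsHyperbolicSum.of_sumElim [CharP F 2] {ι κ : Type} [Fintype ι] [Fintype κ]
    {x : ι → Fˣ × F} {y : κ → Fˣ × F} (hxy : IsHyperbolicSum (Sum.elim x y))
    (hy : IsHyperbolicSum y) : IsHyperbolicSum x := by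
  obtain ⟨N, hN, hN0⟩ := hxy
  obtain ⟨M, hM, hM0⟩ := hy
  have hNB : ∀ v ∈ N, ∀ w ∈ N, normSumPolar (Sum.elim x y) v w = 0 := fun v hv w hw => by
    have := normSum_add (Sum.elim x y) v w
    rw [hN0 v hv, hN0 w hw, hN0 _ (N.add_mem hv hw)] at this
    simpa using this.symm
  have hMB : ∀ v ∈ M, ∀ w ∈ M, normSumPolar y v w = 0 := fun v hv w hw => by
    have := normSum_add y v w
    rw [hM0 v hv, hM0 w hw, hM0 _ (M.add_mem hv hw)] at this
    simpa using this.symm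
  set fl : (ι ⊕ κ → F × F) →ₗ[F] (ι → F × F) := LinearMap.funLeft F (F × F) Sum.inl with hfl
  set fr : (ι ⊕ κ → F × F) →ₗ[F] (κ → F × F) := LinearMap.funLeft F (F × F) Sum.inr with hfr
  set W := M.comap fr with hW
  have hWdim : 2 * Fintype.card ι + Module.finrank F M ≤ Module.finrank F W := by
    have h1 := LinearMap.finrank_range_add_finrank_ker (M.mkQ ∘ₗ fr)
    rw [LinearMap.ker_comp, Submodule.ker_mkQ, ← hW] at h1
    have h2 := Submodule.finrank_le (LinearMap.range (M.mkQ ∘ₗ fr))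
    have h3 := Submodule.finrank_quotient_add_finrank M
    have h4 : Module.finrank F (ι ⊕ κ → F × F) = 2 * Fintype.card ι + 2 * Fintype.card κ := by
      simp [Module.finrank_pi_fintype]; ring
    have h5 : Module.finrank F (κ → F × F) = 2 * Fintype.card κ := by
      simp [Module.finrank_pi_fintype, mul_comm]
    omega
  have hle := finrank_add_finrank_le_of_normSumPolar_eq_zero (Sum.elim x y)
    (N ⊓ W ⊓ LinearMap.ker fl) (N ⊔ W) (by
      rintro z ⟨⟨hzN, hzW⟩, hz0⟩ t ht
      obtain ⟨n, hn, w, hw, rfl⟩ := Submodule.mem_sup.mp ht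
      rw [map_add, hNB z hzN n hn, zero_add, normSumPolar_apply, Fintype.sum_sum_type]
      have h1 := hMB _ hzW _ hw
      rw [normSumPolar_apply] at h1
      have h0 : ∀ i, z (Sum.inl i) = 0 := fun i => congr_fun hz0 i
      simpa [h0, hfr, LinearMap.funLeft_apply] using h1)
  rw [Fintype.card_sum] at hle hN
  have hsup := Submodule.finrank_sup_add_finrank_inf_eq N W
  have hmap := Submodule.finrank_map_add_finrank_inf_ker fl (N ⊓ W)
  refine ⟨(N ⊓ W).map fl, by omega, ?_⟩
  rintro _ ⟨v, ⟨hvN, hvW⟩, rfl⟩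
  have h1 := hN0 v hvN
  have h2 := hM0 _ hvW
  rw [normSum, Fintype.sum_sum_type] at h1
  simp only [normSum, hfr, LinearMap.funLeft_apply] at h2
  simp only [Sum.elim_inr, Sum.elim_inl, h2, add_zero] at h1
  exact h1

theorem IsHyperbolicSum.comp_equiv {ι κ : Type} [Fintype ι] [Fintype κ] {x : ι → Fˣ × F}
    (hx : IsHyperbolicSum x) (e : κ ≃ ι) : IsHyperbolicSum (x ∘ e) := by
  obtain ⟨N, hN, hN0⟩ := hx
  refine ⟨N.map (LinearEquiv.funCongrLeft F (F × F) e).toLinearMap, ?_, ?_⟩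
  · rwa [LinearEquiv.finrank_map_eq, Fintype.card_congr e]
  · rintro _ ⟨v, hv, rfl⟩
    rw [← hN0 v hv]
    exact Equiv.sum_comp e fun i =>
      ((x i).1 : F) * ((v i).1 ^ 2 + (v i).1 * (v i).2 + (x i).2 * (v i).2 ^ 2)

/-- A totally singular family of vectors parametrised injectively by `F ^ ι` makes the form
hyperbolic. -/
theorem IsHyperbolicSum.of_injective {ι : Type} [Fintype ι] {x : ι → Fˣ × F}
    (f : (ι → F) →ₗ[F] (ι → F × F)) (hf : Function.Injective f)
    (h : ∀ u, normSum x (f u) = 0) : IsHyperbolicSum x := by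
  refine ⟨LinearMap.range f, ?_, ?_⟩
  · rw [LinearMap.finrank_range_of_inj hf, Module.finrank_fintype_fun_eq_card]
  · rintro _ ⟨u, rfl⟩
    exact h u

theorem IsHyperbolicSum.const_of_card_eq_two [CharP F 2] {ι : Type} [Fintype ι]
    (h : Fintype.card ι = 2) (a : Fˣ × F) : IsHyperbolicSum fun _ : ι => a := by
  have : Nonempty ι := Fintype.card_pos_iff.mp (by omega)
  refine ⟨LinearMap.range (LinearMap.pi fun _ : ι => (LinearMap.id : F × F →ₗ[F] F × F)), ?_, ?_⟩
  · rw [LinearMap.finrank_range_of_inj, h]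
    · simp
    · intro u v huv
      exact congr_fun huv (Classical.arbitrary ι)
  · rintro _ ⟨u, rfl⟩
    simp [normSum, h, CharTwo.two_eq_zero]

theorem isHyperbolicSum_of_sum_single_eq_zero [CharP F 2] {ι : Type} [Fintype ι] (x : ι → Fˣ × F)
    (h : ∑ i, Finsupp.single (x i) (1 : ZMod 2) = 0) : IsHyperbolicSum x := by
  classical
  induction hn : Fintype.card ι using Nat.strong_induction_on generalizing ι with
  | _ n ih =>
    rcases isEmpty_or_nonempty ι with hι | ⟨⟨i⟩⟩
    · exact ⟨⊤, by simp, fun v _ => by simp [normSum]⟩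
    obtain ⟨j, hj, hji⟩ : ∃ j ≠ i, x j = x i := by
      by_contra! hne
      have h1 := DFunLike.congr_fun h (x i)
      rw [Finsupp.finsetSum_apply, Finset.sum_eq_single i] at h1
      · simp at h1
      · intro k _ hk
        exact Finsupp.single_eq_of_ne (hne k hk).symm
      · simp
    have hpair : (fun k : {k // k = i ∨ k = j} => x k) = fun _ => x i := by
      funext ⟨k, hk⟩
      rcases hk with rfl | rfl
      · rfl
      · exact hji
    have hcard : Fintype.card {k // k = i ∨ k = j} = 2 := by
      rw [Fintype.card_subtype, ← Finset.card_pair hj.symm]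
      congr 1
      ext k
      simp
    have hrest : IsHyperbolicSum fun k : {k // ¬ (k = i ∨ k = j)} => x k := by
      refine ih _ ?_ _ ?_ rfl
      · rw [← hn]
        exact Fintype.card_subtype_lt (x := i) (by simp)
      · rw [← Fintype.sum_subtype_add_sum_subtype (fun k => k = i ∨ k = j)] at h
        have h2 : ∑ k : {k // k = i ∨ k = j}, Finsupp.single (x k) (1 : ZMod 2) = 0 := by
          rw [Finset.sum_congr rfl fun k _ => by rw [congr_fun hpair k], Finset.sum_const,
            Finset.card_univ, hcard, two_nsmul, ZModModule.add_self]
        rwa [h2, zero_add] at h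
    have hsum := ((hpair ▸ IsHyperbolicSum.const_of_card_eq_two hcard (x i) :
      IsHyperbolicSum fun k : {k // k = i ∨ k = j} => x k).sumElim hrest).comp_equiv
        (Equiv.sumCompl fun k => k = i ∨ k = j).symm
    convert hsum using 1
    funext k
    obtain ⟨k, rfl⟩ := (Equiv.sumCompl fun k => k = i ∨ k = j).surjective k
    rcases k with k | k <;> simp

variable (F) in
/-- The formal sums of symbols `(d, c)` whose quadratic form is hyperbolic. -/
def hyperbolicRelations [CharP F 2] : Submodule (ZMod 2) (Fˣ × F →₀ ZMod 2) where
  carrier := {u | ∃ (ι : Type) (_ : Fintype ι) (x : ι → Fˣ × F), IsHyperbolicSum x ∧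
    ∑ i, Finsupp.single (x i) (1 : ZMod 2) = u}
  add_mem' := by
    rintro _ _ ⟨ι, _, x, hx, rfl⟩ ⟨κ, _, y, hy, rfl⟩
    exact ⟨ι ⊕ κ, inferInstance, Sum.elim x y, hx.sumElim hy, by simp⟩
  zero_mem' := ⟨Empty, inferInstance, Empty.elim,
    isHyperbolicSum_of_sum_single_eq_zero _ (by simp), by simp⟩
  smul_mem' := by
    intro c u hu
    obtain rfl | rfl : c = 0 ∨ c = 1 := by decide +revert
    · exact ⟨Empty, inferInstance, Empty.elim,
        isHyperbolicSum_of_sum_single_eq_zero _ (by simp), by simp⟩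
    · rwa [one_smul]

variable (F) in
/-- The Witt group of nonsingular quadratic forms in characteristic two. -/
abbrev QuadraticWitt [CharP F 2] : Type := (Fˣ × F →₀ ZMod 2) ⧸ hyperbolicRelations F

/-- The Witt class of the form `d (r² + r s + c s²)`. -/
noncomputable def wittBinary [CharP F 2] (d : Fˣ) (c : F) : QuadraticWitt F :=
  (hyperbolicRelations F).mkQ (Finsupp.single (d, c) 1)

theorem isHyperbolicSum_iff_sum_wittBinary [CharP F 2] {ι : Type} [Fintype ι]
    (x : ι → Fˣ × F) : IsHyperbolicSum x ↔ ∑ i, wittBinary (x i).1 (x i).2 = 0 := by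
  simp only [wittBinary, Prod.mk.eta]
  rw [← map_sum, Submodule.mkQ_apply, Submodule.Quotient.mk_eq_zero]
  constructor
  · exact fun hx => ⟨ι, inferInstance, x, hx, rfl⟩
  · rintro ⟨κ, _, y, hy, hxy⟩
    refine IsHyperbolicSum.of_sumElim (isHyperbolicSum_of_sum_single_eq_zero _ ?_) hy
    rw [Fintype.sum_sum_type]
    simp only [Sum.elim_inl, Sum.elim_inr]
    rw [hxy, ZModModule.add_self]

end QuadraticForms

section WittRelations

variable {F : Type} [Field F] [CharP F 2]

theorem wittBinary_add_param (d : Fˣ) (c c' : F) :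
    wittBinary d (c + c') = wittBinary d c + wittBinary d c' := by
  have h2 : (2 : F) = 0 := CharTwo.two_eq_zero
  have h : IsHyperbolicSum ![(d, c), (d, c'), (d, c + c')] := by
    refine IsHyperbolicSum.of_injective
      { toFun := fun u => ![(u 0, u 2), (u 1, u 2), (u 0 + u 1, u 2)]
        map_add' := fun u v => by
          ext i <;> fin_cases i <;> simp
          ring
        map_smul' := fun t u => by ext i <;> fin_cases i <;> simp [mul_add] } ?_ ?_
    · intro u v huv
      have h0 := congr_fun huv 0
      have h1 := congr_fun huv 1
      simp at h0 h1
      ext i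
      fin_cases i <;> simp [h0, h1]
    · intro u
      simp [normSum, Fin.sum_univ_three]
      linear_combination (d : F) * (u 0 ^ 2 + u 1 ^ 2 + u 0 * u 1 + u 0 * u 2 + u 1 * u 2 +
        c * u 2 ^ 2 + c' * u 2 ^ 2) * h2
  rw [isHyperbolicSum_iff_sum_wittBinary, Fin.sum_univ_three] at h
  simp only [Matrix.cons_val] at h
  rw [add_eq_zero_iff_eq_neg, ZModModule.neg_eq_self] at h
  exact h.symm

theorem wittBinary_sq_add_self (d : Fˣ) (g : F) : wittBinary d (g ^ 2 + g) = 0 := by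
  have h2 : (2 : F) = 0 := CharTwo.two_eq_zero
  have h : IsHyperbolicSum fun _ : Unit => (d, g ^ 2 + g) := by
    refine IsHyperbolicSum.of_injective
      { toFun := fun u _ => (g * u (), u ())
        map_add' := fun u v => by ext i <;> simp [mul_add]
        map_smul' := fun t u => by ext i <;> simp [mul_left_comm] } ?_ ?_
    · intro u v huv
      have h0 := congr_fun huv ()
      simp at h0
      ext
      exact h0.2
    · intro u
      simp [normSum]
      linear_combination (g ^ 2 * u () ^ 2 + g * u () ^ 2) * h2
  rw [isHyperbolicSum_iff_sum_wittBinary] at h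
  simpa using h

theorem wittBinary_mul_norm (d n : Fˣ) (c p s : F) (hn : (n : F) = p ^ 2 + p * s + c * s ^ 2) :
    wittBinary (d * n) c = wittBinary d c := by
  have h2 : (2 : F) = 0 := CharTwo.two_eq_zero
  have h4 : (4 : F) = 0 := by linear_combination 2 * h2
  have h : IsHyperbolicSum ![(d, c), (d * n, c)] := by
    refine IsHyperbolicSum.of_injective
      { toFun := fun u =>
          ![(p * u 0 + c * s * u 1, p * u 1 + s * u 0 + s * u 1), (u 0, u 1)]
        map_add' := fun u v => by
          ext i <;> fin_cases i <;> simp <;> ring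
        map_smul' := fun t u => by
          ext i <;> fin_cases i <;> simp <;> ring } ?_ ?_
    · intro u v huv
      have h1 := congr_fun huv 1
      simp at h1
      ext i
      fin_cases i <;> simp [h1]
    · intro u
      simp [normSum, Fin.sum_univ_two, hn]
      ring_nf
      simp [h2, h4]
  rw [isHyperbolicSum_iff_sum_wittBinary, Fin.sum_univ_two] at h
  simp only [Matrix.cons_val] at h
  rw [add_eq_zero_iff_eq_neg, ZModModule.neg_eq_self] at h
  exact h.symm

theorem wittBinary_add_wittBinary (x y z : Fˣ) (c : F) (hz : (z : F) = x + y) :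
    wittBinary x c + wittBinary y c = wittBinary z c + wittBinary (x * y * z) c := by
  have h2 : (2 : F) = 0 := CharTwo.two_eq_zero
  have h4 : (4 : F) = 0 := by linear_combination 2 * h2
  have h : IsHyperbolicSum ![(x, c), (y, c), (z, c), (x * y * z, c)] := by
    refine IsHyperbolicSum.of_injective
      { toFun := fun u =>
          ![(u 0 + y * u 2, u 1 + y * u 3), (u 0 + x * u 2, u 1 + x * u 3), (u 0, u 1),
            (u 2, u 3)]
        map_add' := fun u v => by
          ext i <;> fin_cases i <;> simp <;> ring
        map_smul' := fun t u => by
          ext i <;> fin_cases i <;> simp <;> ring } ?_ ?_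
    · intro u v huv
      have h1 := congr_fun huv 2
      have h3 := congr_fun huv 3
      simp at h1 h3
      ext i
      fin_cases i <;> simp [h1, h3]
    · intro u
      simp [normSum, Fin.sum_univ_four, hz]
      ring_nf
      simp [h2, h4]
  rw [isHyperbolicSum_iff_sum_wittBinary, Fin.sum_univ_four] at h
  simp only [Matrix.cons_val] at h
  rw [add_assoc, add_eq_zero_iff_eq_neg, ZModModule.neg_eq_self] at h
  exact h

theorem wittBinary_eq_zero_of_isotropic (d : Fˣ) (c : F) (v : F × F) (hv : v ≠ 0)
    (h : v.1 ^ 2 + v.1 * v.2 + c * v.2 ^ 2 = 0) : wittBinary d c = 0 := by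
  have h2 : (2 : F) = 0 := CharTwo.two_eq_zero
  have hs : v.2 ≠ 0 := by
    intro hs
    refine hv (Prod.ext ?_ hs)
    simpa [hs] using h
  have hc : c = (v.1 / v.2) ^ 2 + v.1 / v.2 := by
    field_simp
    linear_combination h - (v.1 ^ 2 + v.1 * v.2) * h2
  rw [hc, wittBinary_sq_add_self]

theorem wittBinary_add_wittBinary_mul_norm (d a A : Fˣ) (c : F) (v w : F × F)
    (hA : (A : F) = (v.1 ^ 2 + v.1 * v.2 + c * v.2 ^ 2) +
      a * (w.1 ^ 2 + w.1 * w.2 + c * w.2 ^ 2)) :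
    wittBinary d c + wittBinary (d * a) c =
      wittBinary (d * A) c + wittBinary (d * a * A) c := by
  by_cases hv : v.1 ^ 2 + v.1 * v.2 + c * v.2 ^ 2 = 0
  · rw [hv, zero_add] at hA
    have hw : w.1 ^ 2 + w.1 * w.2 + c * w.2 ^ 2 ≠ 0 := by
      intro hw
      simp [hw] at hA
    obtain rfl : A = a * Units.mk0 _ hw := Units.ext hA
    rw [← mul_assoc, wittBinary_mul_norm (d * a) _ c w.1 w.2 rfl, add_comm,
      ← wittBinary_mul_norm d (a * a * Units.mk0 _ hw) c (a * w.1) (a * w.2)]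
    · congr 2
      simp only [mul_assoc]
    · simp only [Units.val_mul, Units.val_mk0]
      ring
  by_cases hw : w.1 ^ 2 + w.1 * w.2 + c * w.2 ^ 2 = 0
  · rw [hw, mul_zero, add_zero] at hA
    rw [wittBinary_mul_norm d A c v.1 v.2 hA, wittBinary_mul_norm (d * a) A c v.1 v.2 hA]
  · rw [← wittBinary_mul_norm d (Units.mk0 _ hv) c v.1 v.2 rfl,
      ← wittBinary_mul_norm (d * a) (Units.mk0 _ hw) c w.1 w.2 rfl,
      wittBinary_add_wittBinary _ _ (d * A) c]
    · congr 1
      have : d * Units.mk0 _ hv * (d * a * Units.mk0 _ hw) * (d * A) =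
          d * a * A * (d * d) * Units.mk0 _ hv * Units.mk0 _ hw := by
        simp only [mul_assoc, mul_left_comm, mul_comm]
      rw [this, wittBinary_mul_norm _ (Units.mk0 _ hw) c w.1 w.2 rfl,
        wittBinary_mul_norm _ (Units.mk0 _ hv) c v.1 v.2 rfl,
        wittBinary_mul_norm _ (d * d) c d 0 (by simp [pow_two])]
    · simp only [Units.val_mul, hA, Units.val_mk0]
      ring

/-- An isotropic quadratic 3-fold Pfister form is hyperbolic. -/
theorem sum_wittBinary_eq_zero_of_pfister_isotropic (a b : Fˣ) (c : F)
    (h : ∃ v : Fin 4 → F × F, v ≠ 0 ∧ ∑ i, (![1, (a : F), b, a * b] i) *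
      ((v i).1 ^ 2 + (v i).1 * (v i).2 + c * (v i).2 ^ 2) = 0) :
    wittBinary 1 c + wittBinary a c + (wittBinary b c + wittBinary (b * a) c) = 0 := by
  have h2 : (2 : F) = 0 := CharTwo.two_eq_zero
  obtain ⟨v, hv, h⟩ := h
  by_cases hiso : ∃ w : F × F, w ≠ 0 ∧ w.1 ^ 2 + w.1 * w.2 + c * w.2 ^ 2 = 0
  · obtain ⟨w, hw, hw0⟩ := hiso
    simp [wittBinary_eq_zero_of_isotropic _ c w hw hw0]
  push Not at hiso
  have ha_norm (w w' : F × F) (hne : w ≠ 0 ∨ w' ≠ 0)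
      (hw : (w.1 ^ 2 + w.1 * w.2 + c * w.2 ^ 2) +
        a * (w'.1 ^ 2 + w'.1 * w'.2 + c * w'.2 ^ 2) = 0) (d : Fˣ) :
      wittBinary d c + wittBinary (d * a) c = 0 := by
    have hw' : w' ≠ 0 := by
      rintro rfl
      simp only [ne_eq, not_true_eq_false, or_false] at hne
      exact hiso w hne (by simpa using hw)
    have hn := hiso w' hw'
    have hw0 : w.1 ^ 2 + w.1 * w.2 + c * w.2 ^ 2 ≠ 0 := by
      intro h0
      simp [h0, hn] at hw
    have : Units.mk0 _ hw0 = a * Units.mk0 _ hn := Units.ext (by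
      simp only [Units.val_mul, Units.val_mk0]
      linear_combination hw - (a : F) * (w'.1 ^ 2 + w'.1 * w'.2 + c * w'.2 ^ 2) * h2)
    rw [← wittBinary_mul_norm d _ c w.1 w.2 (Units.val_mk0 hw0), this, ← mul_assoc,
      wittBinary_mul_norm (d * a) _ c w'.1 w'.2 (Units.val_mk0 hn), ZModModule.add_self]
  rw [Fin.sum_univ_four] at h
  simp only [Matrix.cons_val] at h
  by_cases hA : ((v 0).1 ^ 2 + (v 0).1 * (v 0).2 + c * (v 0).2 ^ 2) +
      a * ((v 1).1 ^ 2 + (v 1).1 * (v 1).2 + c * (v 1).2 ^ 2) = 0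
  · have hC : ((v 2).1 ^ 2 + (v 2).1 * (v 2).2 + c * (v 2).2 ^ 2) +
        a * ((v 3).1 ^ 2 + (v 3).1 * (v 3).2 + c * (v 3).2 ^ 2) = 0 := by
      refine (mul_eq_zero.mp (?_ : (b : F) * _ = 0)).resolve_left b.ne_zero
      linear_combination h - hA
    have hd (d : Fˣ) : wittBinary d c + wittBinary (d * a) c = 0 := by
      by_cases h01 : v 0 ≠ 0 ∨ v 1 ≠ 0
      · exact ha_norm _ _ h01 hA d
      · refine ha_norm _ _ ?_ hC d
        by_contra h23
        push Not at h01 h23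
        refine hv (funext fun i => ?_)
        fin_cases i
        exacts [h01.1, h01.2, h23.1, h23.2]
    simpa using congr_arg₂ (· + ·) (hd 1) (hd b)
  · have hAC : Units.mk0 _ hA = b * (Units.mk0 _ hA * b⁻¹) := by
      rw [mul_left_comm, mul_inv_cancel, mul_one]
    have h1 := wittBinary_add_wittBinary_mul_norm 1 a (Units.mk0 _ hA) c (v 0) (v 1) rfl
    have h3 := wittBinary_add_wittBinary_mul_norm b a (Units.mk0 _ hA * b⁻¹) c (v 2) (v 3) (by
      simp only [Units.val_mul, Units.val_mk0, Units.val_inv_eq_inv_val]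
      field_simp
      linear_combination h - (b * (((v 2).1 ^ 2 + (v 2).1 * (v 2).2 + c * (v 2).2 ^ 2) +
        a * ((v 3).1 ^ 2 + (v 3).1 * (v 3).2 + c * (v 3).2 ^ 2))) * h2)
    rw [one_mul, one_mul] at h1
    rw [h1, h3, mul_right_comm b a, ← hAC, mul_comm a, ZModModule.add_self]

/-- The Witt class of the quadratic 2-fold Pfister form attached to `b` and `c`. -/
noncomputable def wittPfister (b : Fˣ) (c : F) : QuadraticWitt F :=
  wittBinary 1 c + wittBinary b c

theorem wittPfister_add_param (b : Fˣ) (c c' : F) :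
    wittPfister b (c + c') = wittPfister b c + wittPfister b c' := by
  simp only [wittPfister, wittBinary_add_param]
  abel

theorem wittPfister_sq_add_self (b : Fˣ) (g : F) : wittPfister b (g ^ 2 + g) = 0 := by
  simp [wittPfister, wittBinary_sq_add_self]

theorem wittPfister_sq_mul_self (b : Fˣ) (f : F) : wittPfister b (f ^ 2 * b) = 0 := by
  by_cases hf : f = 0
  · simpa [hf] using wittPfister_sq_add_self b 0
  · rw [wittPfister, ← one_mul b, wittBinary_mul_norm 1 b _ 0 f⁻¹ (by simp; field_simp), one_mul,
      ZModModule.add_self]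

end WittRelations

section PfisterSums

variable {F : Type} [Field F] [CharP F 2]

theorem wittPfister_mul
    (hI3 : ∀ a b c : F, a ≠ 0 → b ≠ 0 → ∃ v : Fin 4 → F × F, v ≠ 0 ∧
      ∑ i, (![1, a, b, a * b] i) * ((v i).1 ^ 2 + (v i).1 * (v i).2 + c * (v i).2 ^ 2) = 0)
    (x y : Fˣ) (c : F) : wittPfister (x * y) c = wittPfister x c + wittPfister y c := by
  have h := sum_wittBinary_eq_zero_of_pfister_isotropic y x c (hI3 _ _ _ y.ne_zero x.ne_zero)
  rw [← ZModModule.neg_eq_self (wittPfister (x * y) c), eq_comm, ← add_eq_zero_iff_eq_neg,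
    ← h, ← add_zero (wittBinary 1 c + _ + _), ← ZModModule.add_self (wittBinary 1 c)]
  simp only [wittPfister]
  abel

theorem wittPfister_prod
    (hI3 : ∀ a b c : F, a ≠ 0 → b ≠ 0 → ∃ v : Fin 4 → F × F, v ≠ 0 ∧
      ∑ i, (![1, a, b, a * b] i) * ((v i).1 ^ 2 + (v i).1 * (v i).2 + c * (v i).2 ^ 2) = 0)
    {ι : Type} (S : Finset ι) (β : ι → Fˣ) (c : F) :
    wittPfister (∏ i ∈ S, β i) c = ∑ i ∈ S, wittPfister (β i) c := by
  classical
  induction S using Finset.induction_on with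
  | empty => simp [wittPfister, ZModModule.add_self]
  | insert i S hi ih => rw [Finset.prod_insert hi, Finset.sum_insert hi, wittPfister_mul hI3, ih]

theorem wittPfister_sum_param {ι : Type} (S : Finset ι) (b : Fˣ) (c : ι → F) :
    wittPfister b (∑ i ∈ S, c i) = ∑ i ∈ S, wittPfister b (c i) := by
  classical
  induction S using Finset.induction_on with
  | empty => simpa using wittPfister_sq_add_self b 0
  | insert i S hi ih => rw [Finset.sum_insert hi, Finset.sum_insert hi, wittPfister_add_param, ih]

theorem wittBinary_sum_param {ι : Type} (S : Finset ι) (b : Fˣ) (c : ι → F) :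
    wittBinary b (∑ i ∈ S, c i) = ∑ i ∈ S, wittBinary b (c i) := by
  classical
  induction S using Finset.induction_on with
  | empty => simpa using wittBinary_sq_add_self b 0
  | insert i S hi ih => rw [Finset.sum_insert hi, Finset.sum_insert hi, wittBinary_add_param, ih]

theorem sum_wittPfister_eq_zero
    (hI3 : ∀ a b c : F, a ≠ 0 → b ≠ 0 → ∃ v : Fin 4 → F × F, v ≠ 0 ∧
      ∑ i, (![1, a, b, a * b] i) * ((v i).1 ^ 2 + (v i).1 * (v i).2 + c * (v i).2 ^ 2) = 0)
    {ι : Type} [Fintype ι] [DecidableEq ι] (α : ι → F) (β : ι → Fˣ)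
    (g : ι → F) (f : Finset ι → F)
    (h : ∀ i, α i = g i ^ 2 + g i + ∑ S with i ∈ S, f S ^ 2 * ∏ j ∈ S, (β j : F)) :
    ∑ i, wittPfister (β i) (α i) = 0 := by
  calc ∑ i, wittPfister (β i) (α i)
      = ∑ i, ∑ S with i ∈ S, wittPfister (β i) (f S ^ 2 * ∏ j ∈ S, (β j : F)) := by
        refine Finset.sum_congr rfl fun i _ => ?_
        rw [h, wittPfister_add_param, wittPfister_sq_add_self, zero_add, wittPfister_sum_param]
    _ = ∑ S, ∑ i ∈ S, wittPfister (β i) (f S ^ 2 * ∏ j ∈ S, (β j : F)) :=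
        Finset.sum_comm' (by simp)
    _ = ∑ S : Finset ι, 0 := by
        refine Finset.sum_congr rfl fun S _ => ?_
        rw [← wittPfister_prod hI3, ← Units.coe_prod, wittPfister_sq_mul_self]
    _ = 0 := Finset.sum_const_zero

/-- An anisotropic form of trivial Arf invariant whose Witt class is a sum of `k` quadratic
2-fold Pfister forms has dimension at most `2 k + 2`. -/
theorem le_of_sum_wittPfister_eq_zero
    (hI3 : ∀ a b c : F, a ≠ 0 → b ≠ 0 → ∃ v : Fin 4 → F × F, v ≠ 0 ∧
      ∑ i, (![1, a, b, a * b] i) * ((v i).1 ^ 2 + (v i).1 * (v i).2 + c * (v i).2 ^ 2) = 0)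
    {m : ℕ} (a : Fin (m + 2) → F) (b : Fin (m + 2) → Fˣ)
    (haniso : AnisoBin F a fun i => (b i : F))
    (harf : ∃ l : F, ∑ i, a i * b i = l ^ 2 + l) {k : ℕ} (c : Fin k → F) (e : Fin k → Fˣ)
    (h : ∑ i : Fin (m + 1), wittPfister (b (Fin.last (m + 1)) * b i.castSucc)
        (a i.castSucc * b i.castSucc) + ∑ j, wittPfister (e j) (c j) = 0) :
    m + 1 ≤ k := by
  have h2 : (2 : F) = 0 := CharTwo.two_eq_zero
  obtain ⟨l, hl⟩ := harf
  set x : Fin (m + 2) → Fˣ × F := fun i => (b i, a i * b i) with hx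
  set y : Option (Fin k) → Fˣ × F := fun j => j.elim (1, ∑ j, c j) fun j => (e j, c j) with hy
  have hhyp : IsHyperbolicSum (Sum.elim x y) := by
    rw [isHyperbolicSum_iff_sum_wittBinary, Fintype.sum_sum_type, Fintype.sum_option, ← h]
    simp only [Sum.elim_inl, Sum.elim_inr, hx, hy, Option.elim]
    congr 1
    · have hlast : a (Fin.last (m + 1)) * b (Fin.last (m + 1)) =
          (l ^ 2 + l) + ∑ i : Fin (m + 1), a i.castSucc * b i.castSucc := by
        rw [Fin.sum_univ_castSucc] at hl
        linear_combination hl - (∑ i : Fin (m + 1), a i.castSucc * b i.castSucc) * h2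
      rw [Fin.sum_univ_castSucc, hlast, wittBinary_add_param, wittBinary_sq_add_self, zero_add,
        wittBinary_sum_param, ← Finset.sum_add_distrib]
      refine Finset.sum_congr rfl fun i _ => ?_
      rw [wittPfister_mul hI3, wittPfister, wittPfister, add_add_add_comm, ZModModule.add_self,
        zero_add, add_comm]
    · rw [wittBinary_sum_param, ← Finset.sum_add_distrib]
      rfl
  obtain ⟨N, hN, hN0⟩ := hhyp
  by_contra! hk
  set p : N →ₗ[F] (Option (Fin k) → F × F) :=
    LinearMap.funLeft F (F × F) Sum.inr ∘ₗ N.subtype with hp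
  have hker : LinearMap.ker p ≠ ⊥ := by
    refine LinearMap.ker_ne_bot_of_finrank_lt ?_
    simp only [Module.finrank_pi_fintype, Module.finrank_prod, Module.finrank_self,
      Finset.sum_const, Finset.card_univ, Fintype.card_option, Fintype.card_fin, smul_eq_mul]
    simp only [Fintype.card_sum, Fintype.card_option, Fintype.card_fin] at hN
    omega
  obtain ⟨⟨v, hvN⟩, hv, hv0⟩ := (Submodule.ne_bot_iff _).mp hker
  have hvr : ∀ j, v (Sum.inr j) = 0 := fun j => congr_fun hv j
  have hq := hN0 v hvN
  rw [normSum, Fintype.sum_sum_type] at hq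
  simp only [hvr, Sum.elim_inl, Sum.elim_inr] at hq
  have hzero := haniso (fun i => ((b i : F) * (v (Sum.inl i)).2,
    (v (Sum.inl i)).1)) (by
      rw [binSum, ← hq]
      simp only [hx, Prod.fst_zero, Prod.snd_zero, mul_zero, add_zero, ne_eq, OfNat.ofNat_ne_zero,
        not_false_eq_true, zero_pow, Finset.sum_const_zero]
      refine Finset.sum_congr rfl fun i _ => ?_
      ring)
  refine hv0 (Subtype.ext (funext fun i => ?_))
  rcases i with i | j
  · have := congr_fun hzero i
    simp [Prod.ext_iff] at this
    exact Prod.ext this.2 this.1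
  · exact hvr j

end PfisterSums

section DifferentialModules

open scoped IsMulCommutative

/-- A nonzero subspace of `Finset ι → F` stable under all restrictions to the sets containing a
given element contains a coordinate vector. -/
theorem exists_single_mem_of_stable {F ι : Type*} [Field F] [Fintype ι] [DecidableEq ι]
    (W : Submodule F (Finset ι → F))
    (hW : ∀ i, ∀ w ∈ W, (fun T => if i ∈ T then w T else 0) ∈ W) (h : W ≠ ⊥) :
    ∃ S, Pi.single S 1 ∈ W := by
  obtain ⟨w, hw, hw0⟩ := (Submodule.ne_bot_iff _).mp h
  obtain ⟨S, hS⟩ := Function.ne_iff.mp hw0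
  have key : ∀ s : Finset ι, (fun T => if ∀ i ∈ s, (i ∈ T ↔ i ∈ S) then w T else 0) ∈ W := by
    intro s
    induction s using Finset.induction_on with
    | empty => simpa using hw
    | insert i s hi ih =>
      by_cases hiS : i ∈ S
      · convert hW i _ ih using 1
        funext T
        by_cases hiT : i ∈ T <;> simp [hiS, hiT]
      · convert W.sub_mem ih (hW i _ ih) using 1
        funext T
        by_cases hiT : i ∈ T <;> simp [hiS, hiT]
  refine ⟨S, ?_⟩
  convert W.smul_mem (w S)⁻¹ (key Finset.univ) using 1
  funext T
  have hiff : (∀ i, i ∈ T ↔ i ∈ S) ↔ T = S := Finset.ext_iff.symm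
  by_cases hT : T = S
  · subst hT
    simp only [Pi.single_eq_same, Pi.smul_apply, smul_eq_mul]
    rw [if_pos (by simp), inv_mul_cancel₀ hS]
  · simp [hiff, hT]

variable {F L V ι : Type*} [Field F] [CommRing L] [AddCommGroup V] [Module F V] [Module L V]

theorem derivation_prod_smul [DecidableEq ι] (y : ι → L) (X : ι → Module.End F V)
    (hX : ∀ i j v, X i (y j • v) = y j • X i v + if i = j then y j • v else 0)
    (i : ι) (S : Finset ι) (v : V) :
    X i ((∏ j ∈ S, y j) • v) =
      (∏ j ∈ S, y j) • X i v + if i ∈ S then (∏ j ∈ S, y j) • v else 0 := by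
  induction S using Finset.induction_on generalizing v with
  | empty => simp
  | insert k S hk ih =>
    rw [Finset.prod_insert hk, mul_smul, hX, ih, smul_add, add_assoc, mul_smul]
    congr 1
    by_cases hik : i = k
    · subst hik
      simp [hk]
    · simp [hik]

variable [Algebra F L]

theorem isUnit_prod_of_sq_eq {y : ι → L} {β : ι → F} (hβ : ∀ i, β i ≠ 0)
    (hy : ∀ i, y i ^ 2 = algebraMap F L (β i)) (S : Finset ι) : IsUnit (∏ j ∈ S, y j) := by
  refine IsUnit.prod_iff.mpr fun j _ => ?_
  have h := (IsUnit.mk0 _ (hβ j)).map (algebraMap F L)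
  rw [← hy j] at h
  exact (isUnit_pow_iff two_ne_zero).mp h

theorem sq_eq_algebraMap_sum [Fintype ι] [CharP F 2] [Nontrivial L] {y : ι → L} {β : ι → F}
    (hy : ∀ i, y i ^ 2 = algebraMap F L (β i)) (b : Module.Basis (Finset ι) F L)
    (hb : ∀ S, b S = ∏ j ∈ S, y j) (z : L) :
    z ^ 2 = algebraMap F L (∑ S, b.repr z S ^ 2 * ∏ j ∈ S, β j) := by
  have : CharP L 2 := charP_of_injective_algebraMap (algebraMap F L).injective 2
  conv_lhs => rw [← b.sum_repr z]
  rw [sum_pow_char, map_sum]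
  refine Finset.sum_congr rfl fun S _ => ?_
  rw [hb, smul_pow, ← Finset.prod_pow, Algebra.smul_def, map_mul, map_prod]
  simp only [hy]

theorem isLocalRing_of_sq_eq_algebraMap [CharP F 2] [Nontrivial L]
    (h : ∀ z : L, ∃ t : F, z ^ 2 = algebraMap F L t) : IsLocalRing L := by
  have : CharP L 2 := charP_of_injective_algebraMap (algebraMap F L).injective 2
  have key : ∀ z : L, ¬ IsUnit z → z ^ 2 = 0 := by
    intro z hz
    obtain ⟨t, ht⟩ := h z
    by_cases h0 : t = 0
    · rw [ht, h0, map_zero]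
    · refine absurd ((isUnit_pow_iff two_ne_zero).mp ?_) hz
      rw [ht]
      exact (IsUnit.mk0 t h0).map _
  refine IsLocalRing.of_nonunits_add fun p q hp hq hpq => ?_
  have hs : (p + q) ^ 2 = 0 := by rw [add_pow_char, key p hp, key q hq, add_zero]
  exact not_isUnit_zero (hs ▸ hpq.pow 2)

variable [DecidableEq ι]

/-- The coordinatewise derivation attached to the basis of square-free monomials. -/
noncomputable def monomialDerivation (b : Module.Basis (Finset ι) F L) (i : ι) : L →ₗ[F] L :=
  b.constr F fun S => if i ∈ S then b S else 0

theorem monomialDerivation_basis (b : Module.Basis (Finset ι) F L) (i : ι) (S : Finset ι) :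
    monomialDerivation b i (b S) = if i ∈ S then b S else 0 := by
  rw [monomialDerivation, b.constr_basis]

variable [Fintype ι] [IsScalarTower F L V]

theorem linearIndependent_prod_of_derivation [Nontrivial V] {y : ι → L} {β : ι → F}
    (hβ : ∀ i, β i ≠ 0) (hy : ∀ i, y i ^ 2 = algebraMap F L (β i)) (X : ι → Module.End F V)
    (hX : ∀ i j v, X i (y j • v) = y j • X i v + if i = j then y j • v else 0) :
    LinearIndependent F fun S : Finset ι => ∏ j ∈ S, y j := by
  set Φ := Fintype.linearCombination F fun S : Finset ι => ∏ j ∈ S, y j with hΦ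
  let W : Submodule F (Finset ι → F) :=
    { carrier := {c | ∀ v : V, Φ c • v = 0}
      add_mem' := fun {a b} ha hb v => by rw [map_add, add_smul, ha v, hb v, add_zero]
      zero_mem' := fun v => by rw [map_zero, zero_smul]
      smul_mem' := fun t c hc v => by rw [map_smul, smul_assoc, hc v, smul_zero] }
  have hΦX (i : ι) (c : Finset ι → F) (v : V) :
      X i (Φ c • v) = Φ c • X i v + Φ (fun T => if i ∈ T then c T else 0) • v := by
    simp only [hΦ, Fintype.linearCombination_apply, Finset.sum_smul, map_sum,
      ← Finset.sum_add_distrib]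
    refine Finset.sum_congr rfl fun S _ => ?_
    rw [smul_assoc, map_smul, derivation_prod_smul y X hX, smul_add, smul_assoc]
    congr 1
    split_ifs <;> simp
  have hbot : W = ⊥ := by
    by_contra hne
    obtain ⟨S, hS⟩ := exists_single_mem_of_stable W (fun i c hc v => by
      have := hΦX i c v
      rwa [hc v, map_zero, hc, zero_add, eq_comm] at this) hne
    obtain ⟨v, hv⟩ := exists_ne (0 : V)
    have h := hS v
    rw [hΦ, Fintype.linearCombination_apply_single, one_smul] at h
    exact hv ((isUnit_prod_of_sq_eq hβ hy S).smul_eq_zero.mp h)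
  refine Fintype.linearIndependent_iff.mpr fun c hc => congrFun ?_
  have : c ∈ W := fun v => by rw [hΦ, Fintype.linearCombination_apply, hc, zero_smul]
  rwa [hbot, Submodule.mem_bot] at this

theorem monomialDerivation_repr (b : Module.Basis (Finset ι) F L) (i : ι) (z : L)
    (S : Finset ι) :
    b.repr (monomialDerivation b i z) S = if i ∈ S then b.repr z S else 0 := by
  conv_lhs => rw [← b.sum_repr z]
  simp only [map_sum, map_smul, monomialDerivation_basis, Finsupp.coe_finsetSum,
    Finset.sum_apply, Finsupp.smul_apply, smul_eq_mul]
  rw [Finset.sum_eq_single S]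
  · split_ifs <;> simp
  · intro T _ hT
    split_ifs <;> simp [hT]
  · simp

theorem map_smul_monomialDerivation {y : ι → L} (X : ι → Module.End F V)
    (hX : ∀ i j v, X i (y j • v) = y j • X i v + if i = j then y j • v else 0)
    (b : Module.Basis (Finset ι) F L) (hb : ∀ S, b S = ∏ j ∈ S, y j) (i : ι) (z : L) (v : V) :
    X i (z • v) = z • X i v + monomialDerivation b i z • v := by
  rw [← b.sum_repr z]
  simp only [map_sum, map_smul, monomialDerivation_basis, Finset.sum_smul,
    ← Finset.sum_add_distrib, smul_assoc]
  refine Finset.sum_congr rfl fun S _ => ?_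
  rw [hb, derivation_prod_smul y X hX, smul_add]
  congr 2
  split_ifs <;> simp

/-- A finite module over the algebra spanned by the monomials that carries compatible derivations
is free. -/
theorem exists_basis_of_derivation [IsLocalRing L] [Module.Finite L V] {y : ι → L} {β : ι → F}
    (hβ : ∀ i, β i ≠ 0) (hy : ∀ i, y i ^ 2 = algebraMap F L (β i)) (X : ι → Module.End F V)
    (hX : ∀ i j v, X i (y j • v) = y j • X i v + if i = j then y j • v else 0)
    (b : Module.Basis (Finset ι) F L) (hb : ∀ S, b S = ∏ j ∈ S, y j) :
    ∃ t, Nonempty (Module.Basis (Fin t) L V) := by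
  classical
  have hex : ∃ t, ∃ s : Fin t → V, Submodule.span L (Set.range s) = ⊤ :=
    Module.Finite.exists_fin
  obtain ⟨s, hs⟩ := Nat.find_spec hex
  have hmin := fun t => Nat.find_min hex (m := t)
  generalize Nat.find hex = t at s hs hmin
  refine ⟨t, ⟨Module.Basis.mk ?_ hs.ge⟩⟩
  by_contra hdep
  let R : Submodule L (Fin t → L) := LinearMap.ker (Fintype.linearCombination L s)
  have hR (l : Fin t → L) : l ∈ R ↔ ∑ j, l j • s j = 0 := by
    rw [LinearMap.mem_ker, Fintype.linearCombination_apply]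
  let I : Ideal L := ⨆ k, R.map (LinearMap.proj k)
  have hmemI (l : Fin t → L) (hl : l ∈ R) (k : Fin t) : l k ∈ I :=
    Submodule.mem_iSup_of_mem k ⟨l, hl, rfl⟩
  have hstable (i : ι) (z : L) (hz : z ∈ I) : monomialDerivation b i z ∈ I := by
    have hc (j : Fin t) : ∃ c : Fin t → L, ∑ k, c k • s k = X i (s j) :=
      (Submodule.mem_span_range_iff_exists_fun L).mp (hs ▸ Submodule.mem_top)
    choose c hc using hc
    refine Submodule.iSup_induction _ (motive := fun z => monomialDerivation b i z ∈ I) hz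
      ?_ (by rw [map_zero]; exact I.zero_mem)
      (fun p q hp hq => by rw [map_add]; exact I.add_mem hp hq)
    rintro k _ ⟨l, hl, rfl⟩
    have hl' : (fun k => ∑ j, l j * c j k + monomialDerivation b i (l k)) ∈ R := by
      rw [hR]
      have h := congrArg (X i) ((hR l).mp hl)
      simp only [map_sum, map_zero, map_smul_monomialDerivation X hX b hb, ← hc,
        Finset.smul_sum, Finset.sum_add_distrib, smul_smul] at h
      rw [Finset.sum_comm] at h
      simpa only [add_smul, Finset.sum_smul, Finset.sum_add_distrib] using h
    have h1 := hmemI _ hl' k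
    have h2 : ∑ j, l j * c j k ∈ I :=
      I.sum_mem fun j _ => I.mul_mem_right _ (hmemI l hl j)
    exact (I.add_mem_iff_right h2).mp h1
  have hI : I ≠ ⊥ := by
    intro h0
    refine hdep (Fintype.linearIndependent_iff.mpr fun l hl k => ?_)
    have := hmemI l ((hR l).mpr hl) k
    rwa [h0, Submodule.mem_bot] at this
  obtain ⟨S, hS⟩ := exists_single_mem_of_stable
    ((I.restrictScalars F).map (b.equivFun : L →ₗ[F] Finset ι → F))
    (by
      rintro i _ ⟨z, hz, rfl⟩
      refine ⟨monomialDerivation b i z, hstable i z hz, funext fun S => ?_⟩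
      simp [monomialDerivation_repr])
    (by
      rw [Ne, Submodule.map_eq_bot_iff]
      exact fun h => hI ((Submodule.restrictScalars_eq_bot_iff F L L).mp h))
  obtain ⟨z, hz, hzS⟩ := hS
  have hzb : z = b S := b.equivFun.injective (by
    funext T
    rw [← LinearEquiv.coe_coe, hzS]
    simp [Pi.single_apply, eq_comm])
  have htop : I = ⊤ := Ideal.eq_top_of_isUnit_mem I hz (by
    rw [hzb, hb]; exact isUnit_prod_of_sq_eq hβ hy S)
  obtain ⟨k, hk⟩ : ∃ k, ¬ R.map (LinearMap.proj k) ≤ IsLocalRing.maximalIdeal L := by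
    by_contra! hall
    exact (IsLocalRing.maximalIdeal.isMaximal L).ne_top (top_le_iff.mp (htop ▸ iSup_le hall))
  obtain ⟨_, ⟨l, hl, rfl⟩, hlu⟩ := SetLike.not_le_iff_exists.mp hk
  have hu : IsUnit (l k) := by simpa using hlu
  obtain _ | t := t
  · exact k.elim0
  refine hmin t t.lt_succ_self ⟨s ∘ k.succAbove, top_le_iff.mp (hs ▸ ?_)⟩
  rw [Submodule.span_le]
  rintro _ ⟨j, rfl⟩
  obtain rfl | ⟨j, rfl⟩ := k.eq_self_or_eq_succAbove j
  · have h := (hR l).mp hl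
    rw [Fin.sum_univ_succAbove _ j, add_eq_zero_iff_eq_neg] at h
    rw [SetLike.mem_coe, ← Submodule.smul_mem_iff_of_isUnit _ hu, h]
    exact Submodule.neg_mem _ (Submodule.sum_mem _ fun i _ =>
      Submodule.smul_mem _ _ (Submodule.subset_span ⟨i, rfl⟩))
  · exact Submodule.subset_span ⟨j, rfl⟩

/-- Comparing coordinates in the integrability equations for the derivations of a cyclic
module. -/
theorem exists_coordinates_of_cyclic [CharP F 2] [Nontrivial L] {y : ι → L} {α β : ι → F}
    (hy : ∀ i, y i ^ 2 = algebraMap F L (β i)) (X : ι → Module.End F V)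
    (hX : ∀ i j v, X i (y j • v) = y j • X i v + if i = j then y j • v else 0)
    (hXX : ∀ i v, X i (X i v) = X i v + α i • v) (hcomm : ∀ i j, Commute (X i) (X j))
    (b : Module.Basis (Finset ι) F L) (hb : ∀ S, b S = ∏ j ∈ S, y j)
    (s : V) (hs : ∀ v, ∃ l : L, l • s = v) (hs0 : ∀ l : L, l • s = 0 → l = 0) :
    ∃ (g : ι → F) (f : Finset ι → F),
      ∀ i, α i = g i ^ 2 + g i + ∑ S with i ∈ S, f S ^ 2 * ∏ j ∈ S, β j := by
  classical
  choose l hl using fun i => hs (X i s)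
  have hinj (p q : L) (h : p • s = q • s) : p = q :=
    sub_eq_zero.mp (hs0 _ (by rw [sub_smul, h, sub_self]))
  have hb0 : b ∅ = 1 := by simp [hb]
  have hsq (i : ι) : l i ^ 2 + monomialDerivation b i (l i) = l i + α i • 1 := by
    apply hinj
    have h := hXX i s
    rw [← hl, map_smul_monomialDerivation X hX b hb, ← hl, smul_smul, ← sq, ← add_smul] at h
    rw [h, add_smul, smul_assoc, one_smul]
  have hintegrable (i j : ι) : monomialDerivation b j (l i) = monomialDerivation b i (l j) := by
    apply hinj
    have h : X j (X i s) = X i (X j s) := LinearMap.congr_fun (hcomm j i) s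
    rw [← hl i, ← hl j, map_smul_monomialDerivation X hX b hb,
      map_smul_monomialDerivation X hX b hb, ← hl i, ← hl j, smul_smul, smul_smul,
      mul_comm, add_right_inj] at h
    exact h
  have hcoord (i : ι) (S : Finset ι) :
      (if S = ∅ then ∑ T, b.repr (l i) T ^ 2 * ∏ j ∈ T, β j else 0) +
        (if i ∈ S then b.repr (l i) S else 0) =
      b.repr (l i) S + if S = ∅ then α i else 0 := by
    have h := congrArg (fun z => b.repr z S) (hsq i)
    simp only [sq_eq_algebraMap_sum hy b hb, Algebra.algebraMap_eq_smul_one, map_add, map_smul,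
      ← hb0, Finsupp.add_apply, Finsupp.smul_apply, b.repr_self, Finsupp.single_apply,
      monomialDerivation_repr, smul_eq_mul, mul_ite, mul_one, mul_zero] at h
    simpa only [eq_comm] using h
  have hsymm (i j : ι) (S : Finset ι) (hi : i ∈ S) (hj : j ∈ S) :
      b.repr (l i) S = b.repr (l j) S := by
    have h := congrArg (fun z => b.repr z S) (hintegrable i j)
    simpa only [monomialDerivation_repr, if_pos hi, if_pos hj] using h
  have hzero (i : ι) (S : Finset ι) (hi : i ∉ S) (hS : S ≠ ∅) : b.repr (l i) S = 0 := by
    have h := hcoord i S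
    simpa [hi, hS, eq_comm] using h
  refine ⟨fun i => b.repr (l i) ∅,
    fun S => if h : S.Nonempty then b.repr (l h.choose) S else 0, fun i => ?_⟩
  have h := hcoord i ∅
  simp only [if_true, Finset.notMem_empty, if_false, add_zero] at h
  rw [← sub_eq_iff_eq_add'.mpr h, CharTwo.sub_eq_add]
  have hsplit : ∑ T, b.repr (l i) T ^ 2 * ∏ j ∈ T, β j = b.repr (l i) ∅ ^ 2 +
      ∑ S with i ∈ S, b.repr (l i) S ^ 2 * ∏ j ∈ S, β j := by
    rw [Finset.sum_filter, ← Finset.add_sum_erase _ _ (Finset.mem_univ ∅),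
      ← Finset.add_sum_erase _ (fun S => if i ∈ S then _ else _) (Finset.mem_univ ∅)]
    simp only [Finset.prod_empty, mul_one, Finset.notMem_empty, if_false, zero_add]
    congr 1
    refine Finset.sum_congr rfl fun S hS => ?_
    split_ifs with hi
    · rfl
    · rw [hzero i S hi (Finset.ne_of_mem_erase hS)]; simp
  rw [hsplit, add_right_comm]
  congr 1
  refine Finset.sum_congr rfl fun S hS => ?_
  have hi := (Finset.mem_filter.mp hS).2
  have hne : S.Nonempty := ⟨i, hi⟩
  dsimp only
  rw [dif_pos hne, hsymm i _ S hi hne.choose_spec]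

/-- A module of dimension `2 ^ r` over a product of `r` symbol algebras yields a presentation of
the parameters of the symbols. -/
theorem exists_coordinates_of_symbol_action [CharP F 2] {α β : ι → F} (hβ : ∀ i, β i ≠ 0)
    (X Y : ι → Module.End F V) (hXX : ∀ i, X i ^ 2 = X i + algebraMap F _ (α i))
    (hYY : ∀ i, Y i ^ 2 = algebraMap F _ (β i)) (hYX : ∀ i, Y i * X i = X i * Y i + Y i)
    (hX : ∀ i j, Commute (X i) (X j)) (hY : ∀ i j, Commute (Y i) (Y j))
    (hXY : ∀ i j, i ≠ j → Commute (X i) (Y j))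
    (hdim : Module.finrank F V = 2 ^ Fintype.card ι) :
    ∃ (g : ι → F) (f : Finset ι → F),
      ∀ i, α i = g i ^ 2 + g i + ∑ S with i ∈ S, f S ^ 2 * ∏ j ∈ S, β j := by
  have : Nontrivial V := Module.nontrivial_of_finrank_pos (R := F) (hdim ▸ by positivity)
  have : Module.Finite F V := Module.finite_of_finrank_pos (hdim ▸ by positivity)
  let K := Algebra.adjoin F (Set.range Y)
  have : IsMulCommutative K := Algebra.isMulCommutative_adjoin F (by
    rintro _ ⟨i, rfl⟩ _ ⟨j, rfl⟩
    exact hY i j)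
  have : Module.Finite K V := Module.Finite.of_restrictScalars_finite F K V
  let y : ι → K := fun i => ⟨Y i, Algebra.subset_adjoin ⟨i, rfl⟩⟩
  have hy (i : ι) : y i ^ 2 = algebraMap F K (β i) := Subtype.ext (hYY i)
  have hXy (i j : ι) (v : V) :
      X i (y j • v) = y j • X i v + if i = j then y j • v else 0 := by
    change X i (Y j v) = Y j (X i v) + if i = j then Y j v else 0
    split_ifs with hij
    · subst hij
      have h : Y i (X i v) = X i (Y i v) + Y i v := LinearMap.congr_fun (hYX i) v
      rw [h, add_assoc, ← two_smul F, CharTwo.two_eq_zero, zero_smul, add_zero]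
    · rw [add_zero]
      exact LinearMap.congr_fun (hXY i j hij) v
  have hli := linearIndependent_prod_of_derivation hβ hy X hXy
  have hspan : ⊤ ≤ Submodule.span F (Set.range fun S : Finset ι => ∏ j ∈ S, y j) := by
    set W := Submodule.span F (Set.range fun S : Finset ι => ∏ j ∈ S, y j) with hW
    have hmul (i : ι) (z : K) (hz : z ∈ W) : y i * z ∈ W := by
      induction hz using Submodule.span_induction with
      | mem _ h =>
        obtain ⟨S, rfl⟩ := h
        by_cases hi : i ∈ S
        · have h : y i * ∏ j ∈ S, y j = β i • ∏ j ∈ S.erase i, y j := by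
            rw [← Finset.mul_prod_erase S y hi, ← mul_assoc, ← sq, hy, Algebra.smul_def]
          dsimp only
          rw [h]
          exact W.smul_mem _ (Submodule.subset_span ⟨_, rfl⟩)
        · dsimp only
          rw [← Finset.prod_insert hi]
          exact Submodule.subset_span ⟨_, rfl⟩
      | zero => rw [mul_zero]; exact W.zero_mem
      | add p q _ _ hp hq => rw [mul_add]; exact W.add_mem hp hq
      | smul t p _ hp => rw [mul_smul_comm]; exact W.smul_mem t hp
    have hone : (1 : K) ∈ W := Submodule.subset_span ⟨∅, Finset.prod_empty⟩
    rintro ⟨z, hz⟩ -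
    have key : ∀ w ∈ W, (⟨z, hz⟩ : K) * w ∈ W := by
      induction hz using Algebra.adjoin_induction with
      | mem x hx =>
        obtain ⟨i, rfl⟩ := hx
        exact hmul i
      | algebraMap t =>
        intro w hw
        have := W.smul_mem t hw
        rwa [Algebra.smul_def] at this
      | add p q hp hq ihp ihq =>
        intro w hw
        have := W.add_mem (ihp w hw) (ihq w hw)
        rwa [← add_mul] at this
      | mul p q hp hq ihp ihq =>
        intro w hw
        have := ihp _ (ihq w hw)
        rwa [← mul_assoc] at this
    simpa using key 1 hone
  let b := Module.Basis.mk hli hspan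
  have hb (S : Finset ι) : b S = ∏ j ∈ S, y j := by simp [b]
  have : Nontrivial K := ⟨_, _, b.ne_zero ∅⟩
  have : IsLocalRing K :=
    isLocalRing_of_sq_eq_algebraMap fun z => ⟨_, sq_eq_algebraMap_sum hy b hb z⟩
  obtain ⟨t, ⟨B⟩⟩ := exists_basis_of_derivation hβ hy X hXy b hb
  have : Module.Free F K := Module.Free.of_basis b
  have : Module.Free K V := Module.Free.of_basis B
  have ht : t = 1 := by
    have h := Module.finrank_mul_finrank F K V
    rw [hdim, Module.finrank_eq_card_basis b, Module.finrank_eq_card_basis B, Fintype.card_finset,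
      Fintype.card_fin] at h
    exact Nat.eq_of_mul_eq_mul_left (by positivity) (h.trans (mul_one _).symm)
  subst ht
  refine exists_coordinates_of_cyclic hy X hXy (fun i v => ?_) hX b hb (B 0) (fun v => ?_)
    fun l h => ?_
  · have h := LinearMap.congr_fun (hXX i) v
    rwa [sq] at h
  · exact ⟨B.repr v 0, by simpa using B.sum_repr v⟩
  · simpa using congrArg (fun v => B.repr v 0) h

end DifferentialModules

section SymbolFamilies

/-- Elements `x i`, `y i` satisfying the relations of a tensor product of quaternion symbols with
parameters `α i`, `β i`. -/
structure IsSymbolFamily {F E ι : Type*} [Field F] [Ring E] [Algebra F E] (α β : ι → F)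
    (x y : ι → E) : Prop where
  sq_x : ∀ i, x i ^ 2 = x i + algebraMap F E (α i)
  sq_y : ∀ i, y i ^ 2 = algebraMap F E (β i)
  y_mul_x : ∀ i, y i * x i = x i * y i + y i
  comm_x : ∀ i j, Commute (x i) (x j)
  comm_y : ∀ i j, Commute (y i) (y j)
  comm_xy : ∀ i j, i ≠ j → Commute (x i) (y j)

namespace IsSymbolFamily

variable {F E E' ι κ : Type*} [Field F] [Ring E] [Algebra F E] [Ring E'] [Algebra F E']
  {α β : ι → F} {x y : ι → E}

theorem map (h : IsSymbolFamily α β x y) (f : E →ₐ[F] E') :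
    IsSymbolFamily α β (fun i => f (x i)) fun i => f (y i) where
  sq_x i := by rw [← map_pow, h.sq_x, map_add, f.commutes]
  sq_y i := by rw [← map_pow, h.sq_y, f.commutes]
  y_mul_x i := by rw [← map_mul, h.y_mul_x, map_add, map_mul]
  comm_x i j := (h.comm_x i j).map f
  comm_y i j := (h.comm_y i j).map f
  comm_xy i j hij := (h.comm_xy i j hij).map f

theorem of_map {f : E →ₐ[F] E'} (hf : Function.Injective f)
    (h : IsSymbolFamily α β (fun i => f (x i)) fun i => f (y i)) : IsSymbolFamily α β x y where
  sq_x i := hf (by rw [map_pow, h.sq_x, map_add, f.commutes])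
  sq_y i := hf (by rw [map_pow, h.sq_y, f.commutes])
  y_mul_x i := hf (by rw [map_mul, h.y_mul_x, map_add, map_mul])
  comm_x i j := hf (by rw [map_mul, map_mul]; exact h.comm_x i j)
  comm_y i j := hf (by rw [map_mul, map_mul]; exact h.comm_y i j)
  comm_xy i j hij := hf (by rw [map_mul, map_mul]; exact h.comm_xy i j hij)

theorem op [CharP F 2] (h : IsSymbolFamily α β x y) :
    IsSymbolFamily α β (fun i => MulOpposite.op (x i)) fun i => MulOpposite.op (y i) where
  sq_x i := by rw [← MulOpposite.op_pow, h.sq_x]; rfl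
  sq_y i := by rw [← MulOpposite.op_pow, h.sq_y]; rfl
  y_mul_x i := by
    rw [← MulOpposite.op_mul, ← MulOpposite.op_mul, h.y_mul_x, ← MulOpposite.op_add, add_assoc,
      ← two_smul F, CharTwo.two_eq_zero, zero_smul, add_zero]
  comm_x i j := (h.comm_x i j).op
  comm_y i j := (h.comm_y i j).op
  comm_xy i j hij := (h.comm_xy i j hij).op

theorem sumElim (h : IsSymbolFamily α β x y) {α' β' : κ → F} {x' y' : κ → E}
    (h' : IsSymbolFamily α' β' x' y') (hxx : ∀ i j, Commute (x i) (x' j))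
    (hxy : ∀ i j, Commute (x i) (y' j)) (hyx : ∀ i j, Commute (y i) (x' j))
    (hyy : ∀ i j, Commute (y i) (y' j)) :
    IsSymbolFamily (Sum.elim α α') (Sum.elim β β') (Sum.elim x x') (Sum.elim y y') where
  sq_x := by rintro (i | i); exacts [h.sq_x i, h'.sq_x i]
  sq_y := by rintro (i | i); exacts [h.sq_y i, h'.sq_y i]
  y_mul_x := by rintro (i | i); exacts [h.y_mul_x i, h'.y_mul_x i]
  comm_x := by
    rintro (i | i) (j | j)
    exacts [h.comm_x i j, hxx i j, (hxx j i).symm, h'.comm_x i j]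
  comm_y := by
    rintro (i | i) (j | j)
    exacts [h.comm_y i j, hyy i j, (hyy j i).symm, h'.comm_y i j]
  comm_xy := by
    rintro (i | i) (j | j) hij
    exacts [h.comm_xy i j (by simpa using hij), hxy i j, (hyx j i).symm,
      h'.comm_xy i j (by simpa using hij)]

end IsSymbolFamily

open scoped Quaternion

/-- In characteristic two a quaternion symbol is a generalised quaternion algebra. -/
noncomputable def symbolAlgEquivQuaternion {F : Type} [Field F] [CharP F 2] (a b : F) :
    SymbolAlg F 2 a b ≃ₐ[F] ℍ[F,a,1,b] :=
  let q : QuaternionAlgebra.Basis (SymbolAlg F 2 a b) a 1 b :=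
    { i := RingQuot.mkAlgHom F _ (FreeAlgebra.ι F 0)
      j := RingQuot.mkAlgHom F _ (FreeAlgebra.ι F 1)
      k := RingQuot.mkAlgHom F _ (FreeAlgebra.ι F 0) * RingQuot.mkAlgHom F _ (FreeAlgebra.ι F 1)
      i_mul_i := by
        have h := RingQuot.mkAlgHom_rel F (SymbolRel.x (F := F) (p := 2) (a := a) (b := b))
        rw [map_sub, map_pow, AlgHom.commutes, sub_eq_iff_eq_add, sq] at h
        rw [h, one_smul, Algebra.algebraMap_eq_smul_one]
      j_mul_j := by
        have h := RingQuot.mkAlgHom_rel F (SymbolRel.y (F := F) (p := 2) (a := a) (b := b))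
        rw [map_pow, AlgHom.commutes, sq] at h
        rw [h, Algebra.algebraMap_eq_smul_one]
      i_mul_j := rfl
      j_mul_i := by
        have h := RingQuot.mkAlgHom_rel F (SymbolRel.comm (F := F) (p := 2) (a := a) (b := b))
        rw [map_sub, map_mul, map_mul, sub_eq_iff_eq_add] at h
        rw [h, one_smul, sub_eq_add_neg, ← neg_one_smul F, CharTwo.neg_eq, one_smul] }
  let f : SymbolAlg F 2 a b →ₐ[F] ℍ[F,a,1,b] :=
    RingQuot.liftAlgHom F ⟨FreeAlgebra.lift F ![⟨0, 1, 0, 0⟩, ⟨0, 0, 1, 0⟩], by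
      rintro _ _ (_ | _ | _)
      · ext <;> simp [sq]
      · ext <;> simp [sq]
      · ext <;> simp [CharTwo.neg_eq]⟩
  AlgEquiv.ofAlgHom f q.liftHom
    (by
      ext <;> simp [f, q, QuaternionAlgebra.Basis.lift])
    (by
      refine RingQuot.ringQuot_ext' _ _ _ (FreeAlgebra.hom_ext (funext fun i => ?_))
      fin_cases i <;> simp [f, q, QuaternionAlgebra.Basis.lift])

theorem finrank_symbolAlg {F : Type} [Field F] [CharP F 2] (a b : F) :
    Module.finrank F (SymbolAlg F 2 a b) = 4 := by
  rw [(symbolAlgEquivQuaternion a b).toLinearEquiv.finrank_eq, QuaternionAlgebra.finrank_eq_four]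

open scoped PiTensorProduct

theorem finrank_piTensorProduct_symbolAlg {F ι : Type} [Field F] [CharP F 2] [Fintype ι]
    (α β : ι → F) :
    Module.finrank F (⨂[F] i, SymbolAlg F 2 (α i) (β i)) = 4 ^ Fintype.card ι := by
  have : ∀ i, Module.Finite F (SymbolAlg F 2 (α i) (β i)) := fun i =>
    Module.finite_of_finrank_pos (by rw [finrank_symbolAlg]; norm_num)
  classical
  rw [Module.finrank_eq_card_basis (Basis.piTensorProduct fun i =>
    Module.finBasis F (SymbolAlg F 2 (α i) (β i))), Fintype.card_pi]
  simp [finrank_symbolAlg]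

theorem exists_isSymbolFamily_piTensorProduct {F ι : Type} [Field F] [Fintype ι]
    [DecidableEq ι] (α β : ι → F) :
    ∃ x y : ι → ⨂[F] i, SymbolAlg F 2 (α i) (β i), IsSymbolFamily α β x y := by
  let u (i : ι) (t : Fin 2) : SymbolAlg F 2 (α i) (β i) :=
    RingQuot.mkAlgHom F _ (FreeAlgebra.ι F t)
  let S (i : ι) : SymbolAlg F 2 (α i) (β i) →ₐ[F] ⨂[F] i, SymbolAlg F 2 (α i) (β i) :=
    PiTensorProduct.singleAlgHom (A := fun i => SymbolAlg F 2 (α i) (β i)) i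
  have hcomm (i j : ι) (hij : i ≠ j) (s t : Fin 2) : Commute (S i (u i s)) (S j (u j t)) :=
    Commute.tprod (Pi.mulSingle_commute hij _ _)
  have hcomm' (i j : ι) (s : Fin 2) : Commute (S i (u i s)) (S j (u j s)) := by
    obtain rfl | hij := eq_or_ne i j
    exacts [Commute.refl _, hcomm i j hij s s]
  refine ⟨fun i => S i (u i 0), fun i => S i (u i 1),
    fun i => ?_, fun i => ?_, fun i => ?_, fun i j => hcomm' i j 0, fun i j => hcomm' i j 1,
    fun i j hij => hcomm i j hij 0 1⟩
  · have h := RingQuot.mkAlgHom_rel F (SymbolRel.x (F := F) (p := 2) (a := α i) (b := β i))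
    rw [map_sub, map_pow, AlgHom.commutes, sub_eq_iff_eq_add'] at h
    rw [← map_pow, h, map_add, AlgHom.commutes]
  · have h := RingQuot.mkAlgHom_rel F (SymbolRel.y (F := F) (p := 2) (a := α i) (b := β i))
    rw [map_pow, AlgHom.commutes] at h
    rw [← map_pow, h, AlgHom.commutes]
  · have h := RingQuot.mkAlgHom_rel F (SymbolRel.comm (F := F) (p := 2) (a := α i) (b := β i))
    rw [map_sub, map_mul, map_mul, sub_eq_iff_eq_add'] at h
    rw [← map_mul, h, map_add, map_mul]

end SymbolFamilies

section Corners

variable {F : Type*} [Field F]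

theorem finrank_eq_mul_of_equiv_pi {V W : Type*} [AddCommGroup V] [Module F V] [AddCommGroup W]
    [Module F W] [Module.Finite F W] {n : ℕ} (e : V ≃ₗ[F] (Fin n → W)) :
    Module.finrank F V = n * Module.finrank F W := by
  rw [e.finrank_eq, Module.finrank_pi_fintype, Finset.sum_const, Finset.card_univ,
    Fintype.card_fin, smul_eq_mul]

/-- The centralizer of an idempotent matrix unit acts on the range of that unit. -/
theorem exists_finrank_corner.{u} {A : Type*} {V : Type u} [Ring A] [Algebra F A] [AddCommGroup V]
    [Module F V] [Module.Finite F V] {n : ℕ} [NeZero n]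
    (ψ : Matrix (Fin n) (Fin n) A →ₐ[F] Module.End F V) :
    ∃ (T : Type u) (_ : AddCommGroup T) (_ : Module F T)
      (_ : Subalgebra.centralizer F {ψ (Matrix.single 0 0 1)} →ₐ[F] Module.End F T),
      Module.finrank F V = n * Module.finrank F T := by
  set P := ψ (Matrix.single 0 0 1) with hP
  let C := Subalgebra.centralizer F {P}
  let Q : V →ₗ[C] V :=
    { toFun := P
      map_add' := map_add P
      map_smul' := fun c v => LinearMap.congr_fun
        ((Subalgebra.mem_centralizer_iff F).mp c.2 P rfl) v }
  have hmul (i j k : Fin n) (v : V) :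
      ψ (Matrix.single i j 1) (ψ (Matrix.single j k 1) v) = ψ (Matrix.single i k 1) v := by
    rw [← Module.End.mul_apply, ← map_mul, Matrix.single_mul_single_same, one_mul]
  have hfix (w : LinearMap.range Q) : P w = w := by
    obtain ⟨_, v, rfl⟩ := w
    exact hmul 0 0 0 v
  have : Module.Finite F (LinearMap.range Q) :=
    Module.Finite.of_injective ((LinearMap.range Q).subtype.restrictScalars F)
      Subtype.val_injective
  refine ⟨LinearMap.range Q, inferInstance, inferInstance,
    Algebra.lsmul F F (LinearMap.range Q), ?_⟩
  let e : V ≃ₗ[F] (Fin n → LinearMap.range Q) :=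
    { toFun := fun v i => ⟨ψ (Matrix.single 0 i 1) v, ψ (Matrix.single 0 i 1) v, hmul 0 0 i v⟩
      map_add' := fun v w => funext fun i => Subtype.ext (map_add _ v w)
      map_smul' := fun t v => funext fun i => Subtype.ext (map_smul _ t v)
      invFun := fun w => ∑ i, ψ (Matrix.single i 0 1) (w i)
      left_inv := fun v => by
        simp only [hmul]
        rw [← LinearMap.sum_apply, ← map_sum, Matrix.sum_single_one, map_one,
          Module.End.one_apply]
      right_inv := fun w => funext fun i => Subtype.ext (by
        simp only [map_sum]
        rw [Finset.sum_eq_single i]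
        · rw [hmul]
          exact hfix (w i)
        · intro j _ hj
          rw [← Module.End.mul_apply, ← map_mul, Matrix.single_mul_single_of_ne (h := hj.symm),
            map_zero, LinearMap.zero_apply]
        · simp) }
  exact finrank_eq_mul_of_equiv_pi e

/-- Matrices acting on columns. -/
def mulVecAlgHom (F B : Type*) [Field F] [Ring B] [Algebra F B] (m : ℕ) :
    Matrix (Fin m) (Fin m) B →ₐ[F] Module.End F (Fin m → B) where
  toFun M :=
    { toFun := M.mulVec
      map_add' := M.mulVec_add
      map_smul' := M.mulVec_smul }
  map_one' := LinearMap.ext Matrix.one_mulVec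
  map_mul' M N := LinearMap.ext fun v => (Matrix.mulVec_mulVec v M N).symm
  map_zero' := LinearMap.ext Matrix.zero_mulVec
  map_add' M N := LinearMap.ext fun v => Matrix.add_mulVec M N v
  commutes' t := LinearMap.ext fun v => by
    change (algebraMap F (Matrix (Fin m) (Fin m) B) t).mulVec v = t • v
    rw [Algebra.algebraMap_eq_smul_one, Matrix.smul_mulVec, Matrix.one_mulVec]

/-- Brauer equivalent products of symbols have a common module of the expected dimension. -/
theorem exists_symbolFamily_end.{u} [CharP F 2] {A ι κ : Type*} {B : Type u} [Ring A]
    [Algebra F A] [Ring B] [Algebra F B] [Fintype ι] [Fintype κ] {α β : ι → F} {γ ε : κ → F}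
    {x y : ι → A} {x' y' : κ → B}
    (hA : IsSymbolFamily α β x y) (hB : IsSymbolFamily γ ε x' y')
    (hdimA : Module.finrank F A = 4 ^ Fintype.card ι)
    (hdimB : Module.finrank F B = 4 ^ Fintype.card κ) {n m : ℕ} (hn : 0 < n)
    (Φ : Matrix (Fin n) (Fin n) A ≃ₐ[F] Matrix (Fin m) (Fin m) B) :
    ∃ (T : Type u) (_ : AddCommGroup T) (_ : Module F T) (X Y : ι ⊕ κ → Module.End F T),
      IsSymbolFamily (Sum.elim α γ) (Sum.elim β ε) X Y ∧
        Module.finrank F T = 2 ^ Fintype.card (ι ⊕ κ) := by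
  have : NeZero n := ⟨hn.ne'⟩
  have : Module.Finite F A := Module.finite_of_finrank_pos (by rw [hdimA]; positivity)
  have : Module.Finite F B := Module.finite_of_finrank_pos (by rw [hdimB]; positivity)
  let ψ : Matrix (Fin n) (Fin n) A →ₐ[F] Module.End F (Fin m → B) :=
    (mulVecAlgHom F B m).comp Φ.toAlgHom
  obtain ⟨T, _, _, τ, hT⟩ := exists_finrank_corner ψ
  let ρ : A →ₐ[F] Module.End F (Fin m → B) := ψ.comp (Matrix.scalarAlgHom (Fin n) F)
  let σ : Bᵐᵒᵖ →ₐ[F] Module.End F (Fin m → B) := Algebra.lsmul F F (Fin m → B)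
  have hσψ (M : Matrix (Fin n) (Fin n) A) (b : Bᵐᵒᵖ) : Commute (ψ M) (σ b) :=
    LinearMap.ext fun v => (Φ M).mulVec_smul b v
  have hρP (a : A) : Commute (ψ (Matrix.single 0 0 1)) (ρ a) := by
    refine Commute.map ?_ ψ
    change Matrix.single 0 0 1 * Matrix.scalar (Fin n) a =
      Matrix.scalar (Fin n) a * Matrix.single 0 0 1
    ext i j
    simp [Matrix.scalar_apply, Matrix.single_apply]
  have hfam := (hA.map ρ).sumElim (hB.op.map σ) (fun _ _ => hσψ _ _) (fun _ _ => hσψ _ _)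
    (fun _ _ => hσψ _ _) fun _ _ => hσψ _ _
  let C := Subalgebra.centralizer F {ψ (Matrix.single 0 0 1)}
  have hmem (z : Module.End F (Fin m → B)) (hz : Commute (ψ (Matrix.single 0 0 1)) z) : z ∈ C :=
    (Subalgebra.mem_centralizer_iff F).mpr fun _ h => by
      rw [Set.mem_singleton_iff.mp h]
      exact hz
  have hX (i : ι ⊕ κ) : Sum.elim (fun i => ρ (x i)) (fun i => σ (.op (x' i))) i ∈ C := by
    obtain i | i := i
    exacts [hmem _ (hρP _), hmem _ (hσψ _ _)]
  have hY (i : ι ⊕ κ) : Sum.elim (fun i => ρ (y i)) (fun i => σ (.op (y' i))) i ∈ C := by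
    obtain i | i := i
    exacts [hmem _ (hρP _), hmem _ (hσψ _ _)]
  have hfamC : IsSymbolFamily (Sum.elim α γ) (Sum.elim β ε) (fun i => (⟨_, hX i⟩ : C))
      fun i => (⟨_, hY i⟩ : C) :=
    IsSymbolFamily.of_map (f := C.val) Subtype.val_injective hfam
  refine ⟨T, inferInstance, inferInstance, _, _, hfamC.map τ, ?_⟩
  have hdim := Φ.toLinearEquiv.finrank_eq
  rw [Module.finrank_matrix, Module.finrank_matrix, hdimA, hdimB, Fintype.card_fin,
    Fintype.card_fin, show 4 = 2 * 2 from rfl, mul_pow, mul_pow, mul_mul_mul_comm,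
    mul_mul_mul_comm m] at hdim
  have hnm := Nat.mul_self_inj.mp hdim
  rw [finrank_eq_mul_of_equiv_pi (LinearEquiv.refl F (Fin m → B)), hdimB,
    show 4 = 2 * 2 from rfl, mul_pow, ← mul_assoc, ← hnm, mul_assoc, ← pow_add, ← Fintype.card_sum] at hT
  exact (Nat.eq_of_mul_eq_mul_left hn hT).symm

end Corners

open scoped PiTensorProduct in
/-- Let `φ = [a₁,b₁] ⊥ ⋯ ⊥ [aₙ,bₙ]` (`n = m + 2 ≥ 2`) be anisotropic with trivial Arf
invariant over a field of characteristic 2 with `I_q³F = 0` (every quadratic 3-fold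
Pfister form is isotropic). Then the Clifford invariant
`E(φ) = ⊗_{i<n-1} [aᵢbᵢ, bₙbᵢ)` is not Brauer equivalent to any tensor product of fewer
than `n - 1` quaternion algebras. -/
theorem clifford_invariant_length (F : Type) [Field F] [CharP F 2]
    (hI3 : ∀ a b c : F, a ≠ 0 → b ≠ 0 → ∃ v : Fin 4 → F × F, v ≠ 0 ∧
      ∑ i, (![1, a, b, a * b] i) * ((v i).1 ^ 2 + (v i).1 * (v i).2 + c * (v i).2 ^ 2) = 0)
    (m : ℕ) (a b : Fin (m + 2) → F) (haniso : AnisoBin F a b)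
    (harf : ∃ l : F, ∑ i, a i * b i = l ^ 2 + l)
    (k : ℕ) (hk : k < m + 1) (c e : Fin k → F) (he : ∀ i, e i ≠ 0) :
    ¬ BrauerEquiv F
        (⨂[F] (i : Fin (m + 1)), SymbolAlg F 2 (a i.castSucc * b i.castSucc)
          (b (Fin.last (m + 1)) * b i.castSucc))
        (⨂[F] i, SymbolAlg F 2 (c i) (e i)) := by
  classical
  have hb (i : Fin (m + 2)) : b i ≠ 0 := by
    intro h0
    have h := congrFun (haniso (Pi.single i (0, 1)) ?_) i
    · simp at h
    · rw [binSum, Finset.sum_eq_single i]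
      · simp [h0]
      · intro j _ hj
        simp [hj]
      · simp
  rintro ⟨n, l, hn, -, ⟨Φ⟩⟩
  obtain ⟨x, y, hA⟩ := exists_isSymbolFamily_piTensorProduct
    (fun i : Fin (m + 1) => a i.castSucc * b i.castSucc)
    fun i => b (Fin.last (m + 1)) * b i.castSucc
  obtain ⟨x', y', hB⟩ := exists_isSymbolFamily_piTensorProduct c e
  obtain ⟨T, _, _, X, Y, hXY, hT⟩ := exists_symbolFamily_end hA hB
    (finrank_piTensorProduct_symbolAlg _ _) (finrank_piTensorProduct_symbolAlg _ _) hn Φ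
  let β : Fin (m + 1) ⊕ Fin k → Fˣ := Sum.elim
    (fun i => Units.mk0 _ (hb (Fin.last (m + 1))) * Units.mk0 _ (hb i.castSucc))
    fun j => Units.mk0 _ (he j)
  have hβ : Sum.elim (fun i : Fin (m + 1) => b (Fin.last (m + 1)) * b i.castSucc) e =
      fun i => (β i : F) := by
    funext i
    obtain i | i := i <;> rfl
  rw [hβ] at hXY
  obtain ⟨g, f, hgf⟩ := exists_coordinates_of_symbol_action (fun i => (β i).ne_zero) X Y hXY.sq_x
    hXY.sq_y hXY.y_mul_x hXY.comm_x hXY.comm_y hXY.comm_xy hT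
  have hsum := sum_wittPfister_eq_zero hI3 _ β g f hgf
  rw [Fintype.sum_sum_type] at hsum
  exact hk.not_ge (le_of_sum_wittPfister_eq_zero hI3 a (fun i => Units.mk0 _ (hb i)) haniso harf c
    (fun j => Units.mk0 _ (he j)) hsum)
end
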